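/- arXiv:1909.13549 — 2 statements merged into one kernel-verified Lean document; each statement's English description precedes it below -/
import Mathlib

section
/- There exist constants δ_f > 0, C > 0 and N ∈ ℤ+ depending only on f with the following property: for all positive integers n ≥ N, a, k and every positive divisor δ of Π_f such that pδ ∤ Π_f for every prime p dividing k, and such that k² ≤ n^{1/(1+r)} and n ≡ a·f(0) (mod δ), one has |p_f(a, δk; n) − p_f(a, δ; n)/k| ≤ C · (p_f(a, δ; n)/k) · n · exp(−δ_f · k^{−2} · n^{1/(1+r)}). -/
/-- The parts of the partition `π` all lie in `{f ℓ : ℓ ≥ 1}`. -/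
def PartsIn (f : ℤ → ℤ) {n : ℕ} (π : n.Partition) : Prop :=
  ∀ i ∈ π.parts, ∃ ℓ : ℤ, 1 ≤ ℓ ∧ (i : ℤ) = f ℓ

/-- `pf f n` : number of partitions of `n` with all parts in `{f ℓ : ℓ ≥ 1}`. -/
noncomputable def pf (f : ℤ → ℤ) (n : ℕ) : ℕ :=
  Nat.card {π : n.Partition // PartsIn f π}

/-- `pfm f m n` : number of such partitions of `n` with exactly `m` parts. -/
noncomputable def pfm (f : ℤ → ℤ) (m n : ℕ) : ℕ :=
  Nat.card {π : n.Partition // PartsIn f π ∧ Multiset.card π.parts = m}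

/-- `pfa f a k n = Σ_{m ≥ 0, m ≡ a (mod k)} pfm f m n`; note that `pfm f m n = 0`
for `m > n`, so the sum may be truncated at `m = n`. -/
noncomputable def pfa (f : ℤ → ℤ) (a k n : ℕ) : ℕ :=
  ∑ m ∈ Finset.range (n + 1), if m % k = a % k then pfm f m n else 0



namespace PFW

/-- The box of multiplicity functions. -/
def box (T : Finset ℕ) (J : ℕ → ℕ) : Finset (T → ℕ) :=
  Fintype.piFinset (fun s : T => Finset.range (J s + 1))

/-- The weight of a multiplicity function. -/
def wt {T : Finset ℕ} (M : T → ℕ) : ℕ := ∑ s : T, (s : ℕ) * M s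

lemma mem_box {T : Finset ℕ} {J : ℕ → ℕ} {M : T → ℕ} :
    M ∈ box T J ↔ ∀ s : T, M s ≤ J s := by
  simp [box]

lemma sum_box {R : Type*} [CommSemiring R] (T : Finset ℕ) (J : ℕ → ℕ) (z : ℕ → R) :
    ∑ M ∈ box T J, ∏ s : T, z s ^ M s = ∏ s ∈ T, ∑ j ∈ Finset.range (J s + 1), z s ^ j := by
  rw [← Finset.prod_coe_sort T (fun s => ∑ j ∈ Finset.range (J s + 1), z s ^ j),
    Finset.prod_univ_sum]
  rfl

/-- Hybrid. -/
def hyb {T : Finset ℕ} (t : ℕ) (A B : T → ℕ) : T → ℕ := fun s => if (s : ℕ) < t then B s else A s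

lemma hyb_hyb {T : Finset ℕ} (t : ℕ) (A B : T → ℕ) : hyb t (hyb t A B) (hyb t B A) = A := by
  funext s; simp only [hyb]; split_ifs <;> rfl

lemma wt_hyb_add {T : Finset ℕ} (t : ℕ) (A B : T → ℕ) :
    wt (hyb t A B) + wt (hyb t B A) = wt A + wt B := by
  simp only [wt, ← Finset.sum_add_distrib]
  refine Finset.sum_congr rfl fun s _ => ?_
  simp only [hyb]; split_ifs
  · ring
  · ring

lemma wt_hyb_succ {T : Finset ℕ} {H : ℕ} (t : ℕ) (A B : T → ℕ)
    (hB : ∀ s : T, (s : ℕ) * B s ≤ H) :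
    wt (hyb (t + 1) A B) ≤ wt (hyb t A B) + H := by
  by_cases ht : t ∈ T
  · have key : ∀ s : T, (s : ℕ) * hyb (t + 1) A B s ≤
        (s : ℕ) * hyb t A B s + (if s = (⟨t, ht⟩ : T) then H else 0) := by
      intro s
      by_cases hs : s = ⟨t, ht⟩
      · subst hs
        have := hB ⟨t, ht⟩
        simp only [hyb]
        simp
        simp at this
        omega
      · have hs' : (s : ℕ) ≠ t := fun h => hs (Subtype.ext h)
        have : ((s : ℕ) < t + 1) ↔ ((s : ℕ) < t) := by omega
        simp [hyb, this]
    calc wt (hyb (t + 1) A B) ≤ ∑ s : T, ((s : ℕ) * hyb t A B s +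
          (if s = (⟨t, ht⟩ : T) then H else 0)) := Finset.sum_le_sum fun s _ => key s
      _ = wt (hyb t A B) + H := by
          rw [Finset.sum_add_distrib]; simp [wt]
  · have : hyb (t + 1) A B = hyb t A B := by
      funext s
      have hs' : (s : ℕ) ≠ t := fun h => ht (h ▸ s.2)
      have : ((s : ℕ) < t + 1) ↔ ((s : ℕ) < t) := by omega
      simp [hyb, this]
    rw [this]; omega

/-- fiber of the box -/
def fib (T : Finset ℕ) (J : ℕ → ℕ) (m : ℕ) : Finset (T → ℕ) := (box T J).filter (fun M => wt M = m)

lemma exists_hyb {T : Finset ℕ} {n H ν : ℕ} (hT : ∀ s ∈ T, s ≤ n) (A B : T → ℕ)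
    (hB : ∀ s : T, (s : ℕ) * B s ≤ H) (hA : wt A ≤ ν) (hBν : ν ≤ wt B) :
    ∃ t ∈ Finset.range (n + 2), wt (hyb t A B) ∈ Finset.Icc ν (ν + H) := by
  classical
  have hex : ∃ t, ν ≤ wt (hyb t A B) := by
    refine ⟨n + 1, ?_⟩
    have : hyb (n + 1) A B = B := by
      funext s; have := hT s s.2
      simp [hyb, this]
    rwa [this]
  have h1 := Nat.find_spec hex
  have h0 : hyb 0 A B = A := by funext s; simp [hyb]
  refine ⟨Nat.find hex, ?_, ?_⟩
  · have : Nat.find hex ≤ n + 1 := by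
      apply Nat.find_min'
      have : hyb (n + 1) A B = B := by
        funext s; have := hT s s.2
        simp [hyb, this]
      rwa [this]
    rw [Finset.mem_range]; omega
  · rw [Finset.mem_Icc]
    refine ⟨h1, ?_⟩
    rcases hh : Nat.find hex with _ | t
    · rw [h0]; omega
    · have := Nat.find_min hex (m := t) (by omega)
      have h2 := wt_hyb_succ (H := H) t A B hB
      omega

lemma fib_mul_le (T : Finset ℕ) (n H ν m1 m2 : ℕ) (hT : ∀ s ∈ T, s ≤ n)
    (h1 : m1 ≤ ν) (h2 : ν ≤ m2) :
    (fib T (fun s => H / s) m1).card * (fib T (fun s => H / s) m2).card ≤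
      ∑ _t ∈ Finset.range (n + 2), ∑ n' ∈ (Finset.Icc ν (ν + H)).filter (· ≤ m1 + m2),
        (fib T (fun s => H / s) n').card * (fib T (fun s => H / s) (m1 + m2 - n')).card := by
  classical
  have key : ∀ A ∈ fib T (fun s => H / s) m1, ∀ B ∈ fib T (fun s => H / s) m2,
      ∃ t ∈ Finset.range (n + 2), wt (hyb t A B) ∈ Finset.Icc ν (ν + H) := by
    intro A hA B hB
    simp only [fib, Finset.mem_filter, mem_box] at hA hB
    refine exists_hyb hT A B (fun s => ?_) (hA.2.trans_le h1) (h2.trans_eq hB.2.symm)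
    exact (Nat.mul_le_mul_left _ (hB.1 s)).trans (Nat.mul_div_le _ _)
  choose! tt htt hwt using key
  set F := fib T (fun s => H / s) with hF
  let U : Finset (Σ _ : ℕ, Σ _ : ℕ, (T → ℕ) × (T → ℕ)) :=
    (Finset.range (n + 2)).sigma (fun _ => ((Finset.Icc ν (ν + H)).filter (· ≤ m1 + m2)).sigma
      (fun n' => F n' ×ˢ F (m1 + m2 - n')))
  have hU : U.card = ∑ _t ∈ Finset.range (n + 2), ∑ n' ∈ (Finset.Icc ν (ν + H)).filter (· ≤ m1 + m2),
        (F n').card * (F (m1 + m2 - n')).card := by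
    simp only [U, Finset.card_sigma, Finset.card_product]
  rw [← hU, ← Finset.card_product]
  have hbox : ∀ t, ∀ A B : T → ℕ, A ∈ box T (fun s => H / s) → B ∈ box T (fun s => H / s) →
      hyb t A B ∈ box T (fun s => H / s) := by
    intro t A B hA hB
    rw [mem_box] at *
    intro s
    simp only [hyb]; split_ifs
    · exact hB s
    · exact hA s
  refine Finset.card_le_card_of_injOn (fun p => ⟨tt p.1 p.2, ⟨wt (hyb (tt p.1 p.2) p.1 p.2),
    (hyb (tt p.1 p.2) p.1 p.2, hyb (tt p.1 p.2) p.2 p.1)⟩⟩) ?_ ?_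
  · rintro ⟨A, B⟩ hp
    rw [Finset.mem_coe, Finset.mem_product] at hp
    have ha := htt A hp.1 B hp.2
    have hb := hwt A hp.1 B hp.2
    have hadd := wt_hyb_add (tt A B) A B
    simp only [hF, fib, Finset.mem_filter] at hp
    simp only [U, hF, fib, Finset.coe_sigma, Set.mem_sigma_iff, Finset.mem_coe, 
      Finset.mem_product, Finset.mem_filter]
    rw [hp.1.2, hp.2.2] at hadd
    refine ⟨ha, ⟨hb, by omega⟩, ⟨hbox _ _ _ hp.1.1 hp.2.1, trivial⟩, hbox _ _ _ hp.2.1 hp.1.1, ?_⟩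
    omega
  · rintro ⟨A, B⟩ hp ⟨A', B'⟩ hp' h
    simp only [Sigma.mk.injEq, heq_eq_eq, Prod.mk.injEq] at h
    obtain ⟨h1, -, h2, h3⟩ := h
    have e1 := hyb_hyb (tt A B) A B
    have e2 := hyb_hyb (tt A B) B A
    rw [h2, h3, h1, hyb_hyb] at e1
    rw [h2, h3, h1, hyb_hyb] at e2
    rw [e1, e2]

/-- generating function of the box -/
noncomputable def GH (T : Finset ℕ) (H : ℕ) (y : ℝ) : ℝ :=
  ∏ s ∈ T, ∑ j ∈ Finset.range (H / s + 1), Real.exp (-(y * s)) ^ j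

lemma GH_pos (T : Finset ℕ) (H : ℕ) (y : ℝ) : 0 < GH T H y := by
  refine Finset.prod_pos fun s _ => Finset.sum_pos (fun j _ => by positivity) ⟨0, by simp⟩

lemma GH_cont (T : Finset ℕ) (H : ℕ) : Continuous (GH T H) := by
  unfold GH; fun_prop

lemma exp_wt {T : Finset ℕ} (M : T → ℕ) (y : ℝ) :
    ∏ s : T, Real.exp (-(y * (s : ℕ))) ^ M s = Real.exp (-(wt M * y)) := by
  simp only [← Real.exp_nat_mul, ← Real.exp_sum]
  congr 1
  simp only [wt]; push_cast
  rw [Finset.sum_mul, ← Finset.sum_neg_distrib]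
  refine Finset.sum_congr rfl fun s _ => ?_
  ring

lemma wt_le {T : Finset ℕ} {n H : ℕ} (hT : T ⊆ Finset.Icc 1 n) {M : T → ℕ}
    (hM : M ∈ box T (fun s => H / s)) : wt M ≤ n * H := by
  rw [mem_box] at hM
  calc wt M ≤ ∑ s : T, H := Finset.sum_le_sum fun s _ =>
        (Nat.mul_le_mul_left _ (hM s)).trans (Nat.mul_div_le _ _)
    _ = T.card * H := by simp
    _ ≤ n * H := by
        have := Finset.card_le_card hT
        simp at this
        exact Nat.mul_le_mul_right _ this

lemma GH_eq {T : Finset ℕ} {n H : ℕ} (hT : T ⊆ Finset.Icc 1 n) (y : ℝ) :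
    GH T H y = ∑ m ∈ Finset.range (n * H + 1),
      ((fib T (fun s => H / s) m).card : ℝ) * Real.exp (-(m * y)) := by
  have h1 : GH T H y = ∑ M ∈ box T (fun s => H / s), Real.exp (-(wt M * y)) := by
    rw [GH, ← sum_box T (fun s => H / s) (fun s => Real.exp (-(y * s)))]
    exact Finset.sum_congr rfl fun M _ => exp_wt M y
  rw [h1, ← Finset.sum_fiberwise_of_maps_to (g := wt) (t := Finset.range (n * H + 1))
    (fun M hM => Finset.mem_range.2 (Nat.lt_succ_of_le (wt_le hT hM)))]
  refine Finset.sum_congr rfl fun m _ => ?_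
  rw [← nsmul_eq_mul]
  refine Finset.sum_eq_card_nsmul fun M hM => ?_
  rw [(Finset.mem_filter.1 hM).2]

lemma fib_le_GH {T : Finset ℕ} {n H : ℕ} (hT : T ⊆ Finset.Icc 1 n) (y : ℝ) (m : ℕ) :
    ((fib T (fun s => H / s) m).card : ℝ) * Real.exp (-(m * y)) ≤ GH T H y := by
  by_cases hm : m < n * H + 1
  · rw [GH_eq hT]
    exact Finset.single_le_sum (f := fun m : ℕ => ((fib T (fun s => H / s) m).card : ℝ) *
      Real.exp (-(m * y))) (fun i _ => by positivity) (Finset.mem_range.2 hm)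
  · have : fib T (fun s => H / s) m = ∅ := by
      rw [fib, Finset.filter_eq_empty_iff]
      intro M hM h
      have := wt_le hT hM
      omega
    rw [this]; simp [(GH_pos T H y).le]

lemma local_lower (T : Finset ℕ) (n H ν : ℕ) (hT : T ⊆ Finset.Icc 1 n) (a b : ℝ)
    (ha : 0 < a) (hab : a ≤ b)
    (hA : (n * H + 1) * (Real.exp (ν * a) * GH T H (2 * a)) < GH T H a)
    (hB : (n * H + 1) * (Real.exp (-(ν * (b / 2))) * GH T H (b / 2)) < GH T H b) :
    ∃ x ∈ Set.Icc a b, ∃ n' ∈ Finset.Icc ν (ν + H),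
      GH T H x ≤ 2 * ((n * H + 1) ^ 2 * ((n + 2) * (H + 1))) *
        (((fib T (fun s => H / s) n').card : ℝ) * Real.exp (-(n' * x))) := by
  classical
  set q : ℕ → ℝ := fun m => ((fib T (fun s => H / s) m).card : ℝ) with hq
  set R : ℕ := n * H with hR
  have hRr : ((R : ℕ) : ℝ) = n * H := by simp [hR]
  -- good m
  have good : ∀ x : ℝ, ∃ m ∈ Finset.range (R + 1), GH T H x ≤ (n * H + 1) * (q m * Real.exp (-(m * x))) := by
    intro x
    by_contra! hcon
    have h1 : ∑ m ∈ Finset.range (R + 1), ((n : ℝ) * H + 1) * (q m * Real.exp (-(m * x))) <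
        ∑ m ∈ Finset.range (R + 1), GH T H x :=
      Finset.sum_lt_sum_of_nonempty ⟨0, by simp⟩ hcon
    rw [← Finset.mul_sum, ← GH_eq hT] at h1
    simp [hRr] at h1
  let C1 : Set ℝ := ⋃ m ∈ (Finset.range (R + 1)).filter (· ≤ ν),
    {x | GH T H x ≤ (n * H + 1) * (q m * Real.exp (-(m * x)))}
  let C2 : Set ℝ := ⋃ m ∈ (Finset.range (R + 1)).filter (ν ≤ ·),
    {x | GH T H x ≤ (n * H + 1) * (q m * Real.exp (-(m * x)))}
  have hcl : ∀ m : ℕ, IsClosed {x | GH T H x ≤ (n * H + 1) * (q m * Real.exp (-(m * x)))} := by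
    intro m
    refine isClosed_le (GH_cont T H) ?_
    fun_prop
  have hC1 : IsClosed C1 := isClosed_biUnion_finset fun m _ => hcl m
  have hC2 : IsClosed C2 := isClosed_biUnion_finset fun m _ => hcl m
  have hcov : Set.Icc a b ⊆ C1 ∪ C2 := by
    intro x _
    obtain ⟨m, hm, h⟩ := good x
    rcases le_total m ν with hmν | hmν
    · left
      simp only [C1, Set.mem_iUnion]
      exact ⟨m, Finset.mem_filter.2 ⟨hm, hmν⟩, h⟩
    · right
      simp only [C2, Set.mem_iUnion]
      exact ⟨m, Finset.mem_filter.2 ⟨hm, hmν⟩, h⟩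
  have hpos : (0 : ℝ) < n * H + 1 := by positivity
  have hne1 : (Set.Icc a b ∩ C1).Nonempty := by
    refine ⟨b, ⟨hab, le_rfl⟩, ?_⟩
    obtain ⟨m, hm, h⟩ := good b
    simp only [C1, Set.mem_iUnion]
    refine ⟨m, Finset.mem_filter.2 ⟨hm, ?_⟩, h⟩
    by_contra hlt
    push Not at hlt
    have h2 := fib_le_GH (H := H) hT (b / 2) m
    have h3 : q m * Real.exp (-(m * b)) ≤ Real.exp (-(ν * (b / 2))) * GH T H (b / 2) := by
      calc q m * Real.exp (-(m * b)) = Real.exp (-(m * (b / 2))) * (q m * Real.exp (-(m * (b / 2)))) := by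
            rw [mul_left_comm, ← Real.exp_add]; congr 2; ring
        _ ≤ _ := by
            refine mul_le_mul ?_ h2 (by positivity) (by positivity)
            have : (ν : ℝ) ≤ m := by exact_mod_cast hlt.le
            have hb : 0 ≤ b / 2 := by linarith
            rw [Real.exp_le_exp]; nlinarith
    have := mul_le_mul_of_nonneg_left h3 hpos.le
    linarith
  have hne2 : (Set.Icc a b ∩ C2).Nonempty := by
    refine ⟨a, ⟨le_rfl, hab⟩, ?_⟩
    obtain ⟨m, hm, h⟩ := good a
    simp only [C2, Set.mem_iUnion]
    refine ⟨m, Finset.mem_filter.2 ⟨hm, ?_⟩, h⟩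
    by_contra hlt
    push Not at hlt
    have h2 := fib_le_GH (H := H) hT (2 * a) m
    have h3 : q m * Real.exp (-(m * a)) ≤ Real.exp (ν * a) * GH T H (2 * a) := by
      calc q m * Real.exp (-(m * a)) = Real.exp (m * a) * (q m * Real.exp (-(m * (2 * a)))) := by
            rw [mul_left_comm, ← Real.exp_add]; congr 2; ring
        _ ≤ _ := by
            refine mul_le_mul ?_ h2 (by positivity) (by positivity)
            have : (m : ℝ) ≤ ν := by exact_mod_cast hlt.le
            rw [Real.exp_le_exp]; nlinarith
    have := mul_le_mul_of_nonneg_left h3 hpos.le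
    linarith
  obtain ⟨x, hx, hx1, hx2⟩ := isPreconnected_closed_iff.1 isPreconnected_Icc C1 C2 hC1 hC2 hcov hne1 hne2
  simp only [C1, C2, Set.mem_iUnion] at hx1 hx2
  obtain ⟨m1, hm1, hg1⟩ := hx1
  obtain ⟨m2, hm2, hg2⟩ := hx2
  simp only [Set.mem_ofPred_eq] at hg1 hg2
  have hm1' := (Finset.mem_filter.1 hm1).2
  have hm2' := (Finset.mem_filter.1 hm2).2
  refine ⟨x, hx, ?_⟩
  by_contra! hcon
  have hmul := fib_mul_le T n H ν m1 m2 (fun s hs => (Finset.mem_Icc.1 (hT hs)).2) hm1' hm2'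
  have hmul' : q m1 * q m2 ≤ ∑ _t ∈ Finset.range (n + 2), ∑ n' ∈ (Finset.Icc ν (ν + H)).filter (· ≤ m1 + m2),
      q n' * q (m1 + m2 - n') := by
    simp only [hq]
    exact_mod_cast hmul
  set G := GH T H x with hG
  have hGpos : 0 < G := GH_pos T H x
  set K : ℝ := 2 * ((n * H + 1) ^ 2 * ((n + 2) * (H + 1))) with hK
  have hKpos : 0 < K := by positivity
  have hterm : ∀ n' ∈ (Finset.Icc ν (ν + H)).filter (· ≤ m1 + m2),
      q n' * q (m1 + m2 - n') * Real.exp (-((m1 + m2) * x)) ≤ G / K * G := by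
    intro n' hn'
    rw [Finset.mem_filter] at hn'
    have hc := hcon n' hn'.1
    have hle := hn'.2
    have hc1 : q n' * Real.exp (-(n' * x)) < G / K := by
      rw [lt_div_iff₀ hKpos, mul_comm]; exact hc
    have h4 := fib_le_GH (H := H) hT x (m1 + m2 - n')
    have e : q n' * q (m1 + m2 - n') * Real.exp (-((m1 + m2) * x)) =
        (q n' * Real.exp (-(n' * x))) * (q (m1 + m2 - n') * Real.exp (-(((m1 + m2 - n' : ℕ) : ℝ) * x))) := by
      rw [Nat.cast_sub hle]; push_cast
      have : Real.exp (-((m1 + m2) * x)) = Real.exp (-(n' * x)) * Real.exp (-((m1 + m2 - n') * x)) := by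
        rw [← Real.exp_add]; congr 1; ring
      rw [this]; ring
    rw [e]
    calc _ ≤ (q n' * Real.exp (-(n' * x))) * G := mul_le_mul_of_nonneg_left h4 (by positivity)
      _ ≤ _ := (mul_lt_mul_of_pos_right hc1 hGpos).le
  have hsum : q m1 * q m2 * Real.exp (-((m1 + m2) * x)) ≤ (n + 2) * ((H + 1) * (G / K * G)) := by
    calc q m1 * q m2 * Real.exp (-((m1 + m2) * x)) ≤
        (∑ _t ∈ Finset.range (n + 2), ∑ n' ∈ (Finset.Icc ν (ν + H)).filter (· ≤ m1 + m2),
          q n' * q (m1 + m2 - n')) * Real.exp (-((m1 + m2) * x)) :=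
          mul_le_mul_of_nonneg_right hmul' (by positivity)
      _ = (n + 2) * ∑ n' ∈ (Finset.Icc ν (ν + H)).filter (· ≤ m1 + m2),
          q n' * q (m1 + m2 - n') * Real.exp (-((m1 + m2) * x)) := by
          rw [Finset.sum_const, Finset.card_range, nsmul_eq_mul, mul_assoc, Finset.sum_mul]
          push_cast; ring
      _ ≤ (n + 2) * ((H + 1) * (G / K * G)) := by
          refine mul_le_mul_of_nonneg_left ?_ (by positivity)
          refine (Finset.sum_le_card_nsmul _ _ _ hterm).trans ?_
          rw [nsmul_eq_mul]
          refine mul_le_mul_of_nonneg_right ?_ (by positivity)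
          have : ((Finset.Icc ν (ν + H)).filter (· ≤ m1 + m2)).card ≤ H + 1 := by
            refine (Finset.card_filter_le _ _).trans ?_
            simp; omega
          exact_mod_cast this
  have hlow : G * G ≤ (n * H + 1) ^ 2 * (q m1 * q m2 * Real.exp (-((m1 + m2) * x))) := by
    have := mul_le_mul hg1 hg2 hGpos.le (by positivity)
    refine this.trans_eq ?_
    have : Real.exp (-((m1 + m2) * x)) = Real.exp (-(m1 * x)) * Real.exp (-(m2 * x)) := by
      rw [← Real.exp_add]; congr 1; ring
    rw [this]; ring
  have h6 : G * G ≤ (n * H + 1) ^ 2 * ((n + 2) * ((H + 1) * (G / K * G))) :=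
    hlow.trans (mul_le_mul_of_nonneg_left hsum (by positivity))
  have h7 : ((n : ℝ) * H + 1) ^ 2 * ((n + 2) * ((H + 1) * (G / K * G))) = G * G / 2 := by
    rw [hK]; field_simp
  rw [h7] at h6
  have := mul_pos hGpos hGpos
  linarith

end PFW


namespace PFW

/-- membership in the set of allowed parts -/
def IsPart (f : ℤ → ℤ) (s : ℕ) : Prop := ∃ ℓ : ℤ, 1 ≤ ℓ ∧ (s : ℤ) = f ℓ

open Classical in
/-- allowed parts up to n -/
noncomputable def Tn (f : ℤ → ℤ) (n : ℕ) : Finset ℕ := (Finset.Icc 1 n).filter (IsPart f)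

/-- multiset attached to a multiplicity function -/
def toMS {T : Finset ℕ} (M : T → ℕ) : Multiset ℕ := ∑ s : T, Multiset.replicate (M s) (s : ℕ)

lemma count_toMS {T : Finset ℕ} (M : T → ℕ) (s : T) : (toMS M).count (s : ℕ) = M s := by
  simp only [toMS, Multiset.count_sum', Multiset.count_replicate]
  rw [Finset.sum_eq_single s]
  · simp
  · intro b _ hb
    rw [if_neg]
    exact fun h => hb (Subtype.ext h)
  · simp

lemma toMS_inj {T : Finset ℕ} : Function.Injective (toMS (T := T)) := by
  intro A B h
  funext s
  rw [← count_toMS A s, ← count_toMS B s, h]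

lemma sum_toMS {T : Finset ℕ} (M : T → ℕ) : (toMS M).sum = wt M := by
  simp only [toMS, wt, Multiset.sum_sum, Multiset.sum_replicate, smul_eq_mul]
  exact Finset.sum_congr rfl fun s _ => mul_comm _ _

lemma card_toMS {T : Finset ℕ} (M : T → ℕ) : Multiset.card (toMS M) = ∑ s, M s := by
  simp [toMS]

lemma mem_toMS {T : Finset ℕ} {M : T → ℕ} {i : ℕ} (h : i ∈ toMS M) : i ∈ T := by
  simp only [toMS, Multiset.mem_sum] at h
  obtain ⟨s, -, hs⟩ := h
  rw [Multiset.eq_of_mem_replicate hs]; exact s.2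

lemma fib_card_le_pf (f : ℤ → ℤ) (T : Finset ℕ) (hT : ∀ s ∈ T, 0 < s ∧ IsPart f s) (J : ℕ → ℕ)
    (m n : ℕ) (E : Multiset ℕ) (hE : ∀ i ∈ E, 0 < i ∧ IsPart f i) (hsum : m + E.sum = n) :
    (fib T J m).card ≤ pf f n := by
  classical
  rw [pf, Nat.card_eq_fintype_card, ← Fintype.card_coe]
  refine Fintype.card_le_of_injective (fun M : fib T J m =>
    (⟨⟨toMS M.1 + E, ?_, ?_⟩, ?_⟩ : {π : n.Partition // PartsIn f π})) ?_
  · intro i hi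
    rcases Multiset.mem_add.1 hi with h | h
    · exact (hT _ (mem_toMS h)).1
    · exact (hE _ h).1
  · rw [Multiset.sum_add, sum_toMS, (Finset.mem_filter.1 M.2).2, hsum]
  · intro i hi
    rcases Multiset.mem_add.1 hi with h | h
    · exact (hT _ (mem_toMS h)).2
    · exact (hE _ h).2
  · intro A B h
    have h1 := congrArg (fun p : {π : n.Partition // PartsIn f π} => p.1.parts) h
    exact Subtype.ext (toMS_inj (add_right_cancel h1))

open Classical in
/-- the finset of allowed partitions -/
noncomputable def Pn (f : ℤ → ℤ) (n : ℕ) : Finset n.Partition :=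
  Finset.univ.filter (fun π => PartsIn f π)

lemma sum_Pn (f : ℤ → ℤ) (n : ℕ) (z : ℂ) :
    ∑ π ∈ Pn f n, z ^ (Multiset.card π.parts) =
      ∑ M ∈ fib (Tn f n) (fun _ => n) n, z ^ (∑ s, M s) := by
  classical
  symm
  have hT : ∀ s ∈ Tn f n, 0 < s ∧ IsPart f s := by
    intro s hs
    simp only [Tn, Finset.mem_filter, Finset.mem_Icc] at hs
    exact ⟨hs.1.1, hs.2⟩
  refine Finset.sum_bij (fun M hM => (⟨toMS M, fun {i} hi => (hT i (mem_toMS hi)).1, by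
    rw [sum_toMS, (Finset.mem_filter.1 hM).2]⟩ : n.Partition)) ?_ ?_ ?_ ?_
  · intro M hM
    simp only [Pn, Finset.mem_filter, Finset.mem_univ, true_and]
    intro i hi
    exact (hT i (mem_toMS hi)).2
  · intro A _ B _ h
    simp only [Nat.Partition.mk.injEq] at h
    exact toMS_inj h
  · intro π hπ
    simp only [Pn, Finset.mem_filter, Finset.mem_univ, true_and] at hπ
    have hle : ∀ i ∈ π.parts, i ≤ n := fun i hi => by
      have := Multiset.le_sum_of_mem hi
      rwa [π.parts_sum] at this
    have hmem : ∀ i ∈ π.parts, i ∈ Tn f n := by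
      intro i hi
      simp only [Tn, Finset.mem_filter, Finset.mem_Icc]
      exact ⟨⟨π.parts_pos hi, hle i hi⟩, hπ i hi⟩
    have hto : toMS (fun s : Tn f n => π.parts.count (s : ℕ)) = π.parts := by
      ext i
      by_cases hi : i ∈ Tn f n
      · exact count_toMS (fun s : Tn f n => π.parts.count (s : ℕ)) ⟨i, hi⟩
      · rw [Multiset.count_eq_zero_of_notMem (fun h => hi (mem_toMS h)),
          Multiset.count_eq_zero_of_notMem (fun h => hi (hmem i h))]
    refine ⟨fun s => π.parts.count (s : ℕ), ?_, ?_⟩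
    · rw [fib, Finset.mem_filter, mem_box]
      constructor
      · intro s
        have h1 : (s : ℕ) * π.parts.count (s : ℕ) ≤ wt (fun s : Tn f n => π.parts.count (s : ℕ)) :=
          Finset.single_le_sum (f := fun s : Tn f n => (s : ℕ) * π.parts.count (s : ℕ))
            (fun _ _ => Nat.zero_le _) (Finset.mem_univ s)
        rw [← sum_toMS, hto, π.parts_sum] at h1
        exact (Nat.le_mul_of_pos_left _ (hT s s.2).1).trans h1
      · rw [← sum_toMS, hto, π.parts_sum]
    · ext1; exact hto
  · intro M hM
    simp only [card_toMS]

lemma pf_eq (f : ℤ → ℤ) (n : ℕ) : pf f n = (Pn f n).card := by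
  classical
  rw [pf, Nat.card_eq_fintype_card, Fintype.card_subtype]; rfl

lemma pfa_eq (f : ℤ → ℤ) (a K n : ℕ) :
    pfa f a K n = ((Pn f n).filter (fun π => Multiset.card π.parts % K = a % K)).card := by
  classical
  have hc : ∀ π : n.Partition, Multiset.card π.parts ≤ n := by
    intro π
    have := Multiset.card_nsmul_le_sum (s := π.parts) (a := 1) (fun i hi => π.parts_pos hi)
    rw [π.parts_sum] at this
    simpa using this
  have h1 : ∀ m, pfm f m n = ((Pn f n).filter (fun π => Multiset.card π.parts = m)).card := by
    intro m
    rw [pfm, Nat.card_eq_fintype_card, Fintype.card_subtype, Pn, Finset.filter_filter]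
  rw [Finset.card_eq_sum_card_fiberwise (f := fun π : n.Partition => Multiset.card π.parts)
    (t := Finset.range (n + 1)) (fun π _ => by
      simpa [Nat.lt_succ_iff] using hc π)]
  rw [pfa]
  refine Finset.sum_congr rfl fun m _ => ?_
  rw [Finset.filter_filter, h1]
  split_ifs with h
  · congr 1
    refine Finset.filter_congr fun π _ => ?_
    constructor
    · rintro rfl; exact ⟨h, rfl⟩
    · exact fun h => h.2
  · symm
    rw [Finset.card_eq_zero, Finset.filter_eq_empty_iff]
    rintro π - ⟨h2, rfl⟩
    exact h h2

/-- additive character -/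
noncomputable def ee (t : ℝ) : ℂ := Complex.exp (2 * Real.pi * t * Complex.I)

lemma ee_add (s t : ℝ) : ee (s + t) = ee s * ee t := by
  rw [ee, ee, ee, ← Complex.exp_add]; congr 1; push_cast; ring

lemma ee_int (d : ℤ) : ee d = 1 := by
  rw [ee, Complex.exp_eq_one_iff]; exact ⟨d, by push_cast; ring⟩

lemma ee_zero : ee 0 = 1 := by simpa using ee_int 0

lemma ee_nsmul (h : ℕ) (t : ℝ) : ee (h * t) = ee t ^ h := by
  rw [ee, ee, ← Complex.exp_nat_mul]; congr 1; push_cast; ring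

lemma norm_ee (t : ℝ) : ‖ee t‖ = 1 := by
  have : (2 * Real.pi * t * Complex.I : ℂ) = ((2 * Real.pi * t : ℝ) : ℂ) * Complex.I := by
    push_cast; ring
  rw [ee, this, Complex.norm_exp_ofReal_mul_I]

lemma ee_eq_one {t : ℝ} (h : ee t = 1) : ∃ d : ℤ, t = d := by
  rw [ee, Complex.exp_eq_one_iff] at h
  obtain ⟨d, hd⟩ := h
  refine ⟨d, ?_⟩
  have h2 : (2 * Real.pi * Complex.I : ℂ) ≠ 0 := Complex.two_pi_I_ne_zero
  have : (t : ℂ) = d := mul_left_cancel₀ h2 (by rw [mul_comm _ (d : ℂ), ← hd]; ring)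
  exact_mod_cast this

lemma orth (K : ℕ) (hK : 0 < K) (d : ℤ) :
    ∑ h ∈ Finset.range K, ee (h * ((d : ℝ) / K)) = if (K : ℤ) ∣ d then (K : ℂ) else 0 := by
  simp only [ee_nsmul]
  have hK' : (K : ℝ) ≠ 0 := by positivity
  split_ifs with hd
  · obtain ⟨c, rfl⟩ := hd
    have : ((((K : ℤ) * c : ℤ) : ℝ) / K) = (c : ℤ) := by push_cast; field_simp
    rw [this, ee_int]; simp
  · have hne : ee ((d : ℝ) / K) ≠ 1 := by
      intro h
      obtain ⟨c, hc⟩ := ee_eq_one h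
      apply hd
      refine ⟨c, ?_⟩
      field_simp at hc
      exact_mod_cast hc
    rw [geom_sum_eq hne, ← ee_nsmul]
    have : (K : ℝ) * ((d : ℝ) / K) = d := by field_simp
    rw [this, ee_int]; simp

lemma coeff_bound (T : Finset ℕ) (J : ℕ → ℕ) (m : ℕ) (x B : ℝ) (ζ : ℂ)
    (hB : ∀ θ : ℝ, ‖∏ s ∈ T, ∑ j ∈ Finset.range (J s + 1),
      (ζ * ee (s * θ) * (Real.exp (-(x * s)) : ℝ)) ^ j‖ ≤ B) :
    ‖∑ M ∈ fib T J m, ζ ^ (∑ s, M s)‖ ≤ Real.exp (m * x) * B := by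
  classical
  obtain ⟨Q, hQ0, hQm, hQ⟩ : ∃ Q : ℕ, 0 < Q ∧ m < Q ∧ ∀ M ∈ box T J, wt M < Q := by
    refine ⟨m + 1 + ∑ M ∈ box T J, wt M, by omega, by omega, fun M hM => ?_⟩
    have := Finset.single_le_sum (f := fun M : T → ℕ => wt M) (fun _ _ => Nat.zero_le _) hM
    omega
  have hQr : (Q : ℂ) ≠ 0 := by exact_mod_cast hQ0.ne'
  have e1 : ∀ θ : ℝ, ∏ s ∈ T, ∑ j ∈ Finset.range (J s + 1),
      (ζ * ee (s * θ) * (Real.exp (-(x * s)) : ℝ)) ^ j =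
      ∑ M ∈ box T J, ζ ^ (∑ s, M s) * ee (wt M * θ) * (Real.exp (-(wt M * x)) : ℝ) := by
    intro θ
    rw [← sum_box T J (fun s => ζ * ee (s * θ) * (Real.exp (-(x * s)) : ℝ))]
    refine Finset.sum_congr rfl fun M _ => ?_
    simp only [mul_pow, Finset.prod_mul_distrib]
    congr 1
    · congr 1
      · rw [Finset.prod_pow_eq_pow_sum]
      · simp only [← ee_nsmul]
        have : ∀ U : Finset T, ∏ s ∈ U, ee (M s * ((s : ℕ) * θ)) = ee ((∑ s ∈ U, ((s : ℕ) : ℝ) * M s) * θ) := by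
          intro U
          induction U using Finset.induction_on with
          | empty => simp [ee_zero]
          | insert a U ha ih =>
            rw [Finset.prod_insert ha, Finset.sum_insert ha, ih, ← ee_add]; congr 1; ring
        rw [this]; simp [wt]
    · rw [← exp_wt]; push_cast; rfl
  have key : (Q : ℂ) * ∑ M ∈ fib T J m, ζ ^ (∑ s, M s) * (Real.exp (-(m * x)) : ℝ) =
      ∑ h ∈ Finset.range Q, ee (-(m * (h / Q))) * ∏ s ∈ T, ∑ j ∈ Finset.range (J s + 1),
      (ζ * ee (s * (h / Q)) * (Real.exp (-(x * s)) : ℝ)) ^ j := by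
    simp only [e1, Finset.mul_sum]
    rw [Finset.sum_comm, fib, Finset.sum_filter]
    refine Finset.sum_congr rfl fun M hM => ?_
    have h1 : ∀ h : ℕ, ee (-(m * ((h : ℝ) / Q))) * (ζ ^ (∑ s, M s) * ee (wt M * ((h : ℝ) / Q)) *
        (Real.exp (-(wt M * x)) : ℝ)) = (ζ ^ (∑ s, M s) * (Real.exp (-(wt M * x)) : ℝ)) *
        ee (h * ((((wt M : ℤ) - m : ℤ) : ℝ) / Q)) := by
      intro h
      have : ee (h * ((((wt M : ℤ) - m : ℤ) : ℝ) / Q)) = ee (-(m * ((h : ℝ) / Q))) * ee (wt M * ((h : ℝ) / Q)) := by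
        rw [← ee_add]; congr 1; push_cast; ring
      rw [this]; ring
    simp only [h1]
    rw [← Finset.mul_sum, orth Q hQ0]
    have hd : ((Q : ℤ) ∣ ((wt M : ℤ) - m)) ↔ wt M = m := by
      constructor
      · intro h
        have h2 := Int.eq_zero_of_abs_lt_dvd h (by
          have := hQ M hM
          rw [abs_lt]; constructor <;> omega)
        omega
      · intro h; rw [h]; simp
    simp only [hd]
    split_ifs with hh
    · rw [hh]; ring
    · simp
  have h2 : ‖(Q : ℂ) * ∑ M ∈ fib T J m, ζ ^ (∑ s, M s) * (Real.exp (-(m * x)) : ℝ)‖ ≤ Q * B := by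
    rw [key]
    refine (norm_sum_le _ _).trans ?_
    refine (Finset.sum_le_card_nsmul _ _ B ?_).trans (by simp)
    intro h _
    rw [norm_mul, norm_ee, one_mul]
    exact hB _
  rw [← Finset.sum_mul, norm_mul, norm_mul, Complex.norm_natCast, Complex.norm_real, Real.norm_eq_abs,
    Real.abs_exp] at h2
  have h3 := le_of_mul_le_mul_left h2 (by exact_mod_cast hQ0)
  rw [Real.exp_neg, ← div_eq_mul_inv, div_le_iff₀ (Real.exp_pos _)] at h3
  linarith

end PFW


namespace PFW
open Polynomial

lemma poly_diff (r : ℕ) (P : Polynomial ℚ) (hPdeg : P.natDegree = r)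
    (hPlc : 0 < P.leadingCoeff)
    (f : ℤ → ℤ) (hfP : ∀ ℓ : ℤ, (f ℓ : ℚ) = P.eval (ℓ : ℚ)) :
    ∃ D : ℤ, 0 < D ∧ ∀ ℓ h : ℤ, h ≠ 0 →
      ∑ i ∈ Finset.range (r + 1), ((-1 : ℤ) ^ (r - i) * (r.choose i : ℤ)) * f (ℓ + i * h) = D * h ^ r := by
  have key : ∀ ℓ h : ℤ, h ≠ 0 →
      ((∑ i ∈ Finset.range (r + 1), ((-1 : ℤ) ^ (r - i) * (r.choose i : ℤ)) * f (ℓ + i * h) : ℤ) : ℚ) =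
        P.leadingCoeff * (r.factorial : ℚ) * (h : ℚ) ^ r := by
    intro ℓ h hh
    set Q : Polynomial ℚ := P.comp (C (h : ℚ) * X + C (ℓ : ℚ)) with hQ
    have hh' : (h : ℚ) ≠ 0 := by exact_mod_cast hh
    have hlin : (C (h : ℚ) * X + C (ℓ : ℚ)).natDegree = 1 := natDegree_linear hh'
    have hQd : Q.natDegree = r := by rw [hQ, natDegree_comp, hlin, hPdeg, mul_one]
    have hQl : Q.leadingCoeff = P.leadingCoeff * (h : ℚ) ^ r := by
      rw [hQ, leadingCoeff_comp (by rw [hlin]; norm_num), leadingCoeff_linear hh', hPdeg]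
    have h1 := Polynomial.fwdDiff_iter_degree_eq_factorial Q
    have h2 := congrFun h1 0
    rw [fwdDiff_iter_eq_sum_shift, hQd] at h2
    simp only [hQl] at h2
    simp at h2
    push_cast
    rw [show P.leadingCoeff * (r.factorial : ℚ) * (h : ℚ) ^ r = P.leadingCoeff * (h : ℚ) ^ r * r.factorial by ring]
    rw [← h2]
    refine Finset.sum_congr rfl fun i _ => ?_
    rw [hfP, hQ, eval_comp]
    simp
    left
    congr 1
    ring
  refine ⟨∑ i ∈ Finset.range (r + 1), ((-1 : ℤ) ^ (r - i) * (r.choose i : ℤ)) * f (0 + i * 1), ?_, ?_⟩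
  · have := key 0 1 one_ne_zero
    have h3 : (0 : ℚ) < P.leadingCoeff * (r.factorial : ℚ) * ((1 : ℤ) : ℚ) ^ r := by
      have : (0 : ℚ) < r.factorial := by exact_mod_cast r.factorial_pos
      simp; positivity
    rw [← this] at h3
    exact_mod_cast h3
  · intro ℓ h hh
    have h1 := key 0 1 one_ne_zero
    have h2 := key ℓ h hh
    have : ((∑ i ∈ Finset.range (r + 1), ((-1 : ℤ) ^ (r - i) * (r.choose i : ℤ)) * f (ℓ + i * h) : ℤ) : ℚ) =
      (((∑ i ∈ Finset.range (r + 1), ((-1 : ℤ) ^ (r - i) * (r.choose i : ℤ)) * f (0 + i * 1)) * h ^ r : ℤ) : ℚ) := by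
      rw [h2, Int.cast_mul, h1]; push_cast; ring
    exact_mod_cast this

lemma poly_period (P : Polynomial ℚ)
    (f : ℤ → ℤ) (hfP : ∀ ℓ : ℤ, (f ℓ : ℚ) = P.eval (ℓ : ℚ)) (D : ℤ) (hD : 0 < D) :
    ∃ q : ℕ, 0 < q ∧ ∀ ℓ c : ℤ, D ∣ f (ℓ + c * q) - f ℓ := by
  obtain ⟨b, hb, hbP⟩ := IsLocalization.integerNormalization_spec (nonZeroDivisors ℤ) P
  set P' := IsLocalization.integerNormalization (nonZeroDivisors ℤ) P
  have hb0 : b ≠ 0 := nonZeroDivisors.ne_zero hb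
  have hev : ∀ ℓ : ℤ, P'.eval ℓ = b * f ℓ := by
    intro ℓ
    have h1 : ((P'.eval ℓ : ℤ) : ℚ) = (P'.map (algebraMap ℤ ℚ)).eval (ℓ : ℚ) := by
      simp [eval_map, eval₂_at_intCast]
    have : ((P'.eval ℓ : ℤ) : ℚ) = ((b * f ℓ : ℤ) : ℚ) := by
      rw [h1, hbP]; push_cast; rw [hfP]; simp
    exact_mod_cast this
  refine ⟨(b * D).natAbs, Int.natAbs_pos.2 (mul_ne_zero hb0 hD.ne'), fun ℓ c => ?_⟩
  have h1 := P'.sub_dvd_eval_sub (ℓ + c * ((b * D).natAbs : ℤ)) ℓ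
  rw [hev, hev, ← mul_sub] at h1
  have h2 : b * D ∣ (ℓ + c * ((b * D).natAbs : ℤ)) - ℓ := by
    rw [add_sub_cancel_left]
    exact Dvd.dvd.mul_left (Int.dvd_natAbs_self) _
  exact (mul_dvd_mul_iff_left hb0).1 (h2.trans h1)

lemma poly_upper (r : ℕ) (P : Polynomial ℚ) (hPdeg : P.natDegree = r)
    (f : ℤ → ℤ) (hfP : ∀ ℓ : ℤ, (f ℓ : ℚ) = P.eval (ℓ : ℚ)) :
    ∃ C0 : ℝ, 1 ≤ C0 ∧ ∀ ℓ : ℕ, 1 ≤ ℓ → |(f ℓ : ℝ)| ≤ C0 * (ℓ : ℝ) ^ r := by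
  refine ⟨1 + ∑ i ∈ Finset.range (r + 1), |((P.coeff i : ℚ) : ℝ)|, by
    have : 0 ≤ ∑ i ∈ Finset.range (r + 1), |((P.coeff i : ℚ) : ℝ)| := Finset.sum_nonneg fun _ _ => abs_nonneg _
    linarith, fun ℓ hℓ => ?_⟩
  have h1 : (f ℓ : ℝ) = ∑ i ∈ Finset.range (r + 1), ((P.coeff i : ℚ) : ℝ) * (ℓ : ℝ) ^ i := by
    have := hfP ℓ
    rw [eval_eq_sum_range, hPdeg] at this
    have h2 : ((f ℓ : ℚ) : ℝ) = ((∑ i ∈ Finset.range (r + 1), P.coeff i * ((ℓ : ℤ) : ℚ) ^ i : ℚ) : ℝ) := by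
      rw [this]
    push_cast at h2
    exact h2
  have hℓ1 : (1 : ℝ) ≤ ℓ := by exact_mod_cast hℓ
  calc |(f ℓ : ℝ)| ≤ ∑ i ∈ Finset.range (r + 1), |((P.coeff i : ℚ) : ℝ) * (ℓ : ℝ) ^ i| := by
        rw [h1]; exact Finset.abs_sum_le_sum_abs _ _
    _ ≤ ∑ i ∈ Finset.range (r + 1), |((P.coeff i : ℚ) : ℝ)| * (ℓ : ℝ) ^ r := by
        refine Finset.sum_le_sum fun i hi => ?_
        rw [abs_mul, abs_of_nonneg (by positivity : (0 : ℝ) ≤ (ℓ : ℝ) ^ i)]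
        refine mul_le_mul_of_nonneg_left ?_ (abs_nonneg _)
        exact pow_le_pow_right₀ hℓ1 (by simp at hi; omega)
    _ ≤ _ := by
        rw [← Finset.sum_mul]
        refine mul_le_mul_of_nonneg_right (by linarith) (by positivity)

lemma poly_lower (r : ℕ) (P : Polynomial ℚ) (hPdeg : P.natDegree = r)
    (hPlc : 0 < P.leadingCoeff)
    (f : ℤ → ℤ) (hfP : ∀ ℓ : ℤ, (f ℓ : ℚ) = P.eval (ℓ : ℚ)) (hfpos : ∀ ℓ : ℤ, 1 ≤ ℓ → 0 < f ℓ) :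
    ∃ c0 : ℝ, 0 < c0 ∧ ∀ ℓ : ℕ, 1 ≤ ℓ → c0 * (ℓ : ℝ) ^ r ≤ f ℓ := by
  set R : Polynomial ℝ := P.map (algebraMap ℚ ℝ) with hR
  have hRd : R.natDegree = r := by rw [hR, natDegree_map, hPdeg]
  have hRl : R.leadingCoeff = (P.leadingCoeff : ℝ) := by rw [hR, leadingCoeff_map]; simp
  have hlc : 0 < R.leadingCoeff := by rw [hRl]; exact_mod_cast hPlc
  have hfR : ∀ ℓ : ℕ, (f ℓ : ℝ) = R.eval (ℓ : ℝ) := by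
    intro ℓ
    have h2 : ((f ℓ : ℚ) : ℝ) = ((P.eval ((ℓ : ℤ) : ℚ) : ℚ) : ℝ) := by rw [hfP]
    rw [hR, eval_map]
    have h3 : eval₂ (algebraMap ℚ ℝ) (ℓ : ℝ) P = algebraMap ℚ ℝ (P.eval (ℓ : ℚ)) := by
      rw [← eval₂_at_apply]; simp
    rw [h3]
    push_cast at h2
    simpa using h2
  have heq := (Polynomial.isEquivalent_atTop_lead R)
  have hev : ∀ᶠ x : ℝ in Filter.atTop, R.leadingCoeff / 2 * x ^ r ≤ R.eval x := by
    have h1 := heq.def (c := 1 / 2) (by norm_num)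
    filter_upwards [h1, Filter.eventually_ge_atTop 0] with x hx hx0
    simp only [Pi.sub_apply, hRd] at hx
    have hp : 0 ≤ R.leadingCoeff * x ^ r := by positivity
    rw [Real.norm_eq_abs, Real.norm_eq_abs, abs_of_nonneg hp] at hx
    have := (abs_le.1 hx).1
    nlinarith
  obtain ⟨x0, hx0⟩ := Filter.eventually_atTop.1 hev
  set m : ℕ := ⌈x0⌉₊ + 1 with hm
  refine ⟨min (R.leadingCoeff / 2) (1 / (m : ℝ) ^ r), by
    refine lt_min (by linarith) ?_
    have : (0 : ℝ) < m := by rw [hm]; positivity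
    positivity, fun ℓ hℓ => ?_⟩
  by_cases h : x0 ≤ (ℓ : ℝ)
  · rw [hfR]
    exact (mul_le_mul_of_nonneg_right (min_le_left _ _) (by positivity)).trans (hx0 _ h)
  · have hlt : (ℓ : ℝ) ≤ m := by
      push Not at h
      have := Nat.le_ceil x0
      rw [hm]; push_cast; linarith
    have h1 : (1 : ℝ) ≤ f ℓ := by
      have := hfpos ℓ (by exact_mod_cast hℓ)
      exact_mod_cast this
    refine le_trans (mul_le_mul_of_nonneg_right (min_le_right _ _) (by positivity)) (le_trans ?_ h1)
    have hm0 : (0 : ℝ) < m := by rw [hm]; positivity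
    rw [one_div, inv_mul_le_iff₀ (by positivity), mul_one]
    gcongr

lemma poly_fiber (r : ℕ) (hr : 1 ≤ r) (P : Polynomial ℚ) (hPdeg : P.natDegree = r)
    (f : ℤ → ℤ) (hfP : ∀ ℓ : ℤ, (f ℓ : ℚ) = P.eval (ℓ : ℚ)) (U : Finset ℕ) (s : ℕ) :
    (U.filter (fun ℓ : ℕ => (f ℓ).toNat = s ∧ 0 ≤ f ℓ)).card ≤ r := by
  set Q : Polynomial ℚ := P - C (s : ℚ) with hQ
  have hQd : Q.natDegree = r := by rw [hQ, natDegree_sub_C, hPdeg]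
  have hQ0 : Q ≠ 0 := by intro h; rw [h] at hQd; simp at hQd; omega
  calc _ = ((U.filter (fun ℓ : ℕ => (f ℓ).toNat = s ∧ 0 ≤ f ℓ)).image (fun ℓ : ℕ => (ℓ : ℚ))).card := by
        rw [Finset.card_image_of_injective _ Nat.cast_injective]
    _ ≤ Q.roots.toFinset.card := by
        refine Finset.card_le_card fun x hx => ?_
        simp only [Finset.mem_image, Finset.mem_filter] at hx
        obtain ⟨ℓ, ⟨-, h1, h2⟩, rfl⟩ := hx
        rw [Multiset.mem_toFinset, mem_roots hQ0, IsRoot, hQ, eval_sub, eval_C, sub_eq_zero]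
        have h3 : f ℓ = s := by omega
        have := hfP ℓ
        rw [h3] at this
        push_cast at this
        exact this.symm
    _ ≤ Multiset.card Q.roots := Multiset.toFinset_card_le _
    _ ≤ r := hQd ▸ card_roots' Q

end PFW


namespace PFW

/-- distance to the nearest integer -/
noncomputable def nd (t : ℝ) : ℝ := |t - round t|

lemma nd_nonneg (t : ℝ) : 0 ≤ nd t := abs_nonneg _

lemma nd_le (t : ℝ) (z : ℤ) : nd t ≤ |t - z| := round_le t z

lemma nd_add (s t : ℝ) : nd (s + t) ≤ nd s + nd t := by
  refine (nd_le _ (round s + round t)).trans ?_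
  push_cast
  rw [show s + t - (round s + round t) = (s - round s) + (t - round t) by ring]
  exact abs_add_le _ _

lemma nd_mul (c : ℤ) (t : ℝ) : nd (c * t) ≤ |(c : ℝ)| * nd t := by
  refine (nd_le _ (c * round t)).trans ?_
  push_cast
  rw [← mul_sub, abs_mul]; rfl

lemma nd_neg (t : ℝ) : nd (-t) ≤ nd t := by
  have := nd_mul (-1) t
  simpa using this

lemma nd_sub (s t : ℝ) : nd (s - t) ≤ nd s + nd t := by
  rw [sub_eq_add_neg]
  exact (nd_add _ _).trans (by linarith [nd_neg t])

lemma nd_le_abs (t : ℝ) : nd t ≤ |t| := by simpa using nd_le t 0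

lemma nd_add_int (t : ℝ) (z : ℤ) : nd (t + z) = nd t := by
  simp [nd]

lemma nd_int (z : ℤ) : nd z = 0 := by simp [nd]

lemma nd_eq {t : ℝ} {z : ℤ} (h : |t - z| < 1 / 2) : nd t = |t - z| := by
  have h1 := nd_le t z
  have h2 : round t = z := by
    have : |((round t - z : ℤ) : ℝ)| < 1 := by
      push_cast
      calc |(round t : ℝ) - z| = |(t - z) - (t - round t)| := by congr 1; ring
        _ ≤ |t - z| + |t - round t| := abs_sub _ _
        _ < 1 := by unfold nd at h1; linarith
    have h3 : |round t - z| < 1 := by exact_mod_cast this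
    rw [Int.abs_lt_one_iff] at h3
    omega
  rw [nd, h2]

lemma nd_sum {ι : Type*} (U : Finset ι) (g : ι → ℝ) : nd (∑ i ∈ U, g i) ≤ ∑ i ∈ U, nd (g i) := by
  classical
  induction U using Finset.induction_on with
  | empty => simpa using (nd_int 0).le
  | insert a U ha ih =>
    rw [Finset.sum_insert ha, Finset.sum_insert ha]
    exact (nd_add _ _).trans (by linarith)

lemma dvd_of_nd_lt {D a : ℤ} (hD : 0 < D) (h : nd ((a : ℝ) / D) < 1 / D) : D ∣ a := by
  have hD' : (0 : ℝ) < D := by exact_mod_cast hD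
  refine ⟨round ((a : ℝ) / D), ?_⟩
  unfold nd at h
  have h1 : |((a - D * round ((a : ℝ) / D) : ℤ) : ℝ)| < 1 := by
    push_cast
    have : (a : ℝ) - D * round ((a : ℝ) / D) = D * ((a : ℝ) / D - round ((a : ℝ) / D)) := by
      field_simp
    rw [this, abs_mul, abs_of_pos hD']
    rw [lt_div_iff₀ hD'] at h
    linarith
  have h3 : |a - D * round ((a : ℝ) / D)| < 1 := by exact_mod_cast h1
  rw [Int.abs_lt_one_iff] at h3
  omega

lemma exists_prog (r Λ h : ℕ) (hΛ : 0 < Λ) (hh : 2 * r * h ≤ Λ) (B : Finset ℕ)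
    (hB : 4 * ((r + 1) * B.card) ≤ Λ) :
    ∃ ℓ, 1 ≤ ℓ ∧ ∀ i ∈ Finset.range (r + 1), ℓ + i * h ≤ Λ ∧ ℓ + i * h ∉ B := by
  classical
  by_contra! hcon
  have hsub : Finset.Icc 1 (Λ - r * h) ⊆ (Finset.range (r + 1)).biUnion
      (fun i => B.image (fun b => b - i * h)) := by
    intro ℓ hℓ
    rw [Finset.mem_Icc] at hℓ
    obtain ⟨i, hi, h2⟩ := hcon ℓ hℓ.1
    have hir : i * h ≤ r * h := Nat.mul_le_mul_right _ (by simp at hi; omega)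
    have hpos : r * h ≤ Λ := by nlinarith
    have := h2 (by omega)
    rw [Finset.mem_biUnion]
    exact ⟨i, hi, Finset.mem_image.2 ⟨_, this, by omega⟩⟩
  have h1 := (Finset.card_le_card hsub).trans Finset.card_biUnion_le
  have h2 : ∑ i ∈ Finset.range (r + 1), (B.image (fun b => b - i * h)).card ≤ (r + 1) * B.card := by
    refine (Finset.sum_le_card_nsmul _ _ B.card fun i _ => Finset.card_image_le).trans ?_
    simp
  have h3 : (Finset.Icc 1 (Λ - r * h)).card = Λ - r * h := by simp
  rw [h3] at h1
  have h4 : 2 * (r * h) ≤ Λ := by linarith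
  omega

lemma exists_res (q Λ : ℕ) (hq : 0 < q) (B : Finset ℕ) (hB : B.card < Λ / q) (i : ℤ) :
    ∃ ℓ : ℕ, 1 ≤ ℓ ∧ ℓ ≤ Λ ∧ ℓ ∉ B ∧ ∃ c : ℤ, (ℓ : ℤ) = i + c * q := by
  classical
  set i0 : ℕ := ((i - 1) % q).toNat + 1 with hi0
  have hq' : (0 : ℤ) < q := by exact_mod_cast hq
  have hm0 := Int.emod_nonneg (i - 1) hq'.ne'
  have hm1 := Int.emod_lt_of_pos (i - 1) hq'
  have hi0q : i0 ≤ q := by omega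
  have hdm := Int.emod_add_mul_ediv (i - 1) q
  by_contra! hcon
  have hinj : ((Finset.range (Λ / q)).image (fun t => i0 + t * q)).card = Λ / q := by
    rw [Finset.card_image_of_injective, Finset.card_range]
    intro a b hab
    have : a * q = b * q := by simpa using hab
    exact Nat.eq_of_mul_eq_mul_right hq this
  have hsub : (Finset.range (Λ / q)).image (fun t => i0 + t * q) ⊆ B := by
    intro ℓ hℓ
    obtain ⟨t, ht, rfl⟩ := Finset.mem_image.1 hℓ
    rw [Finset.mem_range] at ht
    by_contra hnb
    have h1 : (t + 1) * q ≤ Λ := (Nat.mul_le_mul_right q ht).trans (Nat.div_mul_le_self Λ q)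
    refine hcon (i0 + t * q) (by omega) (by linarith) hnb (t - (i - 1) / q) ?_
    push_cast
    have : ((i0 : ℕ) : ℤ) = (i - 1) % q + 1 := by omega
    rw [this]
    linarith
  have := Finset.card_le_card hsub
  omega

open Classical in
/-- the set of indices where the phase is far from an integer -/
noncomputable def badset (f : ℤ → ℤ) (Λ : ℕ) (θ β κ : ℝ) : Finset ℕ :=
  (Finset.Icc 1 Λ).filter (fun ℓ : ℕ => κ ≤ nd (f ℓ * θ + β))

lemma dvd_Pif (f : ℤ → ℤ) (Pif : ℕ)
    (hPif : ∀ d : ℕ, d ∣ Pif ↔ ∀ ℓ : ℤ, (d : ℤ) ∣ (f ℓ - f 0)) (D A : ℤ) (hD : 0 < D)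
    (h : ∀ i : ℤ, D ∣ (f i - f 0) * A) : D ∣ Pif * A := by
  have hg : 0 < Int.gcd D A := Int.gcd_pos_of_ne_zero_left _ hD.ne'
  obtain ⟨g, D', A', hg0, hcop, rfl, rfl⟩ : ∃ g D' A' : ℤ, 0 < g ∧ IsCoprime D' A' ∧
      D = g * D' ∧ A = g * A' := by
    have hg' : (Int.gcd D A : ℤ) ≠ 0 := by exact_mod_cast hg.ne'
    refine ⟨Int.gcd D A, D / Int.gcd D A, A / Int.gcd D A, by exact_mod_cast hg, ?_,
      (Int.mul_ediv_cancel' (Int.gcd_dvd_left D A)).symm,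
      (Int.mul_ediv_cancel' (Int.gcd_dvd_right D A)).symm⟩
    rw [Int.isCoprime_iff_gcd_eq_one]
    exact Int.gcd_div_gcd_div_gcd hg
  have hdv : D'.natAbs ∣ Pif := by
    rw [hPif]
    intro i
    rw [Int.natAbs_dvd]
    have h1 := h i
    rw [show (f i - f 0) * (g * A') = g * ((f i - f 0) * A') by ring] at h1
    exact hcop.dvd_of_dvd_mul_right ((mul_dvd_mul_iff_left hg0.ne').1 h1)
  have h2 : D' ∣ (Pif : ℤ) := by
    rw [← Int.natAbs_dvd]; exact_mod_cast hdv
  rw [show (Pif : ℤ) * (g * A') = g * Pif * A' by ring]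
  exact Dvd.dvd.mul_right (mul_dvd_mul_left g h2) A'

set_option maxHeartbeats 1600000 in
lemma weyl (r : ℕ) (hr : 1 ≤ r) (P : Polynomial ℚ) (hPdeg : P.natDegree = r)
    (hPlc : 0 < P.leadingCoeff)
    (f : ℤ → ℤ) (hfP : ∀ ℓ : ℤ, (f ℓ : ℚ) = P.eval (ℓ : ℚ))
    (Pif : ℕ) (hPifpos : 0 < Pif)
    (hPif : ∀ d : ℕ, d ∣ Pif ↔ ∀ ℓ : ℤ, (d : ℤ) ∣ (f ℓ - f 0)) :
    ∃ ε η : ℝ, 0 < ε ∧ 0 < η ∧ ∃ Λ0 : ℕ, ∀ Λ : ℕ, Λ0 ≤ Λ → ∀ θ β : ℝ, ∀ k : ℕ, 0 < k →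
      1 / (k : ℝ) ≤ nd (Pif * β) → η * Λ ≤ (badset f Λ θ β (ε / k)).card := by
  obtain ⟨D, hD, hdiff⟩ := poly_diff r P hPdeg hPlc f hfP
  obtain ⟨q, hq, hper⟩ := poly_period P f hfP D hD
  obtain ⟨C0, hC0, hup⟩ := poly_upper r P hPdeg f hfP
  have hD1 : (1 : ℝ) ≤ D := by exact_mod_cast hD
  have hPi1 : (1 : ℝ) ≤ Pif := by exact_mod_cast hPifpos
  have hr1 : (1 : ℝ) ≤ r := by exact_mod_cast hr
  set C' : ℝ := 1 + C0 * ((4 * r) ^ r * 2 ^ r) with hC'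
  have hC'1 : 1 ≤ C' := by
    have : 0 ≤ C0 * ((4 * (r : ℝ)) ^ r * 2 ^ r) := by positivity
    linarith
  set ε : ℝ := 1 / (4 * C' * D * Pif * 4 ^ r) with hε
  have h4r : (1 : ℝ) ≤ 4 ^ r := one_le_pow₀ (by norm_num)
  have hεpos : 0 < ε := by rw [hε]; positivity
  have hεeq : ε * (4 * C' * D * Pif * 4 ^ r) = 1 := by rw [hε]; field_simp
  have hCε : C' * ε * (D * Pif) ≤ 1 / 4 := by
    have : C' * ε * (D * Pif) * 4 ^ r = 1 / 4 := by linear_combination hεeq / 4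
    have h0 : 0 ≤ C' * ε * (D * Pif) := by positivity
    nlinarith
  have hCεD : C' * ε * D ≤ 1 / 4 := by
    have h0 : 0 ≤ C' * ε * D := by positivity
    nlinarith
  have hCePi : C' * ε * Pif ≤ 1 / 4 := by
    have h0 : 0 ≤ C' * ε * Pif := by positivity
    nlinarith
  have hε4 : 4 ^ r * ε < 1 / 2 := by
    have h0 : 0 ≤ 4 ^ r * ε := by positivity
    have h1 : 1 ≤ C' * (D * Pif) := by
      have : 1 ≤ (D : ℝ) * Pif := by nlinarith
      nlinarith
    have h2 : 4 ^ r * ε * (C' * (D * Pif)) = 1 / 4 := by linear_combination hεeq / 4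
    nlinarith
  refine ⟨ε, 1 / (4 * (r + 1) * q), hεpos, by positivity, 4 * q + 4 * r, ?_⟩
  intro Λ hΛ θ β k hk hβ
  by_contra! hcon
  set B := badset f Λ θ β (ε / k) with hBdef
  have hk1 : (1 : ℝ) ≤ k := by exact_mod_cast hk
  have hq1 : (1 : ℝ) ≤ q := by exact_mod_cast hq
  have hΛ0 : 0 < Λ := by omega
  have hcon' : 4 * ((r + 1) * (B.card * q)) < Λ := by
    rw [one_div, inv_mul_eq_div, lt_div_iff₀ (by positivity)] at hcon
    have : ((4 * ((r + 1) * (B.card * q)) : ℕ) : ℝ) < Λ := by push_cast; linarith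
    exact_mod_cast this
  have hB1 : 4 * ((r + 1) * B.card) ≤ Λ := by
    have : B.card ≤ B.card * q := Nat.le_mul_of_pos_right _ hq
    have := Nat.mul_le_mul_left (r + 1) this
    omega
  have hB2 : B.card < Λ / q := by
    rw [← Nat.add_one_le_iff, Nat.le_div_iff_mul_le hq]
    have : B.card * q ≤ (r + 1) * (B.card * q) := Nat.le_mul_of_pos_left _ (by omega)
    have : (B.card + 1) * q = B.card * q + q := by ring
    omega
  have hgood : ∀ ℓ : ℕ, 1 ≤ ℓ → ℓ ≤ Λ → ℓ ∉ B → nd (f ℓ * θ + β) ≤ ε / k := by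
    intro ℓ h1 h2 h3
    by_contra! h4
    apply h3
    rw [hBdef, badset, Finset.mem_filter, Finset.mem_Icc]
    exact ⟨⟨h1, h2⟩, h4.le⟩
  set ε2 : ℝ := 2 ^ r * (ε / k) with hε2
  have hepspos : 0 < ε2 := by positivity
  have hε2' : 2 ^ r * ε2 < 1 / 2 := by
    have h1 : (2 : ℝ) ^ r * ε2 = 4 ^ r * ε / k := by
      rw [hε2, show (4 : ℝ) = 2 * 2 by norm_num, mul_pow]; ring
    rw [h1]
    refine lt_of_le_of_lt (div_le_self (by positivity) hk1) hε4
  -- step 1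
  have step1 : ∀ h : ℕ, 1 ≤ h → 2 * r * h ≤ Λ → nd ((h : ℝ) ^ r * (D * θ)) ≤ ε2 := by
    intro h hh1 hh
    obtain ⟨ℓ, hℓ1, hℓ⟩ := exists_prog r Λ h hΛ0 hh B hB1
    have e0 := hdiff ℓ h (by exact_mod_cast (by omega : h ≠ 0))
    have esum : ∑ i ∈ Finset.range (r + 1), ((-1 : ℤ) ^ (r - i) * (r.choose i : ℤ)) = 0 := by
      have := Int.alternating_sum_range_choose_of_ne (n := r) (by omega)
      have h2 : ∑ i ∈ Finset.range (r + 1), ((-1 : ℤ) ^ (r - i) * (r.choose i : ℤ)) =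
          (-1) ^ r * ∑ i ∈ Finset.range (r + 1), ((-1 : ℤ) ^ i * (r.choose i : ℤ)) := by
        rw [Finset.mul_sum]
        refine Finset.sum_congr rfl fun i hi => ?_
        have hi' : i ≤ r := by simp at hi; omega
        have : (-1 : ℤ) ^ r = (-1) ^ (r - i) * (-1) ^ i := by rw [← pow_add]; congr 1; omega
        rw [this]
        have h3 : (-1 : ℤ) ^ i * (-1) ^ i = 1 := by rw [← mul_pow]; simp
        linear_combination (-(-1 : ℤ) ^ (r - i) * (r.choose i : ℤ)) * h3
      rw [h2, this, mul_zero]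
    have e1 : (h : ℝ) ^ r * (D * θ) = ∑ i ∈ Finset.range (r + 1),
        (((-1 : ℤ) ^ (r - i) * (r.choose i : ℤ) : ℤ) : ℝ) * ((f ((ℓ + i * h : ℕ) : ℤ) : ℝ) * θ + β) := by
      have e0' : ((∑ i ∈ Finset.range (r + 1), ((-1 : ℤ) ^ (r - i) * (r.choose i : ℤ)) * f (ℓ + i * h) : ℤ) : ℝ) =
        ((D * (h : ℤ) ^ r : ℤ) : ℝ) := by rw [e0]
      have esum' : ((∑ i ∈ Finset.range (r + 1), ((-1 : ℤ) ^ (r - i) * (r.choose i : ℤ)) : ℤ) : ℝ) = 0 := by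
        rw [esum]; simp
      have : ∑ i ∈ Finset.range (r + 1),
        (((-1 : ℤ) ^ (r - i) * (r.choose i : ℤ) : ℤ) : ℝ) * ((f ((ℓ + i * h : ℕ) : ℤ) : ℝ) * θ + β) =
        ((∑ i ∈ Finset.range (r + 1), ((-1 : ℤ) ^ (r - i) * (r.choose i : ℤ)) * f (ℓ + i * h) : ℤ) : ℝ) * θ +
        ((∑ i ∈ Finset.range (r + 1), ((-1 : ℤ) ^ (r - i) * (r.choose i : ℤ)) : ℤ) : ℝ) * β := by
        push_cast
        rw [Finset.sum_mul, Finset.sum_mul, ← Finset.sum_add_distrib]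
        refine Finset.sum_congr rfl fun i _ => ?_
        ring
      rw [this, e0', esum']; push_cast; ring
    rw [e1]
    refine (nd_sum _ _).trans ?_
    calc _ ≤ ∑ i ∈ Finset.range (r + 1), (r.choose i : ℝ) * (ε / k) := by
          refine Finset.sum_le_sum fun i hi => ?_
          refine (nd_mul _ _).trans ?_
          have ha : |(((-1 : ℤ) ^ (r - i) * (r.choose i : ℤ) : ℤ) : ℝ)| = r.choose i := by
            push_cast; rw [abs_mul, abs_pow]; simp
          rw [ha]
          refine mul_le_mul_of_nonneg_left ?_ (by positivity)
          exact hgood _ (by omega) (hℓ i hi).1 (hℓ i hi).2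
      _ = ε2 := by
          rw [← Finset.sum_mul, hε2]
          congr 1
          have := Nat.sum_range_choose r
          exact_mod_cast this
  -- step 2
  set A : ℤ := round (D * θ) with hA
  set u : ℝ := D * θ - A with hu
  have step2 : ∀ h : ℕ, 1 ≤ h → 2 * r * h ≤ Λ → |(h : ℝ) ^ r * u| ≤ ε2 := by
    intro h hh1
    induction h, hh1 using Nat.le_induction with
    | base =>
      intro hh
      have := step1 1 le_rfl hh
      simpa [nd, hu, hA] using this
    | succ h hh1 ih =>
      intro hh
      have hprev := ih (by nlinarith)
      have hs := step1 (h + 1) (by omega) hh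
      have hh1' : (1 : ℝ) ≤ h := by exact_mod_cast hh1
      have hb : |((h + 1 : ℕ) : ℝ) ^ r * u| < 1 / 2 := by
        refine lt_of_le_of_lt ?_ hε2'
        rw [abs_mul, abs_of_nonneg (by positivity : (0 : ℝ) ≤ ((h + 1 : ℕ) : ℝ) ^ r)] 
        rw [abs_mul, abs_of_nonneg (by positivity : (0 : ℝ) ≤ (h : ℝ) ^ r)] at hprev
        calc ((h + 1 : ℕ) : ℝ) ^ r * |u| ≤ (2 * h) ^ r * |u| := by
              gcongr; push_cast; linarith
          _ = 2 ^ r * ((h : ℝ) ^ r * |u|) := by rw [mul_pow]; ring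
          _ ≤ _ := by gcongr
      have e : ((h + 1 : ℕ) : ℝ) ^ r * u = ((h + 1 : ℕ) : ℝ) ^ r * (D * θ) - (((h + 1 : ℕ) : ℤ) ^ r * A : ℤ) := by
        rw [hu]; push_cast; ring
      rw [e] at hb ⊢
      rw [← nd_eq hb]
      exact hs
  have hu_small : |u| * (Λ : ℝ) ^ r ≤ (4 * r) ^ r * ε2 := by
    set h := Λ / (2 * r) with hh
    have h1 : 1 ≤ h := by
      rw [hh, Nat.le_div_iff_mul_le (by omega)]; omega
    have h2 : 2 * r * h ≤ Λ := Nat.mul_div_le _ _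
    have h3 : Λ ≤ 4 * r * h := by
      have := Nat.lt_mul_div_succ Λ (by omega : 0 < 2 * r)
      rw [← hh] at this
      nlinarith
    have h4 := step2 h h1 h2
    rw [abs_mul, abs_of_nonneg (by positivity : (0 : ℝ) ≤ (h : ℝ) ^ r)] at h4
    have h5 : (Λ : ℝ) ≤ 4 * r * h := by exact_mod_cast h3
    calc |u| * (Λ : ℝ) ^ r ≤ |u| * (4 * r * h) ^ r := by gcongr
      _ = (4 * r) ^ r * ((h : ℝ) ^ r * |u|) := by rw [mul_pow]; ring
      _ ≤ _ := by gcongr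
  have hDr : (D : ℝ) ≠ 0 := by positivity
  have hθ : θ = A / D + u / D := by rw [hu]; field_simp; ring
  -- step 3
  have step3 : ∀ i : ℤ, nd (((f i * A : ℤ) : ℝ) / D + β) ≤ C' * ε / k := by
    intro i
    obtain ⟨ℓ, h1, h2, h3, c, hc⟩ := exists_res q Λ hq B hB2 i
    have h4 := hgood ℓ h1 h2 h3
    have hd := hper i c
    rw [← hc] at hd
    obtain ⟨z, hz⟩ := hd
    have hz' : (f ℓ : ℝ) = f i + D * z := by
      have : f ℓ = f i + D * z := by linarith
      rw [this]; push_cast; ring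
    have e : ((f i * A : ℤ) : ℝ) / D + β = (((f ℓ : ℝ) * θ + β) - (f ℓ : ℝ) * (u / D)) + ((-(z * A) : ℤ) : ℝ) := by
      rw [hθ, hz']; push_cast; field_simp; ring
    rw [e, nd_add_int]
    refine (nd_sub _ _).trans ?_
    have h5 : nd ((f ℓ : ℝ) * (u / D)) ≤ C0 * ((4 * r) ^ r * 2 ^ r) * (ε / k) := by
      refine (nd_le_abs _).trans ?_
      rw [abs_mul, abs_div, abs_of_pos (by positivity : (0 : ℝ) < D)]
      have h6 := hup ℓ h1
      have h7 : (ℓ : ℝ) ≤ Λ := by exact_mod_cast h2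
      calc |(f ℓ : ℝ)| * (|u| / D) ≤ (C0 * (ℓ : ℝ) ^ r) * |u| := by
            refine mul_le_mul h6 (div_le_self (abs_nonneg _) hD1) (by positivity) (by positivity)
        _ ≤ (C0 * (Λ : ℝ) ^ r) * |u| := by gcongr
        _ = C0 * (|u| * (Λ : ℝ) ^ r) := by ring
        _ ≤ C0 * ((4 * r) ^ r * ε2) := by gcongr
        _ = _ := by rw [hε2]; ring
    calc _ ≤ ε / k + C0 * ((4 * r) ^ r * 2 ^ r) * (ε / k) := add_le_add h4 h5
      _ = C' * ε / k := by rw [hC']; ring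
  have hCk : C' * ε / k ≤ C' * ε := div_le_self (by positivity) hk1
  have step4 : ∀ i : ℤ, D ∣ (f i - f 0) * A := by
    intro i
    apply dvd_of_nd_lt hD
    have e : (((f i - f 0) * A : ℤ) : ℝ) / D = (((f i * A : ℤ) : ℝ) / D + β) - (((f 0 * A : ℤ) : ℝ) / D + β) := by
      push_cast; ring
    rw [e]
    refine lt_of_le_of_lt ((nd_sub _ _).trans (add_le_add (step3 i) (step3 0))) ?_
    rw [lt_div_iff₀ (by positivity)]
    have : C' * ε / k * D ≤ C' * ε * D := by gcongr
    nlinarith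
  have step5 : D ∣ Pif * A := dvd_Pif f Pif hPif D A hD step4
  obtain ⟨w, hw⟩ := step5
  have hfin : nd (Pif * β) ≤ Pif * (C' * ε / k) := by
    have hw' : (Pif : ℝ) * A = D * w := by exact_mod_cast hw
    have e : (Pif : ℝ) * β = ((Pif : ℤ) : ℝ) * (((f 0 * A : ℤ) : ℝ) / D + β) + ((-(f 0 * w) : ℤ) : ℝ) := by
      push_cast
      field_simp
      linear_combination -(f 0 : ℝ) * hw'
    rw [e, nd_add_int]
    refine (nd_mul _ _).trans ?_
    have : |((Pif : ℤ) : ℝ)| = Pif := by simp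
    rw [this]
    exact mul_le_mul_of_nonneg_left (step3 0) (by positivity)
  have hlast : (Pif : ℝ) * (C' * ε / k) ≤ 1 / 4 / k := by
    rw [← mul_div_assoc]; gcongr; linarith
  have : 1 / (k : ℝ) ≤ 1 / 4 / k := hβ.trans (hfin.trans hlast)
  rw [div_le_div_iff_of_pos_right (by positivity)] at this
  norm_num at this

end PFW


namespace PFW

/-- the full generating product -/
noncomputable def GG (T : Finset ℕ) (x : ℝ) : ℝ := ∏ s ∈ T, (1 - Real.exp (-(x * s)))⁻¹

lemma nd_le_half (t : ℝ) : nd t ≤ 1 / 2 := abs_sub_round t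

lemma normSq_one_sub (φ ρ : ℝ) :
    ‖1 - ee φ * (ρ : ℂ)‖ ^ 2 = (1 - ρ) ^ 2 + 4 * ρ * Real.sin (Real.pi * φ) ^ 2 := by
  have h1 : ee φ = ((Real.cos (2 * Real.pi * φ) : ℝ) : ℂ) + (Real.sin (2 * Real.pi * φ) : ℝ) * Complex.I := by
    rw [ee, Complex.exp_mul_I]; push_cast; rfl
  rw [← Complex.normSq_eq_norm_sq, Complex.normSq_apply, h1]
  simp only [Complex.sub_re, Complex.one_re, Complex.mul_re, Complex.add_re, Complex.ofReal_re,
    Complex.I_re, mul_zero, Complex.ofReal_im, Complex.I_im, mul_one, sub_self, add_zero,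
    Complex.add_im, Complex.mul_im, zero_add, Complex.sub_im, Complex.one_im, sub_zero, zero_sub]
  have e : 2 * Real.pi * φ = 2 * (Real.pi * φ) := by ring
  rw [e, Real.cos_two_mul, Real.sin_two_mul]
  have := Real.sin_sq_add_cos_sq (Real.pi * φ)
  have hs : Real.sin (Real.pi * φ) ^ 2 = 1 - Real.cos (Real.pi * φ) ^ 2 := by linarith
  generalize Real.cos (Real.pi * φ) = c at *
  generalize Real.sin (Real.pi * φ) = s at *
  linear_combination (4 * c ^ 2 * ρ ^ 2 - 4 * ρ) * hs

lemma sin_sq_ge (φ : ℝ) : 4 * nd φ ^ 2 ≤ Real.sin (Real.pi * φ) ^ 2 := by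
  set v := φ - round φ with hv
  have hvh : |v| ≤ 1 / 2 := abs_sub_round φ
  have h1 : Real.sin (Real.pi * φ) ^ 2 = Real.sin (Real.pi * |v|) ^ 2 := by
    have e : Real.pi * φ = Real.pi * v + (round φ : ℤ) * Real.pi := by rw [hv]; ring
    rw [e, Real.sin_add_int_mul_pi, mul_pow]
    have : ((-1 : ℝ) ^ (round φ)) ^ 2 = 1 := by
      rw [← zpow_natCast, ← zpow_mul, mul_comm, zpow_mul]; simp
    rw [this, one_mul]
    rcases abs_cases v with h | h
    · rw [h.1]
    · rw [h.1]; simp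
  have h2 : 2 * |v| ≤ Real.sin (Real.pi * |v|) := by
    have := Real.mul_le_sin (x := Real.pi * |v|) (by positivity) (by nlinarith [Real.pi_pos])
    have hp := Real.pi_pos
    have e : 2 / Real.pi * (Real.pi * |v|) = 2 * |v| := by field_simp
    rwa [e] at this
  rw [h1, nd, ← hv]
  have : 0 ≤ |v| := abs_nonneg _
  nlinarith

lemma norm_ge_one (φ ρ : ℝ) (h0 : 0 ≤ ρ) : 1 - ρ ≤ ‖1 - ee φ * (ρ : ℂ)‖ := by
  refine (abs_le_of_sq_le_sq' ?_ (norm_nonneg _)).2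
  rw [normSq_one_sub]
  have : 0 ≤ 4 * ρ * Real.sin (Real.pi * φ) ^ 2 := by positivity
  linarith

lemma norm_ge_two (φ ρ M κ : ℝ) (hM : Real.exp (-M) ≤ ρ) (hM0 : 0 ≤ M) (h1 : ρ ≤ 1) (hκ0 : 0 ≤ κ)
    (hκ : κ ≤ nd φ) :
    (1 - ρ) * Real.exp (Real.exp (-M) * κ ^ 2) ≤ ‖1 - ee φ * (ρ : ℂ)‖ := by
  have hρ : 0 < ρ := (Real.exp_pos _).trans_le hM
  have hM1 : Real.exp (-M) ≤ 1 := by simpa using hM0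
  have hM2 := Real.exp_pos (-M)
  set E := Real.exp (-M)
  have hκ2 : κ ≤ 1 / 2 := hκ.trans (nd_le_half φ)
  refine abs_le_of_sq_le_sq' ?_ (norm_nonneg _) |>.2
  rw [normSq_one_sub]
  have hs := sin_sq_ge φ
  have hs' : 4 * κ ^ 2 ≤ Real.sin (Real.pi * φ) ^ 2 := by nlinarith
  have h2 : (1 - ρ) ^ 2 + 16 * E * κ ^ 2 ≤ (1 - ρ) ^ 2 + 4 * ρ * Real.sin (Real.pi * φ) ^ 2 := by
    have : E * (4 * κ ^ 2) ≤ ρ * Real.sin (Real.pi * φ) ^ 2 := by gcongr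
    linarith
  refine le_trans ?_ h2
  set t := 2 * (E * κ ^ 2) with ht
  have ht0 : 0 ≤ t := by positivity
  have ht1 : t ≤ 1 / 2 := by
    have : E * κ ^ 2 ≤ 1 * (1 / 2) ^ 2 := by gcongr
    linarith
  have h3 : Real.exp (E * κ ^ 2) ^ 2 ≤ 1 + 2 * t := by
    rw [← Real.exp_nat_mul]
    push_cast
    rw [← ht]
    have h4 : Real.exp (-t) ≥ 1 - t := by linarith [Real.add_one_le_exp (-t)]
    rw [Real.exp_neg] at h4
    have h5 : Real.exp t ≤ 1 / (1 - t) := by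
      rw [le_div_iff₀ (by linarith)]
      have := mul_le_mul_of_nonneg_left h4 (Real.exp_pos t).le
      rwa [mul_inv_cancel₀ (Real.exp_pos t).ne'] at this
    refine h5.trans ?_
    rw [div_le_iff₀ (by linarith)]
    nlinarith
  have h6 : (1 - ρ) ^ 2 ≤ 1 := by nlinarith
  rw [mul_pow]
  calc _ ≤ (1 - ρ) ^ 2 * (1 + 2 * t) := by gcongr
    _ = (1 - ρ) ^ 2 + (1 - ρ) ^ 2 * (2 * t) := by ring
    _ ≤ (1 - ρ) ^ 2 + 1 * (2 * t) := by gcongr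
    _ ≤ _ := by rw [ht]; nlinarith [mul_nonneg hM2.le (sq_nonneg κ)]

lemma geom_bound (w : ℂ) (hw : ‖w‖ < 1) (J : ℕ) :
    ‖∑ j ∈ Finset.range (J + 1), w ^ j‖ ≤ (1 + ‖w‖ ^ (J + 1)) * ‖1 - w‖⁻¹ := by
  have hne : w ≠ 1 := by rintro rfl; simp at hw
  have : (1 - w) ≠ 0 := sub_ne_zero.2 hne.symm
  rw [geom_sum_eq hne, norm_div, div_eq_mul_inv, norm_sub_rev w 1]
  gcongr
  rw [norm_sub_rev]
  refine (norm_sub_le _ _).trans ?_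
  simp

lemma prod_bound (T S : Finset ℕ) (hST : S ⊆ T) (n : ℕ) (hT : T ⊆ Finset.Icc 1 n) (x M κ θ β : ℝ)
    (hx : 0 < x) (hM0 : 0 ≤ M) (hκ0 : 0 ≤ κ) (hxn : n * Real.exp (-(x * n)) ≤ 1)
    (hS : ∀ s ∈ S, x * s ≤ M ∧ κ ≤ nd (s * θ + β)) :
    ‖∏ s ∈ T, ∑ j ∈ Finset.range (n + 1), (ee β * ee (s * θ) * (Real.exp (-(x * s)) : ℝ)) ^ j‖ ≤
      Real.exp 1 * (GG T x * Real.exp (-(Real.exp (-M) * κ ^ 2 * S.card))) := by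
  classical
  set E := Real.exp (-M) with hE
  have key : ∀ s ∈ T, ‖∑ j ∈ Finset.range (n + 1), (ee β * ee (s * θ) * (Real.exp (-(x * s)) : ℝ)) ^ j‖ ≤
      Real.exp (1 / n) * ((1 - Real.exp (-(x * s)))⁻¹ * (if s ∈ S then Real.exp (-(E * κ ^ 2)) else 1)) := by
    intro s hs
    obtain ⟨hs1, hsn⟩ := Finset.mem_Icc.1 (hT hs)
    have hs1' : (1 : ℝ) ≤ s := by exact_mod_cast hs1
    have hn1 : (1 : ℝ) ≤ n := by exact_mod_cast hs1.trans hsn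
    have hxs : 0 < x * s := by positivity
    set ρ := Real.exp (-(x * s)) with hρ
    have hρ0 : 0 < ρ := Real.exp_pos _
    have hρ1 : ρ < 1 := by rw [hρ, Real.exp_lt_one_iff]; linarith
    have e : ee β * ee (s * θ) = ee (s * θ + β) := by rw [ee_add, mul_comm]
    rw [e]
    have hnw : ‖ee (s * θ + β) * (ρ : ℂ)‖ = ρ := by
      rw [norm_mul, norm_ee, one_mul, Complex.norm_real, Real.norm_of_nonneg hρ0.le]
    refine (geom_bound _ (by rw [hnw]; exact hρ1) n).trans ?_
    rw [hnw]
    have hA : 1 + ρ ^ (n + 1) ≤ Real.exp (1 / n) := by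
      have h1 : ρ ^ (n + 1) ≤ 1 / n := by
        rw [le_div_iff₀ (by linarith), mul_comm]
        refine le_trans ?_ hxn
        gcongr
        rw [hρ, ← Real.exp_nat_mul]
        apply Real.exp_le_exp.2
        push_cast
        nlinarith [mul_pos hx (by linarith : (0 : ℝ) < n), mul_nonneg (mul_pos hx (by linarith : (0 : ℝ) < n)).le (by linarith : (0 : ℝ) ≤ s - 1)]
      linarith [Real.add_one_le_exp (1 / (n : ℝ))]
    have hB : ‖1 - ee (s * θ + β) * (ρ : ℂ)‖⁻¹ ≤
        (1 - ρ)⁻¹ * (if s ∈ S then Real.exp (-(E * κ ^ 2)) else 1) := by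
      have hpos : 0 < 1 - ρ := by linarith
      split_ifs with hsS
      · obtain ⟨hsM, hsκ⟩ := hS s hsS
        rw [Real.exp_neg, ← mul_inv]
        have := norm_ge_two (s * θ + β) ρ M κ (by rw [hρ]; exact Real.exp_le_exp.2 (by linarith)) hM0 hρ1.le hκ0 hsκ
        exact inv_anti₀ (by positivity) this
      · rw [mul_one]
        exact inv_anti₀ hpos (norm_ge_one _ _ hρ0.le)
    gcongr
  rw [norm_prod]
  refine (Finset.prod_le_prod (fun _ _ => norm_nonneg _) key).trans ?_
  rw [Finset.prod_mul_distrib, Finset.prod_mul_distrib]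
  have hGG : 0 ≤ GG T x := by
    refine Finset.prod_nonneg fun s hs => inv_nonneg.2 ?_
    have : Real.exp (-(x * s)) ≤ 1 := by
      rw [Real.exp_le_one_iff]; have : 0 ≤ x * s := by positivity
      linarith
    linarith
  have h1 : ∏ s ∈ T, (if s ∈ S then Real.exp (-(E * κ ^ 2)) else 1) = Real.exp (-(E * κ ^ 2 * S.card)) := by
    rw [Finset.prod_ite_mem, Finset.inter_eq_right.2 hST, Finset.prod_const, ← Real.exp_nat_mul]
    congr 1; ring
  have h2 : ∏ s ∈ T, Real.exp (1 / (n : ℝ)) ≤ Real.exp 1 := by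
    rw [Finset.prod_const, ← Real.exp_nat_mul]
    apply Real.exp_le_exp.2
    have hc : T.card ≤ n := by simpa using Finset.card_le_card hT
    rcases Nat.eq_zero_or_pos n with h | h
    · subst h; simp
    · have : (0 : ℝ) < n := by exact_mod_cast h
      rw [mul_one_div, div_le_one this]
      exact_mod_cast hc
  rw [h1]
  exact mul_le_mul_of_nonneg_right h2 (mul_nonneg hGG (Real.exp_pos _).le)

lemma GG_pos (T : Finset ℕ) (hT : ∀ s ∈ T, 0 < s) (x : ℝ) (hx : 0 < x) : 0 < GG T x := by
  refine Finset.prod_pos fun s hs => inv_pos.2 ?_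
  have hs : (0 : ℝ) < s := by exact_mod_cast hT s hs
  have : Real.exp (-(x * s)) < 1 := by
    rw [Real.exp_lt_one_iff]; have : 0 < x * s := by positivity
    linarith
  linarith

lemma Tn_sub (f : ℤ → ℤ) (n : ℕ) : Tn f n ⊆ Finset.Icc 1 n := by
  classical
  intro s hs
  rw [Tn, Finset.mem_filter] at hs
  exact hs.1

/-- lower bound for the number of distinct values -/
lemma card_image_ge (r : ℕ) (hr : 1 ≤ r) (P : Polynomial ℚ) (hPdeg : P.natDegree = r)
    (f : ℤ → ℤ) (hfP : ∀ ℓ : ℤ, (f ℓ : ℚ) = P.eval (ℓ : ℚ))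
    (hfpos : ∀ ℓ : ℤ, 1 ≤ ℓ → 0 < f ℓ) (U : Finset ℕ) (hU : ∀ ℓ ∈ U, 1 ≤ ℓ) :
    (U.card : ℝ) / r ≤ (U.image (fun ℓ : ℕ => (f ℓ).toNat)).card := by
  classical
  have h1 := Finset.card_le_mul_card_image (f := fun ℓ : ℕ => (f ℓ).toNat) (s := U) r (by
    intro s hs
    refine le_trans (Finset.card_le_card ?_) (poly_fiber r hr P hPdeg f hfP U s)
    intro ℓ hℓ
    rw [Finset.mem_filter] at hℓ ⊢
    exact ⟨hℓ.1, hℓ.2, (hfpos ℓ (by exact_mod_cast hU ℓ hℓ.1)).le⟩)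
  have hr' : (0 : ℝ) < r := by exact_mod_cast hr
  rw [div_le_iff₀ hr', mul_comm]
  exact_mod_cast h1

/-- Upper bound for the exponential sums. -/
lemma upper (r : ℕ) (hr : 1 ≤ r) (P : Polynomial ℚ) (hPdeg : P.natDegree = r)
    (hPlc : 0 < P.leadingCoeff)
    (f : ℤ → ℤ) (hfP : ∀ ℓ : ℤ, (f ℓ : ℚ) = P.eval (ℓ : ℚ))
    (hfpos : ∀ ℓ : ℤ, 1 ≤ ℓ → 0 < f ℓ)
    (Pif : ℕ) (hPifpos : 0 < Pif)
    (hPif : ∀ d : ℕ, d ∣ Pif ↔ ∀ ℓ : ℤ, (d : ℤ) ∣ (f ℓ - f 0)) (c2 : ℝ) (hc2 : 0 < c2) :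
    ∃ c3 L0 : ℝ, 0 < c3 ∧ ∀ n : ℕ, ∀ L x β : ℝ, ∀ k : ℕ, 0 < k → L0 ≤ L → L ^ r * L = n → 0 < x →
      x ≤ c2 * L / n → n * Real.exp (-(x * n)) ≤ 1 → 1 / (k : ℝ) ≤ nd (Pif * β) →
      ‖∑ π ∈ Pn f n, ee β ^ (Multiset.card π.parts)‖ ≤
        Real.exp (n * x) * (Real.exp 1 * (GG (Tn f n) x * Real.exp (-(c3 * L / k ^ 2)))) := by
  classical
  obtain ⟨ε, η, hε, hη, Λ0, hW⟩ := weyl r hr P hPdeg hPlc f hfP Pif hPifpos hPif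
  obtain ⟨C0, hC0, hup⟩ := poly_upper r P hPdeg f hfP
  have hr' : (0 : ℝ) < r := by exact_mod_cast hr
  set M := c2 * C0 with hM
  have hM0 : 0 ≤ M := by positivity
  refine ⟨Real.exp (-M) * ε ^ 2 * (η / (2 * r)), max (max 2 C0) (Λ0 + 1), by positivity, ?_⟩
  intro n L x β k hk hL hLn hx hx2 hxn hβ
  have hk' : (0 : ℝ) < k := by exact_mod_cast hk
  have hL2 : 2 ≤ L := (le_max_left _ _).trans ((le_max_left _ _).trans hL)
  have hLC : C0 ≤ L := (le_max_right _ _).trans ((le_max_left _ _).trans hL)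
  have hLΛ : (Λ0 : ℝ) + 1 ≤ L := (le_max_right _ _).trans hL
  have hL0 : 0 < L := by linarith
  have hn0 : (0 : ℝ) < n := by rw [← hLn]; positivity
  set Λ := ⌊L⌋₊ with hΛ
  have hΛL : (Λ : ℝ) ≤ L := Nat.floor_le hL0.le
  have hΛL2 : L / 2 ≤ Λ := by
    have := Nat.lt_floor_add_one L
    rw [← hΛ] at this
    linarith
  have hΛ0 : Λ0 ≤ Λ := Nat.le_floor (by linarith)
  rw [sum_Pn]
  apply coeff_bound
  intro θ
  set U := badset f Λ θ β (ε / k) with hU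
  have hUmem : ∀ ℓ ∈ U, 1 ≤ ℓ ∧ ℓ ≤ Λ ∧ ε / k ≤ nd (f ℓ * θ + β) := by
    intro ℓ hℓ
    rw [hU, badset, Finset.mem_filter, Finset.mem_Icc] at hℓ
    exact ⟨hℓ.1.1, hℓ.1.2, hℓ.2⟩
  have hUc := hW Λ hΛ0 θ β k hk hβ
  have hSc := card_image_ge r hr P hPdeg f hfP hfpos U (fun ℓ h => (hUmem ℓ h).1)
  set S := U.image (fun ℓ : ℕ => (f ℓ).toNat) with hS
  have hfb : ∀ ℓ ∈ U, (((f ℓ).toNat : ℕ) : ℝ) = f ℓ ∧ (f ℓ : ℝ) ≤ C0 * L ^ r := by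
    intro ℓ hℓ
    obtain ⟨h1, h2, h3⟩ := hUmem ℓ hℓ
    have hp := hfpos ℓ (by exact_mod_cast h1)
    constructor
    · have : (((f ℓ).toNat : ℕ) : ℤ) = f ℓ := Int.toNat_of_nonneg hp.le
      exact_mod_cast this
    · refine (le_abs_self _).trans ((hup ℓ h1).trans ?_)
      have : (ℓ : ℝ) ≤ L := le_trans (by exact_mod_cast h2) hΛL
      gcongr
  have hST : S ⊆ Tn f n := by
    intro s hs
    obtain ⟨ℓ, hℓ, rfl⟩ := Finset.mem_image.1 hs
    obtain ⟨h1, h2, h3⟩ := hUmem ℓ hℓ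
    have hp := hfpos ℓ (by exact_mod_cast h1)
    obtain ⟨e1, e2⟩ := hfb ℓ hℓ
    rw [Tn, Finset.mem_filter, Finset.mem_Icc]
    refine ⟨⟨by omega, ?_⟩, ℓ, by exact_mod_cast h1, Int.toNat_of_nonneg hp.le⟩
    have : (((f ℓ).toNat : ℕ) : ℝ) ≤ n := by
      rw [e1, ← hLn, mul_comm]
      refine e2.trans ?_
      gcongr
    exact_mod_cast this
  refine (prod_bound (Tn f n) S hST n (Tn_sub f n) x M (ε / k) θ β hx hM0 (by positivity) hxn ?_).trans ?_
  · intro s hs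
    obtain ⟨ℓ, hℓ, rfl⟩ := Finset.mem_image.1 hs
    obtain ⟨h1, h2, h3⟩ := hUmem ℓ hℓ
    obtain ⟨e1, e2⟩ := hfb ℓ hℓ
    simp only [e1]
    refine ⟨?_, h3⟩
    have hf0 : (0 : ℝ) ≤ f ℓ := by rw [← e1]; positivity
    calc x * f ℓ ≤ (c2 * L / n) * (C0 * L ^ r) := by gcongr
      _ = c2 * C0 * (L ^ r * L) / n := by ring
      _ = M := by rw [hLn, hM]; field_simp
  · have hGG := GG_pos (Tn f n) (fun s hs => (Finset.mem_Icc.1 (Tn_sub f n hs)).1) x hx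
    gcongr
    have hc : η / (2 * r) * L ≤ S.card := by
      refine le_trans ?_ hSc
      rw [le_div_iff₀ hr']
      refine le_trans ?_ hUc
      have e : η / (2 * r) * L * r = η * (L / 2) := by field_simp
      rw [e]
      gcongr
    calc _ = Real.exp (-M) * (ε / k) ^ 2 * (η / (2 * r) * L) := by field_simp
      _ ≤ _ := by gcongr

end PFW


namespace PFW

lemma sinh_prod (t : ℝ) (ht : 1 ≤ t) (N : ℕ) :
    ∏ j ∈ Finset.range N, (1 + t ^ 2 / ((j : ℝ) + 1) ^ 2) ≤ Real.exp (Real.pi * t) := by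
  have h := Complex.tendsto_euler_sin_prod (t * Complex.I)
  have h2 := h.norm
  have hpi := Real.pi_gt_three
  have e : ∀ n : ℕ, ‖(Real.pi : ℂ) * (t * Complex.I) *
      ∏ j ∈ Finset.range n, (1 - (t * Complex.I) ^ 2 / ((j : ℂ) + 1) ^ 2)‖ =
      Real.pi * t * ∏ j ∈ Finset.range n, (1 + t ^ 2 / ((j : ℝ) + 1) ^ 2) := by
    intro n
    rw [norm_mul, norm_prod]
    congr 1
    · simp [abs_of_pos Real.pi_pos, abs_of_pos (by linarith : 0 < t)]
    · refine Finset.prod_congr rfl fun j _ => ?_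
      have : (1 - (t * Complex.I) ^ 2 / ((j : ℂ) + 1) ^ 2) = ((1 + t ^ 2 / ((j : ℝ) + 1) ^ 2 : ℝ) : ℂ) := by
        rw [mul_pow, Complex.I_sq]; push_cast; ring
      rw [this, Complex.norm_real, Real.norm_of_nonneg (by positivity)]
  simp only [e] at h2
  have hmono : Monotone fun n : ℕ => Real.pi * t * ∏ j ∈ Finset.range n, (1 + t ^ 2 / ((j : ℝ) + 1) ^ 2) := by
    refine monotone_nat_of_le_succ fun n => ?_
    rw [Finset.prod_range_succ]
    have h0 : 0 ≤ ∏ j ∈ Finset.range n, (1 + t ^ 2 / ((j : ℝ) + 1) ^ 2) :=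
      Finset.prod_nonneg fun _ _ => by positivity
    refine mul_le_mul_of_nonneg_left (le_mul_of_one_le_right h0 ?_) (by positivity)
    have : 0 ≤ t ^ 2 / ((n : ℝ) + 1) ^ 2 := by positivity
    linarith
  have h3 := hmono.ge_of_tendsto h2 N
  have h4 : ‖Complex.sin (Real.pi * (t * Complex.I))‖ ≤ Real.exp (Real.pi * t) := by
    have e : (Real.pi : ℂ) * (t * Complex.I) = ((Real.pi * t : ℝ) : ℂ) * Complex.I := by push_cast; ring
    rw [e, Complex.sin_mul_I, norm_mul, Complex.norm_I, mul_one, ← Complex.ofReal_sinh, Complex.norm_real,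
      Real.norm_of_nonneg (Real.sinh_nonneg_iff.2 (by positivity)), Real.sinh_eq]
    have := Real.exp_pos (-(Real.pi * t))
    have := Real.exp_pos (Real.pi * t)
    linarith
  have h0 : 0 ≤ ∏ j ∈ Finset.range N, (1 + t ^ 2 / ((j : ℝ) + 1) ^ 2) :=
      Finset.prod_nonneg fun _ _ => by positivity
  have h5 : 1 ≤ Real.pi * t := by nlinarith
  calc _ ≤ Real.pi * t * ∏ j ∈ Finset.range N, (1 + t ^ 2 / ((j : ℝ) + 1) ^ 2) :=
        le_mul_of_one_le_left h0 h5
    _ ≤ _ := h3.trans h4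

lemma one_div_one_sub_exp (u : ℝ) (hu : 0 < u) : (1 - Real.exp (-u))⁻¹ ≤ 1 + 2 / u ^ 2 := by
  have h1 : u ^ 2 / 2 + 1 ≤ Real.exp u := by
    have := Real.quadratic_le_exp_of_nonneg hu.le
    linarith
  have h2 : Real.exp (-u) ≤ 1 / (u ^ 2 / 2 + 1) := by
    rw [Real.exp_neg, ← one_div]
    exact one_div_le_one_div_of_le (by positivity) h1
  have h3 : (1 + 2 / u ^ 2)⁻¹ ≤ 1 - Real.exp (-u) := by
    have : (1 + 2 / u ^ 2)⁻¹ = 1 - 1 / (u ^ 2 / 2 + 1) := by field_simp; ring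
    linarith
  have := inv_anti₀ (by positivity) h3
  rwa [inv_inv] at this

/-- growth of the generating product -/
lemma growth (r : ℕ) (hr : 1 ≤ r) (P : Polynomial ℚ) (hPdeg : P.natDegree = r)
    (hPlc : 0 < P.leadingCoeff)
    (f : ℤ → ℤ) (hfP : ∀ ℓ : ℤ, (f ℓ : ℚ) = P.eval (ℓ : ℚ))
    (hfpos : ∀ ℓ : ℤ, 1 ≤ ℓ → 0 < f ℓ) :
    ∃ C : ℝ, 0 < C ∧ ∀ n : ℕ, ∀ y Y : ℝ, 1 ≤ Y → 1 ≤ y * Y ^ r →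
      GG (Tn f n) y ≤ Real.exp (C * Y) := by
  classical
  obtain ⟨c0, hc0, hlow⟩ := poly_lower r P hPdeg hPlc f hfP hfpos
  set B : ℝ := max 1 (2 / c0 ^ 2) with hB
  have hB1 : 1 ≤ B := le_max_left _ _
  have hB2 : 2 / c0 ^ 2 ≤ B ^ r := (le_max_right _ _).trans (le_self_pow₀ hB1 (by omega))
  set b := Real.sqrt B with hb
  have hb1 : 1 ≤ b := Real.one_le_sqrt.2 hB1
  have hbB : b ^ 2 = B := Real.sq_sqrt (by linarith)
  refine ⟨r * (Real.pi * b), by have := Real.pi_pos; positivity, ?_⟩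
  intro n y Y hY hyY
  have hy : 0 < y := by
    by_contra! h
    have : y * Y ^ r ≤ 0 := mul_nonpos_of_nonpos_of_nonneg h (by positivity)
    linarith
  have hex : ∀ s ∈ Tn f n, ∃ ℓ : ℕ, 1 ≤ ℓ ∧ (s : ℤ) = f ℓ := by
    intro s hs
    rw [Tn, Finset.mem_filter] at hs
    obtain ⟨ℓ, h1, h2⟩ := hs.2
    refine ⟨ℓ.toNat, by omega, ?_⟩
    rw [Int.toNat_of_nonneg (by omega)]; exact h2
  choose! g hg1 hg2 using hex
  have hinj : Set.InjOn (fun s => g s - 1) (Tn f n) := by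
    intro s hs t ht h
    have h1 := hg1 s hs
    have h2 := hg1 t ht
    have h3 : g s = g t := by simp only at h; omega
    have := hg2 s hs
    rw [h3, ← hg2 t ht] at this
    exact_mod_cast this
  set F : ℕ → ℝ := fun j => (1 + (b * Y) ^ 2 / ((j : ℝ) + 1) ^ 2) ^ r with hF
  have hF1 : ∀ j, 1 ≤ F j := by
    intro j
    apply one_le_pow₀
    have : 0 ≤ (b * Y) ^ 2 / ((j : ℝ) + 1) ^ 2 := by positivity
    linarith
  have key : ∀ s ∈ Tn f n, (1 - Real.exp (-(y * s)))⁻¹ ≤ F (g s - 1) := by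
    intro s hs
    have hs0 : (0 : ℝ) < s := by exact_mod_cast (Finset.mem_Icc.1 (Tn_sub f n hs)).1
    refine (one_div_one_sub_exp (y * s) (by positivity)).trans ?_
    have hgs := hg1 s hs
    have e : (((g s - 1 : ℕ) : ℝ) + 1) = g s := by
      rw [Nat.cast_sub hgs]; push_cast; ring
    simp only [hF, e]
    have hg0 : (0 : ℝ) < g s := by exact_mod_cast hgs
    have hsf : c0 * (g s : ℝ) ^ r ≤ s := by
      have h1 := hlow (g s) hgs
      have h2 : (s : ℝ) = f (g s) := by exact_mod_cast hg2 s hs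
      rwa [h2]
    have h1 : c0 * (g s : ℝ) ^ r / Y ^ r ≤ y * s := by
      rw [div_le_iff₀ (by positivity)]
      calc c0 * (g s : ℝ) ^ r ≤ s := hsf
        _ ≤ s * (y * Y ^ r) := le_mul_of_one_le_right hs0.le hyY
        _ = _ := by ring
    have h2 : 2 / (y * s) ^ 2 ≤ 2 / (c0 * (g s : ℝ) ^ r / Y ^ r) ^ 2 := by
      gcongr
    have h3 : 2 / (c0 * (g s : ℝ) ^ r / Y ^ r) ^ 2 = 2 / c0 ^ 2 * ((Y / g s) ^ 2) ^ r := by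
      rw [← pow_mul, mul_comm 2 r, pow_mul, div_pow Y]; field_simp
    have h4 : ((b * Y) ^ 2 / (g s : ℝ) ^ 2) = B * (Y / g s) ^ 2 := by
      rw [mul_pow, hbB, div_pow]; ring
    rw [h4]
    have h5 : 1 + (B * (Y / g s) ^ 2) ^ r ≤ (1 + B * (Y / g s) ^ 2) ^ r := by
      have h0 : 0 ≤ B * (Y / g s) ^ 2 := by positivity
      have := pow_add_pow_le (x := (1 : ℝ)) (y := B * (Y / g s) ^ 2) (by norm_num) h0 (n := r) (by omega)
      simpa using this
    refine le_trans ?_ h5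
    rw [mul_pow B]
    have : 2 / c0 ^ 2 * ((Y / g s) ^ 2) ^ r ≤ B ^ r * ((Y / g s) ^ 2) ^ r := by gcongr
    linarith
  have hpos : ∀ s ∈ Tn f n, 0 ≤ (1 - Real.exp (-(y * s)))⁻¹ := by
    intro s hs
    apply inv_nonneg.2
    have : Real.exp (-(y * s)) ≤ 1 := by
      rw [Real.exp_le_one_iff]; have : 0 ≤ y * s := by positivity
      linarith
    linarith
  set W := (Tn f n).sup g with hW
  have hsub : (Tn f n).image (fun s => g s - 1) ⊆ Finset.range W := by
    intro j hj
    obtain ⟨s, hs, rfl⟩ := Finset.mem_image.1 hj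
    have h1 : g s ≤ W := Finset.le_sup (f := g) hs
    have := hg1 s hs
    simp only [Finset.mem_range]; omega
  calc GG (Tn f n) y ≤ ∏ s ∈ Tn f n, F (g s - 1) := Finset.prod_le_prod hpos key
    _ = ∏ j ∈ (Tn f n).image (fun s => g s - 1), F j := by rw [Finset.prod_image hinj]
    _ ≤ ∏ j ∈ Finset.range W, F j := by
        rw [← Finset.prod_sdiff hsub]
        refine le_mul_of_one_le_left (Finset.prod_nonneg fun j _ => by linarith [hF1 j]) ?_
        exact Finset.one_le_prod fun j _ => hF1 j
    _ = (∏ j ∈ Finset.range W, (1 + (b * Y) ^ 2 / ((j : ℝ) + 1) ^ 2)) ^ r := by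
        rw [← Finset.prod_pow]
    _ ≤ (Real.exp (Real.pi * (b * Y))) ^ r := by
        gcongr
        exact sinh_prod _ (by nlinarith) W
    _ = _ := by rw [← Real.exp_nat_mul]; congr 1; ring

/-- counting small parts -/
lemma count_small (r : ℕ) (hr : 1 ≤ r) (P : Polynomial ℚ) (hPdeg : P.natDegree = r)
    (f : ℤ → ℤ) (hfP : ∀ ℓ : ℤ, (f ℓ : ℚ) = P.eval (ℓ : ℚ))
    (hfpos : ∀ ℓ : ℤ, 1 ≤ ℓ → 0 < f ℓ) (C0 : ℝ) (hC0 : 1 ≤ C0)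
    (hup : ∀ ℓ : ℕ, 1 ≤ ℓ → |(f ℓ : ℝ)| ≤ C0 * (ℓ : ℝ) ^ r) (n : ℕ) (X a : ℝ) (hX : 2 ≤ X) (ha : 0 < a)
    (hXn : C0 * X ^ r ≤ n) (haX : a * (C0 * X ^ r) ≤ 1) :
    ∃ S ⊆ Tn f n, X / (2 * r) ≤ S.card ∧ ∀ s ∈ S, a * s ≤ 1 := by
  classical
  have hr' : (0 : ℝ) < r := by exact_mod_cast hr
  have hSc := card_image_ge r hr P hPdeg f hfP hfpos (Finset.Icc 1 ⌊X⌋₊) (fun ℓ h => (Finset.mem_Icc.1 h).1)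
  have hfl : (⌊X⌋₊ : ℝ) ≤ X := Nat.floor_le (by linarith)
  have hfb : ∀ ℓ ∈ Finset.Icc 1 ⌊X⌋₊, (((f ℓ).toNat : ℕ) : ℝ) ≤ C0 * X ^ r := by
    intro ℓ hℓ
    obtain ⟨h1, h2⟩ := Finset.mem_Icc.1 hℓ
    have hp := hfpos ℓ (by exact_mod_cast h1)
    have : (((f ℓ).toNat : ℕ) : ℤ) = f ℓ := Int.toNat_of_nonneg hp.le
    have : (((f ℓ).toNat : ℕ) : ℝ) = f ℓ := by exact_mod_cast this
    rw [this]
    refine (le_abs_self _).trans ((hup ℓ h1).trans ?_)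
    have : (ℓ : ℝ) ≤ X := le_trans (by exact_mod_cast h2) hfl
    gcongr
  refine ⟨(Finset.Icc 1 ⌊X⌋₊).image (fun ℓ : ℕ => (f ℓ).toNat), ?_, ?_, ?_⟩
  · intro s hs
    obtain ⟨ℓ, hℓ, rfl⟩ := Finset.mem_image.1 hs
    obtain ⟨h1, h2⟩ := Finset.mem_Icc.1 hℓ
    have hp := hfpos ℓ (by exact_mod_cast h1)
    rw [Tn, Finset.mem_filter, Finset.mem_Icc]
    refine ⟨⟨by omega, ?_⟩, ℓ, by exact_mod_cast h1, Int.toNat_of_nonneg hp.le⟩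
    exact_mod_cast (hfb ℓ hℓ).trans hXn
  · refine le_trans ?_ hSc
    rw [Nat.card_Icc]
    have := Nat.lt_floor_add_one X
    have e : ((⌊X⌋₊ + 1 - 1 : ℕ) : ℝ) = ⌊X⌋₊ := by simp
    rw [e, div_le_div_iff₀ (by positivity) hr']
    nlinarith
  · intro s hs
    obtain ⟨ℓ, hℓ, rfl⟩ := Finset.mem_image.1 hs
    refine le_trans ?_ haX
    exact mul_le_mul_of_nonneg_left (hfb ℓ hℓ) ha.le

/-- numerical semigroup fact -/
lemma frob (P : Polynomial ℚ)
    (f : ℤ → ℤ) (hfP : ∀ ℓ : ℤ, (f ℓ : ℚ) = P.eval (ℓ : ℚ))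
    (hfpos : ∀ ℓ : ℤ, 1 ≤ ℓ → 0 < f ℓ)
    (hfprime : ∀ p : ℕ, p.Prime → ∃ ℓ : ℤ, ¬ ((p : ℤ) ∣ f ℓ)) :
    ∃ F0 : ℕ, ∀ m ≥ F0, ∃ E : Multiset ℕ, (∀ i ∈ E, 0 < i ∧ IsPart f i) ∧ E.sum = m := by
  obtain ⟨F0, hF0⟩ := Nat.exists_mem_closure_of_ge {s : ℕ | 0 < s ∧ IsPart f s}
  have hg : Nat.setGcd {s : ℕ | 0 < s ∧ IsPart f s} = 1 := by
    by_contra hne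
    obtain ⟨p, hp, hpd⟩ := Nat.exists_prime_and_dvd hne
    obtain ⟨ℓ, hℓ⟩ := hfprime p hp
    apply hℓ
    obtain ⟨q, hq, hper⟩ := poly_period P f hfP p (by exact_mod_cast hp.pos)
    rw [Nat.dvd_setGcd_iff] at hpd
    set ℓ' := ℓ + (|ℓ| + 1) * q with hℓ'
    have h1 : 1 ≤ ℓ' := by
      have : (1 : ℤ) ≤ q := by exact_mod_cast hq
      have h2 := neg_abs_le ℓ
      have h3 := abs_nonneg ℓ
      nlinarith
    have hp1 := hfpos ℓ' h1
    have h2 := hpd (f ℓ').toNat ⟨by omega, ℓ', h1, Int.toNat_of_nonneg hp1.le⟩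
    have h3 : (p : ℤ) ∣ f ℓ' := by
      rw [← Int.toNat_of_nonneg hp1.le]; exact_mod_cast h2
    have h4 := hper ℓ (|ℓ| + 1)
    rw [← hℓ'] at h4
    exact (dvd_sub_right h3).1 h4
  refine ⟨F0, fun m hm => ?_⟩
  obtain ⟨E, hE, hs⟩ := AddSubmonoid.exists_multiset_of_mem_closure (hF0 m hm (by rw [hg]; exact one_dvd m))
  exact ⟨E, hE, hs⟩

end PFW


namespace PFW

lemma exp_facts (y : ℝ) (hy : 0 < y) (s : ℕ) (hs : 0 < s) :
    0 < Real.exp (-(y * s)) ∧ Real.exp (-(y * s)) < 1 := by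
  refine ⟨Real.exp_pos _, ?_⟩
  have hs : (0 : ℝ) < s := by exact_mod_cast hs
  have : 0 < y * s := by positivity
  rw [Real.exp_lt_one_iff]; linarith

lemma tail_small (y : ℝ) (hy : 0 < y) (s H : ℕ) (hs : 0 < s) :
    Real.exp (-(y * s)) ^ (H / s + 1) ≤ Real.exp (-(y * H)) := by
  rw [← Real.exp_nat_mul]
  apply Real.exp_le_exp.2
  have h1 : H < s * (H / s + 1) := Nat.lt_mul_div_succ H hs
  have h2 : (H : ℝ) ≤ s * ((H / s + 1 : ℕ) : ℝ) := by exact_mod_cast h1.le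
  have : y * H ≤ y * (s * ((H / s + 1 : ℕ) : ℝ)) := by gcongr
  linarith

lemma geo (w : ℝ) (hw : w < 1) (J : ℕ) :
    ∑ j ∈ Finset.range (J + 1), w ^ j = (1 - w ^ (J + 1)) * (1 - w)⁻¹ := by
  rw [geom_sum_eq hw.ne, ← neg_div_neg_eq, neg_sub, neg_sub, div_eq_mul_inv]

lemma GH_le_GG (T : Finset ℕ) (hT : ∀ s ∈ T, 0 < s) (H : ℕ) (y : ℝ) (hy : 0 < y) :
    GH T H y ≤ GG T y := by
  refine Finset.prod_le_prod (fun s _ => Finset.sum_nonneg fun _ _ => by positivity) fun s hs => ?_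
  obtain ⟨h0, h1⟩ := exp_facts y hy s (hT s hs)
  rw [geo _ h1]
  have : 0 ≤ (1 - Real.exp (-(y * s)))⁻¹ := inv_nonneg.2 (by linarith)
  have h2 : 0 ≤ Real.exp (-(y * s)) ^ (H / s + 1) := by positivity
  nlinarith

lemma one_le_GH (T : Finset ℕ) (H : ℕ) (y : ℝ) : 1 ≤ GH T H y := by
  refine Finset.one_le_prod fun s _ => ?_
  rw [Finset.sum_range_succ']
  have : 0 ≤ ∑ j ∈ Finset.range (H / s), Real.exp (-(y * s)) ^ (j + 1) :=
    Finset.sum_nonneg fun _ _ => by positivity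
  simpa using this

lemma GG_le_two_GH (T : Finset ℕ) (n : ℕ) (hT : T ⊆ Finset.Icc 1 n) (H : ℕ) (y : ℝ) (hy : 0 < y)
    (hH : 2 * n * Real.exp (-(y * H)) ≤ 1) : GG T y ≤ 2 * GH T H y := by
  have hpos : ∀ s ∈ T, 0 < s := fun s hs => (Finset.mem_Icc.1 (hT hs)).1
  have hGG := GG_pos T hpos y hy
  rcases Nat.eq_zero_or_pos n with h0 | h0
  · subst h0
    have : T = ∅ := by simpa using hT
    subst this
    simp [GG, GH]
  have hn : (0 : ℝ) < n := by exact_mod_cast h0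
  have hn1 : (1 : ℝ) ≤ n := by exact_mod_cast h0
  set e := Real.exp (-(y * H)) with he
  have he0 : 0 < e := Real.exp_pos _
  have he1 : e ≤ 1 / 2 := by nlinarith
  have h1 : (1 - e) ^ T.card * GG T y ≤ GH T H y := by
    rw [← Finset.prod_const, GG, ← Finset.prod_mul_distrib]
    refine Finset.prod_le_prod (fun s hs => ?_) fun s hs => ?_
    · obtain ⟨h0, h1⟩ := exp_facts y hy s (hpos s hs)
      exact mul_nonneg (by linarith) (inv_nonneg.2 (by linarith))
    · obtain ⟨h0, h1⟩ := exp_facts y hy s (hpos s hs)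
      rw [geo _ h1]
      have h2 := tail_small y hy s H (hpos s hs)
      have : 0 ≤ (1 - Real.exp (-(y * s)))⁻¹ := inv_nonneg.2 (by linarith)
      gcongr
  have h2 : 1 / 2 ≤ (1 - e) ^ T.card := by
    have hb := one_add_mul_le_pow (a := -e) (by linarith) T.card
    have hc : (T.card : ℝ) ≤ n := by
      have : T.card ≤ n := by simpa using Finset.card_le_card hT
      exact_mod_cast this
    have : (T.card : ℝ) * e ≤ n * e := by gcongr
    rw [← sub_eq_add_neg] at hb
    linarith
  nlinarith

lemma GH_ratio (T S : Finset ℕ) (hST : S ⊆ T) (hT : ∀ s ∈ T, 0 < s) (H : ℕ) (a : ℝ) (ha : 0 < a)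
    (hS : ∀ s ∈ S, a * s ≤ 1) (hH : Real.exp (-(a * H)) ≤ 1 / 10) :
    GH T H (2 * a) ≤ Real.exp (-(S.card / 6)) * GH T H a := by
  classical
  have h1 : ∏ s ∈ T, (if s ∈ S then Real.exp (-(1 / 6)) else 1) = Real.exp (-(S.card / 6)) := by
    rw [Finset.prod_ite_mem, Finset.inter_eq_right.2 hST, Finset.prod_const, ← Real.exp_nat_mul]
    congr 1; ring
  rw [← h1, GH, GH, ← Finset.prod_mul_distrib]
  refine Finset.prod_le_prod (fun s _ => Finset.sum_nonneg fun _ _ => by positivity) fun s hs => ?_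
  obtain ⟨h0, h1⟩ := exp_facts a ha s (hT s hs)
  have hw2 : Real.exp (-(2 * a * s)) = Real.exp (-(a * s)) ^ 2 := by
    rw [← Real.exp_nat_mul]; congr 1; push_cast; ring
  have h2 := tail_small a ha s H (hT s hs)
  rw [hw2]
  set J := H / s
  have hlow : s ∈ S → 1 / 3 ≤ Real.exp (-(a * s)) := by
    intro h
    have h3 : Real.exp (-1) ≤ Real.exp (-(a * s)) := Real.exp_le_exp.2 (by linarith [hS s h])
    have h4 : 1 / 3 ≤ Real.exp (-1) := by
      rw [Real.exp_neg, ← one_div]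
      exact one_div_le_one_div_of_le (Real.exp_pos 1) (by linarith [Real.exp_one_lt_d9])
    linarith
  set w := Real.exp (-(a * s))
  split_ifs with hsS
  · have hw := hlow hsS
    have hw2 : w ^ 2 < 1 := by nlinarith
    rw [geo _ h1, geo _ hw2]
    have e1 : (1 - (w ^ 2) ^ (J + 1)) * (1 - w ^ 2)⁻¹ =
        (1 + w ^ (J + 1)) * (1 + w)⁻¹ * ((1 - w ^ (J + 1)) * (1 - w)⁻¹) := by
      rw [← pow_mul, mul_comm 2, pow_mul]
      have : 1 - w ^ 2 = (1 + w) * (1 - w) := by ring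
      rw [this, mul_inv]; ring
    rw [e1]
    have hwp : w ^ (J + 1) ≤ 1 := pow_le_one₀ h0.le h1.le
    refine mul_le_mul_of_nonneg_right ?_ (mul_nonneg (by linarith) (inv_nonneg.2 (by linarith)))
    rw [← div_eq_mul_inv, div_le_iff₀ (by linarith)]
    have h5 := Real.add_one_le_exp (-(1 / 6 : ℝ))
    have h6 : w ^ (J + 1) ≤ 1 / 10 := h2.trans hH
    nlinarith
  · rw [one_mul]
    refine Finset.sum_le_sum fun j _ => ?_
    rw [← pow_mul]
    exact pow_le_pow_of_le_one h0.le h1.le (by omega)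

lemma log_small (K : ℝ) : ∃ L0 : ℝ, 1 ≤ L0 ∧ ∀ L : ℝ, L0 ≤ L → K * Real.log L ≤ L := by
  have h := Real.isLittleO_log_id_atTop.const_mul_left K
  have h1 := h.def (c := 1) (by norm_num)
  rw [Filter.eventually_atTop] at h1
  obtain ⟨L0, hL0⟩ := h1
  refine ⟨max L0 1, le_max_right _ _, fun L hL => ?_⟩
  have h2 := hL0 L ((le_max_left _ _).trans hL)
  have h3 : 1 ≤ L := (le_max_right _ _).trans hL
  simp only [Real.norm_eq_abs, id, one_mul, abs_of_pos (by linarith : 0 < L)] at h2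
  exact (le_abs_self _).trans h2

end PFW


namespace PFW

set_option maxHeartbeats 1600000 in
lemma lower (r : ℕ) (hr : 1 ≤ r) (P : Polynomial ℚ) (hPdeg : P.natDegree = r)
    (hPlc : 0 < P.leadingCoeff)
    (f : ℤ → ℤ) (hfP : ∀ ℓ : ℤ, (f ℓ : ℚ) = P.eval (ℓ : ℚ))
    (hfpos : ∀ ℓ : ℤ, 1 ≤ ℓ → 0 < f ℓ)
    (hfprime : ∀ p : ℕ, p.Prime → ∃ ℓ : ℤ, ¬ ((p : ℤ) ∣ f ℓ)) :
    ∃ c2 : ℝ, 0 < c2 ∧ ∃ A : ℕ, ∃ L0 : ℝ, ∀ n : ℕ, ∀ L : ℝ, L0 ≤ L → L ^ r * L = n →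
      ∃ x : ℝ, 0 < x ∧ x ≤ c2 * L / n ∧ n * Real.exp (-(x * n)) ≤ 1 ∧
        Real.exp (n * x) * GG (Tn f n) x ≤ n ^ A * pf f n := by
  obtain ⟨C, hC, hgrow⟩ := growth r hr P hPdeg hPlc f hfP hfpos
  obtain ⟨C0, hC0, hup⟩ := poly_upper r P hPdeg f hfP
  obtain ⟨F0, hF0⟩ := frob P f hfP hfpos hfprime
  have hr1 : (1 : ℝ) ≤ r := by exact_mod_cast hr
  obtain ⟨m, hm⟩ : ∃ m : ℝ, m = 24 * r := ⟨_, rfl⟩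
  have hm1 : 1 ≤ m := by rw [hm]; linarith
  obtain ⟨c1, hc1⟩ : ∃ c1 : ℝ, c1 = 1 / (C0 * m ^ r) := ⟨_, rfl⟩
  have hm1r : 1 ≤ m ^ r := one_le_pow₀ hm1
  have hc1pos : 0 < c1 := by rw [hc1]; positivity
  have hc1eq : c1 * (C0 * m ^ r) = 1 := by rw [hc1]; field_simp
  have hc1le : c1 ≤ 1 := by
    rw [hc1, div_le_one (by positivity)]; nlinarith
  obtain ⟨c2, hc2⟩ : ∃ c2 : ℝ, c2 = 4 * (C + 1) := ⟨_, rfl⟩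
  have hc2pos : 0 < c2 := by rw [hc2]; positivity
  obtain ⟨K, hK⟩ : ∃ K : ℝ, K = 16 / c1 + 3 := ⟨_, rfl⟩
  obtain ⟨A0, hA0⟩ : ∃ A0 : ℝ, A0 = 4 * c2 / c1 + 2 * c2 := ⟨_, rfl⟩
  obtain ⟨L1, hL11, hL1⟩ := log_small (K * (r + 1))
  refine ⟨c2, hc2pos, 8 + ⌈A0⌉₊, max (max L1 8) (max (1 / c1) F0), ?_⟩
  intro n L hL hLn
  have hLL1 : L1 ≤ L := (le_max_left _ _).trans ((le_max_left _ _).trans hL)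
  have hL8 : 8 ≤ L := (le_max_right _ _).trans ((le_max_left _ _).trans hL)
  have hLc1 : 1 / c1 ≤ L := (le_max_left _ _).trans ((le_max_right _ _).trans hL)
  have hLF : (F0 : ℝ) ≤ L := (le_max_right _ _).trans ((le_max_right _ _).trans hL)
  have hLpos : 0 < L := by linarith
  have hLr1 : L ≤ L ^ r := le_self_pow₀ (by linarith) (by omega)
  have hLrpos : 0 < L ^ r := by positivity
  have hnL : L ≤ n := by rw [← hLn]; nlinarith
  have hn8 : (8 : ℝ) ≤ n := by linarith
  have hn0 : (0 : ℝ) < n := by linarith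
  obtain ⟨lg, hlg⟩ : ∃ lg : ℝ, lg = Real.log n := ⟨_, rfl⟩
  have hexplg : Real.exp lg = n := by rw [hlg, Real.exp_log hn0]
  have hlg1 : 1 ≤ lg := by
    rw [hlg, Real.le_log_iff_exp_le hn0]; linarith [Real.exp_one_lt_d9]
  have hlgK : K * lg ≤ L := by
    have : lg = (r + 1) * Real.log L := by
      rw [hlg, ← hLn, ← pow_succ, Real.log_pow]; push_cast; ring
    rw [this]
    have := hL1 L hLL1
    linarith
  have hc1lg : 16 / c1 * lg + 3 * lg ≤ L := by
    rw [hK] at hlgK; linarith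
  have h16 : 0 ≤ 16 / c1 * lg := by positivity
  have h3lg : 3 * lg ≤ L := by linarith
  have hlgc1 : lg ≤ c1 * L := by
    have : 16 / c1 * lg ≤ L := by linarith
    rw [div_mul_eq_mul_div, div_le_iff₀ hc1pos] at this
    linarith
  have h16' : 16 * lg ≤ c1 * L := by
    have : 16 / c1 * lg ≤ L := by linarith
    rw [div_mul_eq_mul_div, div_le_iff₀ hc1pos] at this
    linarith
  obtain ⟨a, ha⟩ : ∃ a : ℝ, a = c1 * L / n := ⟨_, rfl⟩
  obtain ⟨b, hb⟩ : ∃ b : ℝ, b = c2 * L / n := ⟨_, rfl⟩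
  have hapos : 0 < a := by rw [ha]; positivity
  have haL : a * L ^ r = c1 := by
    rw [ha, ← hLn]; field_simp
  have han : a * n = c1 * L := by rw [ha]; field_simp
  have hbn : b * n = c2 * L := by rw [hb]; field_simp
  have hbL : b * L ^ r = c2 := by
    rw [hb, ← hLn]; field_simp
  have hbpos : 0 < b := by rw [hb]; positivity
  have hab : a ≤ b := by
    rw [ha, hb]; gcongr; rw [hc2]; linarith
  obtain ⟨H, hH⟩ : ∃ H : ℕ, H = ⌈2 * lg / a⌉₊ := ⟨_, rfl⟩
  have hH1 : 2 * lg / a ≤ H := by rw [hH]; exact Nat.le_ceil _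
  have hH2 : (H : ℝ) ≤ 2 * lg / a + 1 := by
    rw [hH]; exact (Nat.ceil_lt_add_one (by positivity)).le
  have haH : 2 * lg ≤ a * H := by
    rw [div_le_iff₀ hapos] at hH1; linarith
  have hH4 : 4 * (H : ℝ) ≤ n := by
    have h1 : 2 * lg / a ≤ n / 8 := by
      rw [div_le_iff₀ hapos]
      have : (n : ℝ) / 8 * a = c1 * L / 8 := by rw [← han]; ring
      rw [this]; linarith
    linarith
  have hH4' : 4 * H ≤ n := by exact_mod_cast hH4
  have hHF : F0 ≤ H := by
    have : (F0 : ℝ) ≤ H := by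
      refine le_trans (hLF.trans ?_) hH1
      rw [le_div_iff₀ hapos]
      have : L * a ≤ L ^ r * a := by gcongr
      linarith
    exact_mod_cast this
  have hexp2 : Real.exp (-(2 * lg)) = 1 / (n : ℝ) ^ 2 := by
    rw [Real.exp_neg, two_mul, Real.exp_add, hexplg, sq, one_div]
  have hxH : ∀ x, a ≤ x → Real.exp (-(x * H)) ≤ 1 / (n : ℝ) ^ 2 := by
    intro x hx
    rw [← hexp2]
    apply Real.exp_le_exp.2
    have : a * H ≤ x * H := by gcongr
    linarith
  have hHpos : (0 : ℝ) ≤ H := by positivity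
  have hnH : (n : ℝ) * H + 1 ≤ (n : ℝ) ^ 2 := by nlinarith
  have hnHe : (n : ℝ) * H + 1 ≤ Real.exp (2 * lg) := by
    rw [two_mul, Real.exp_add, hexplg, ← sq]; exact hnH
  obtain ⟨ν, hν⟩ : ∃ ν : ℕ, ν = n - 2 * H := ⟨_, rfl⟩
  have hνn : ν + 2 * H = n := by omega
  have hνn' : (ν : ℝ) + 2 * H = n := by exact_mod_cast hνn
  obtain ⟨T, hT⟩ : ∃ T, T = Tn f n := ⟨_, rfl⟩
  have hTs : T ⊆ Finset.Icc 1 n := by rw [hT]; exact Tn_sub f n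
  have hTpos : ∀ s ∈ T, 0 < s := fun s hs => (Finset.mem_Icc.1 (hTs hs)).1
  -- condition A
  have condA : ((n : ℝ) * H + 1) * (Real.exp (ν * a) * GH T H (2 * a)) < GH T H a := by
    obtain ⟨S, hS1, hS2, hS3⟩ := count_small r hr P hPdeg f hfP hfpos C0 hC0 hup n (m * L) a
      (by nlinarith) hapos (by
        rw [mul_pow, ← mul_assoc, ← hLn, mul_comm]
        gcongr
        have : C0 * m ^ r = 1 / c1 := by field_simp; linarith
        rw [this]; exact hLc1) (by
        rw [mul_pow]
        have : a * (C0 * (m ^ r * L ^ r)) = (a * L ^ r) * (C0 * m ^ r) := by ring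
        rw [this, haL, hc1eq])
    have hrat := GH_ratio T S (by rw [hT]; exact hS1) hTpos H a hapos hS3 (by
      refine (hxH a le_rfl).trans ?_
      apply one_div_le_one_div_of_le (by norm_num)
      nlinarith)
    have hSc : 12 * L ≤ S.card := by
      refine le_trans (le_of_eq ?_) hS2
      rw [hm]; field_simp; ring
    have hGa := GH_pos T H a
    have hνa : ν * a ≤ L := by
      have : (ν : ℝ) ≤ n := by linarith
      calc ν * a ≤ n * a := by gcongr
        _ = c1 * L := by rw [mul_comm]; exact han
        _ ≤ 1 * L := by gcongr
        _ = L := one_mul L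
    have hGa2 := GH_pos T H (2 * a)
    calc ((n : ℝ) * H + 1) * (Real.exp (ν * a) * GH T H (2 * a))
        ≤ Real.exp (2 * lg) * (Real.exp L * (Real.exp (-(S.card / 6)) * GH T H a)) := by
          gcongr
      _ = Real.exp (2 * lg + L - S.card / 6) * GH T H a := by
          rw [sub_eq_add_neg, Real.exp_add, Real.exp_add]; ring
      _ < 1 * GH T H a := by
          apply mul_lt_mul_of_pos_right _ hGa
          rw [Real.exp_lt_one_iff]; linarith
      _ = _ := one_mul _
  have condB : ((n : ℝ) * H + 1) * (Real.exp (-(ν * (b / 2))) * GH T H (b / 2)) < GH T H b := by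
    refine lt_of_lt_of_le ?_ (one_le_GH T H b)
    have h1 : GH T H (b / 2) ≤ Real.exp (C * L) := by
      refine (GH_le_GG T hTpos H (b / 2) (by positivity)).trans ?_
      rw [hT]
      apply hgrow n (b / 2) L (by linarith)
      have : b / 2 * L ^ r = c2 / 2 := by rw [← hbL]; ring
      rw [this, hc2]; linarith
    have h2 : (C + 1) * L ≤ ν * (b / 2) := by
      have : (n : ℝ) / 2 ≤ ν := by linarith
      calc (C + 1) * L = (n : ℝ) / 2 * (b / 2) := by
            have : (n : ℝ) / 2 * (b / 2) = b * n / 4 := by ring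
            rw [this, hbn, hc2]; ring
        _ ≤ _ := by gcongr
    have hGp := GH_pos T H (b / 2)
    calc ((n : ℝ) * H + 1) * (Real.exp (-(ν * (b / 2))) * GH T H (b / 2))
        ≤ Real.exp (2 * lg) * (Real.exp (-((C + 1) * L)) * Real.exp (C * L)) := by
          gcongr
      _ = Real.exp (2 * lg - L) := by
          rw [← Real.exp_add, ← Real.exp_add]; congr 1; ring
      _ < 1 := by rw [Real.exp_lt_one_iff]; linarith
  obtain ⟨x, ⟨hxa, hxb⟩, n', hn', hmain⟩ := local_lower T n H ν hTs a b hapos hab condA condB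
  have hxpos : 0 < x := hapos.trans_le hxa
  obtain ⟨hn'1, hn'2⟩ := Finset.mem_Icc.1 hn'
  refine ⟨x, hxpos, by rw [← hb]; exact hxb, ?_, ?_⟩
  · have h1 : lg ≤ x * n := by
      have : a * n ≤ x * n := by gcongr
      linarith
    calc (n : ℝ) * Real.exp (-(x * n)) ≤ n * Real.exp (-lg) := by gcongr
      _ = 1 := by rw [Real.exp_neg, hexplg]; field_simp
  · obtain ⟨E, hE1, hE2⟩ := hF0 (n - n') (by omega)
    have hcard : (fib T (fun s => H / s) n').card ≤ pf f n := by
      refine fib_card_le_pf f T ?_ _ n' n E hE1 (by omega)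
      intro s hs
      refine ⟨hTpos s hs, ?_⟩
      classical
      rw [hT, Tn, Finset.mem_filter] at hs
      exact hs.2
    have hcard' : ((fib T (fun s => H / s) n').card : ℝ) ≤ pf f n := by exact_mod_cast hcard
    have hGG := GG_le_two_GH T n hTs H x hxpos (by
      calc 2 * (n : ℝ) * Real.exp (-(x * H)) ≤ 2 * n * (1 / (n : ℝ) ^ 2) := by
            gcongr; exact hxH x hxa
        _ = 2 / n := by field_simp
        _ ≤ 1 := by rw [div_le_one hn0]; linarith)
    have hn'r : (n : ℝ) - 2 * H ≤ n' := by
      have : (ν : ℝ) ≤ n' := by exact_mod_cast hn'1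
      linarith
    have hexpo : n * x - n' * x ≤ A0 * lg := by
      have h1 : n * x - n' * x ≤ 2 * H * b := by
        calc n * x - n' * x = (n - n') * x := by ring
          _ ≤ (2 * H) * x := by gcongr; linarith
          _ ≤ _ := by gcongr
      have h2 : 2 * H * b ≤ 2 * (2 * lg / a + 1) * b := by gcongr
      have hba : b = c2 / c1 * a := by rw [ha, hb]; field_simp
      have h3 : 2 * (2 * lg / a + 1) * b = 4 * c2 / c1 * lg + 2 * b := by
        have e : 2 * (2 * lg / a + 1) * b = 4 * lg * (b / a) + 2 * b := by ring
        have e2 : b / a = c2 / c1 := by rw [hba]; field_simp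
        rw [e, e2]; ring
      have h4 : b ≤ c2 * lg := by
        have : b ≤ c2 := by
          rw [← hbL]; exact le_mul_of_one_le_right hbpos.le (by linarith)
        nlinarith
      rw [hA0]
      linarith
    have hexpA : Real.exp (n * x) * Real.exp (-(n' * x)) ≤ (n : ℝ) ^ ⌈A0⌉₊ := by
      rw [← Real.exp_add]
      calc Real.exp (n * x + -(n' * x)) ≤ Real.exp (⌈A0⌉₊ * lg) := by
            apply Real.exp_le_exp.2
            have : A0 * lg ≤ ⌈A0⌉₊ * lg := by gcongr; exact Nat.le_ceil _
            linarith
        _ = _ := by rw [Real.exp_nat_mul, hexplg]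
    have hQ : 4 * (((n : ℝ) * H + 1) ^ 2 * ((n + 2) * (H + 1))) ≤ (n : ℝ) ^ 8 := by
      have h1 : (n : ℝ) + 2 ≤ (n : ℝ) ^ 2 := by nlinarith
      have h2 : (H : ℝ) + 1 ≤ n := by linarith
      have h3 : (4 : ℝ) ≤ n := by linarith
      calc 4 * (((n : ℝ) * H + 1) ^ 2 * ((n + 2) * (H + 1)))
          ≤ n * (((n : ℝ) ^ 2) ^ 2 * ((n : ℝ) ^ 2 * n)) := by gcongr
        _ = _ := by ring
    rw [← hT]
    calc Real.exp (n * x) * GG T x ≤ Real.exp (n * x) * (2 * GH T H x) := by gcongr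
      _ ≤ Real.exp (n * x) * (2 * (2 * ((n * H + 1) ^ 2 * ((n + 2) * (H + 1))) *
        (((fib T (fun s => H / s) n').card : ℝ) * Real.exp (-(n' * x))))) := by gcongr
      _ = (4 * (((n : ℝ) * H + 1) ^ 2 * ((n + 2) * (H + 1)))) *
          (Real.exp (n * x) * Real.exp (-(n' * x))) * ((fib T (fun s => H / s) n').card : ℝ) := by ring
      _ ≤ (n : ℝ) ^ 8 * (n : ℝ) ^ ⌈A0⌉₊ * pf f n := by gcongr
      _ = _ := by rw [pow_add]

end PFW


namespace PFW

lemma cop_f0 (f : ℤ → ℤ) (hfprime : ∀ p : ℕ, p.Prime → ∃ ℓ : ℤ, ¬ ((p : ℤ) ∣ f ℓ))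
    (Pif : ℕ) (hPif : ∀ d : ℕ, d ∣ Pif ↔ ∀ ℓ : ℤ, (d : ℤ) ∣ (f ℓ - f 0))
    (δ : ℕ) (hδ : δ ∣ Pif) : IsCoprime (δ : ℤ) (f 0) := by
  rw [Int.isCoprime_iff_gcd_eq_one]
  by_contra h
  obtain ⟨p, hp, hpd⟩ := Nat.exists_prime_and_dvd h
  obtain ⟨ℓ, hℓ⟩ := hfprime p hp
  apply hℓ
  have h1 : (p : ℤ) ∣ (δ : ℤ) := (Int.natCast_dvd_natCast.mpr hpd).trans (Int.gcd_dvd_left ..)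
  have h2 : (p : ℤ) ∣ f 0 := (Int.natCast_dvd_natCast.mpr hpd).trans (Int.gcd_dvd_right ..)
  have h3 := (hPif p).mp ((Int.natCast_dvd_natCast.mp h1).trans hδ) ℓ
  have := dvd_add h3 h2
  simpa using this

lemma ms_mod (f : ℤ → ℤ) (δ : ℤ) (hδ : ∀ ℓ : ℤ, δ ∣ f ℓ - f 0) (s : Multiset ℕ)
    (hs : ∀ i ∈ s, ∃ ℓ : ℤ, 1 ≤ ℓ ∧ (i : ℤ) = f ℓ) :
    δ ∣ (s.sum : ℤ) - Multiset.card s * f 0 := by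
  induction s using Multiset.induction_on with
  | empty => simp
  | cons i s ih =>
    have h1 := ih (fun j hj => hs j (Multiset.mem_cons_of_mem hj))
    obtain ⟨ℓ, _, hℓ⟩ := hs i (Multiset.mem_cons_self i s)
    have h2 := hδ ℓ
    rw [← hℓ] at h2
    have := dvd_add h1 h2
    have e : ((i ::ₘ s).sum : ℤ) - Multiset.card (i ::ₘ s) * f 0 =
        (s.sum : ℤ) - Multiset.card s * f 0 + (i - f 0) := by
      rw [Multiset.sum_cons, Multiset.card_cons]; push_cast; ring
    rw [e]; exact this

lemma card_mod (f : ℤ → ℤ) (hfprime : ∀ p : ℕ, p.Prime → ∃ ℓ : ℤ, ¬ ((p : ℤ) ∣ f ℓ))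
    (Pif : ℕ) (hPif : ∀ d : ℕ, d ∣ Pif ↔ ∀ ℓ : ℤ, (d : ℤ) ∣ (f ℓ - f 0))
    (δ : ℕ) (hδ : δ ∣ Pif) (n a : ℕ) (hna : (δ : ℤ) ∣ ((n : ℤ) - (a : ℤ) * f 0))
    (π : n.Partition) (hπ : π ∈ Pn f n) : (δ : ℤ) ∣ (Multiset.card π.parts : ℤ) - a := by
  have hp : PartsIn f π := by simpa [Pn] using hπ
  have h1 := ms_mod f δ ((hPif δ).mp hδ) π.parts hp
  rw [π.parts_sum] at h1
  have h2 := dvd_sub hna h1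
  have h3 : (δ : ℤ) ∣ ((Multiset.card π.parts : ℤ) - a) * f 0 := by
    have e : ((Multiset.card π.parts : ℤ) - a) * f 0 =
        ((n : ℤ) - a * f 0) - ((n : ℤ) - Multiset.card π.parts * f 0) := by ring
    rw [e]; exact h2
  exact (cop_f0 f hfprime Pif hPif δ hδ).dvd_of_dvd_mul_right h3

lemma nd_ge (Pif k δ j : ℕ) (hk : 0 < k) (hδ0 : 0 < δ) (hδ : δ ∣ Pif)
    (hco : ∀ p : ℕ, p.Prime → p ∣ k → ¬ (p * δ ∣ Pif)) (hj : ¬ k ∣ j) :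
    1 / (k : ℝ) ≤ nd (Pif * ((j : ℝ) / ((δ * k : ℕ) : ℝ))) := by
  by_contra h
  push Not at h
  obtain ⟨t, rfl⟩ := hδ
  have hcop : Nat.Coprime k t := by
    by_contra hc
    obtain ⟨p, hp, hpd⟩ := Nat.exists_prime_and_dvd hc
    refine hco p hp (hpd.trans (Nat.gcd_dvd_left ..)) ?_
    rw [mul_comm p δ]
    exact mul_dvd_mul_left δ (hpd.trans (Nat.gcd_dvd_right ..))
  have e : ((δ * t : ℕ) : ℝ) * ((j : ℝ) / ((δ * k : ℕ) : ℝ)) = (((t * j : ℕ) : ℤ) : ℝ) / ((k : ℤ) : ℝ) := by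
    push_cast; field_simp
  rw [e] at h
  have h2 := dvd_of_nd_lt (D := (k : ℤ)) (a := ((t * j : ℕ) : ℤ)) (by exact_mod_cast hk)
    (by simpa using h)
  exact hj (hcop.dvd_of_dvd_mul_left (Int.natCast_dvd_natCast.mp h2))

lemma card_mult (δ k : ℕ) (hk : 0 < k) :
    ((Finset.range (δ * k)).filter (fun h => k ∣ h)).card = δ := by
  have : (Finset.range (δ * k)).filter (fun h => k ∣ h) = (Finset.range δ).image (fun i => k * i) := by
    ext h
    simp only [Finset.mem_filter, Finset.mem_range, Finset.mem_image]
    constructor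
    · rintro ⟨h1, i, rfl⟩
      refine ⟨i, ?_, rfl⟩
      rw [mul_comm δ k] at h1
      exact lt_of_mul_lt_mul_left h1 (Nat.zero_le k)
    · rintro ⟨i, hi, rfl⟩
      refine ⟨?_, dvd_mul_right k i⟩
      rw [mul_comm δ k]
      exact Nat.mul_lt_mul_of_pos_left hi hk
  rw [this, Finset.card_image_of_injective, Finset.card_range]
  intro x y hxy
  exact Nat.eq_of_mul_eq_mul_left hk hxy

lemma assemble (f : ℤ → ℤ) (n a k δ : ℕ) (hk : 0 < k) (hδ0 : 0 < δ) (B : ℝ)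
    (hmod : ∀ π ∈ Pn f n, (δ : ℤ) ∣ (Multiset.card π.parts : ℤ) - a)
    (hB0 : 0 ≤ B)
    (hB : ∀ j : ℕ, ¬ k ∣ j →
      ‖∑ π ∈ Pn f n, ee ((j : ℝ) / ((δ * k : ℕ) : ℝ)) ^ (Multiset.card π.parts)‖ ≤ B) :
    |(pfa f a (δ * k) n : ℝ) - (pf f n : ℝ) / k| ≤ B := by
  set K := δ * k with hK
  have hK0 : 0 < K := Nat.mul_pos hδ0 hk
  have hKr : (0 : ℝ) < K := by exact_mod_cast hK0
  set g : ℕ → ℂ := fun h => ∑ π ∈ Pn f n, ee ((h : ℝ) * ((((Multiset.card π.parts : ℤ) - a : ℤ) : ℝ) / K)) with hg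
  have h1 : ∑ h ∈ Finset.range K, g h = (K : ℂ) * pfa f a K n := by
    rw [hg, Finset.sum_comm, Finset.sum_congr rfl (fun π _ => orth K hK0 _), pfa_eq,
      Finset.sum_ite, Finset.sum_const_zero, add_zero, Finset.sum_const, nsmul_eq_mul, mul_comm]
    congr 3
    apply Finset.filter_congr
    intro π _
    rw [← Int.modEq_iff_dvd, Int.natCast_modEq_iff]
    exact eq_comm
  have h2 : ∀ h, k ∣ h → g h = pf f n := by
    rintro h ⟨i, rfl⟩
    rw [hg, pf_eq]
    simp only
    rw [Finset.sum_congr rfl (g := fun _ => (1 : ℂ))]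
    · simp
    · intro π hπ
      obtain ⟨d, hd⟩ := hmod π hπ
      rw [hd]
      have : ((k * i : ℕ) : ℝ) * ((((δ : ℤ) * d : ℤ) : ℝ) / K) = ((i * d : ℤ) : ℝ) := by
        rw [hK]; push_cast; field_simp
      rw [this, ee_int]
  have h3 : ∀ h, ¬ k ∣ h → ‖g h‖ ≤ B := by
    intro h hh
    have : g h = ee (-((h : ℝ) * a / K)) *
        ∑ π ∈ Pn f n, ee ((h : ℝ) / (K : ℝ)) ^ (Multiset.card π.parts) := by
      rw [hg, Finset.mul_sum]
      apply Finset.sum_congr rfl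
      intro π _
      rw [← ee_nsmul, ← ee_add]
      congr 1
      push_cast; ring
    rw [this, norm_mul, norm_ee, one_mul]
    exact hB h hh
  have h4 : (K : ℂ) * ((pfa f a K n : ℂ) - (pf f n : ℂ) / k) =
      ∑ h ∈ (Finset.range K).filter (fun h => ¬ k ∣ h), g h := by
    rw [mul_sub, ← h1, ← Finset.sum_filter_add_sum_filter_not (Finset.range K) (fun h => k ∣ h) g,
      Finset.sum_congr rfl (fun h hh => h2 h (Finset.mem_filter.mp hh).2), Finset.sum_const,
      card_mult δ k hk, hK]
    have : (k : ℂ) ≠ 0 := by exact_mod_cast hk.ne'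
    push_cast
    rw [nsmul_eq_mul]
    field_simp
    ring
  have h5 : ‖(K : ℂ) * ((pfa f a K n : ℂ) - (pf f n : ℂ) / k)‖ ≤ K * B := by
    rw [h4]
    refine (norm_sum_le _ _).trans ?_
    refine (Finset.sum_le_card_nsmul _ _ B (fun h hh => h3 h (Finset.mem_filter.mp hh).2)).trans ?_
    rw [nsmul_eq_mul]
    gcongr
    exact (Finset.card_filter_le _ _).trans (Finset.card_range K).le
  have h6 : ‖(K : ℂ) * ((pfa f a K n : ℂ) - (pf f n : ℂ) / k)‖ =
      K * |(pfa f a K n : ℝ) - (pf f n : ℝ) / k| := by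
    rw [norm_mul, Complex.norm_natCast]
    congr 1
    rw [← Real.norm_eq_abs, ← Complex.norm_real]
    push_cast; rfl
  rw [h6] at h5
  exact le_of_mul_le_mul_left h5 hKr

lemma final_calc (A : ℕ) (c3 n L k p D : ℝ) (_hc3 : 0 < c3) (hn : 1 ≤ n) (hk : 1 ≤ k)
    (hkL : k ^ 2 ≤ n) (hp : 0 ≤ p) (hD1 : D ≤ p)
    (hD2 : D ≤ n ^ A * p * (Real.exp 1 * Real.exp (-(c3 * L / k ^ 2)))) :
    D ≤ Real.exp 1 * (p / k) * n * Real.exp (-(c3 / (2 * (A + 1)) * L / k ^ 2)) := by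
  set lg := Real.log n with hlg
  have hlg0 : 0 ≤ lg := Real.log_nonneg hn
  have hen : Real.exp lg = n := Real.exp_log (by linarith)
  set X := c3 * L / k ^ 2 with hX
  set θ : ℝ := 1 / (2 * (A + 1)) with hθ
  have hA : (0 : ℝ) ≤ A := Nat.cast_nonneg A
  have hθ0 : 0 < θ := by positivity
  have hθ1 : θ ≤ 1 := by
    rw [hθ, div_le_one (by positivity)]; linarith
  have hθA : θ * A ≤ 1 / 2 := by
    rw [hθ, div_mul_eq_mul_div, div_le_div_iff₀ (by positivity) (by norm_num)]; linarith
  have e1 : c3 / (2 * (A + 1)) * L / k ^ 2 = θ * X := by rw [hθ, hX]; ring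
  rw [e1]
  set w := 1 + A * lg - X with hw
  have hD2' : D ≤ p * Real.exp w := by
    refine hD2.trans (le_of_eq ?_)
    rw [hw, sub_eq_add_neg, Real.exp_add, Real.exp_add, Real.exp_nat_mul, hen]; ring
  have hD3 : D ≤ p * Real.exp (θ * w) := by
    rcases le_total 0 w with h | h
    · refine hD1.trans ?_
      have : 1 ≤ Real.exp (θ * w) := Real.one_le_exp (by positivity)
      nlinarith
    · refine hD2'.trans ?_
      gcongr
      nlinarith
  have hkn : k ≤ Real.exp (lg / 2) := by
    refine (sq_le_sq₀ (by linarith) (Real.exp_pos _).le).mp ?_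
    rw [← Real.exp_nat_mul]
    refine hkL.trans (le_of_eq ?_)
    rw [← hen]; congr 1; push_cast; ring
  refine hD3.trans ?_
  have h7 : θ * w ≤ 1 + lg / 2 - θ * X := by
    have : θ * w = θ + (θ * A) * lg - θ * X := by rw [hw]; ring
    rw [this]
    nlinarith
  have hk0 : 0 < k := by linarith
  have h8 : Real.exp (lg / 2) ≤ n / k := by
    rw [le_div_iff₀ hk0]
    calc Real.exp (lg / 2) * k ≤ Real.exp (lg / 2) * Real.exp (lg / 2) := by gcongr
      _ = n := by rw [← Real.exp_add, ← hen]; congr 1; ring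
  calc p * Real.exp (θ * w) ≤ p * Real.exp (1 + lg / 2 - θ * X) := by gcongr
    _ = p * (Real.exp 1 * Real.exp (lg / 2) * Real.exp (-(θ * X))) := by
        rw [sub_eq_add_neg, Real.exp_add, Real.exp_add]
    _ ≤ p * (Real.exp 1 * (n / k) * Real.exp (-(θ * X))) := by gcongr
    _ = _ := by ring

end PFW

theorem stmt3 (r : ℕ) (hr : 1 ≤ r) (P : Polynomial ℚ) (hPdeg : P.natDegree = r)
    (hPlc : 0 < P.leadingCoeff)
    (f : ℤ → ℤ) (hfP : ∀ ℓ : ℤ, (f ℓ : ℚ) = P.eval (ℓ : ℚ))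
    (hfpos : ∀ ℓ : ℤ, 1 ≤ ℓ → 0 < f ℓ)
    (hfprime : ∀ p : ℕ, p.Prime → ∃ ℓ : ℤ, ¬ ((p : ℤ) ∣ f ℓ))
    (Pif : ℕ) (hPifpos : 0 < Pif)
    (hPif : ∀ d : ℕ, d ∣ Pif ↔ ∀ ℓ : ℤ, (d : ℤ) ∣ (f ℓ - f 0)) :
    ∃ δf C : ℝ, ∃ N : ℕ, 0 < δf ∧ 0 < C ∧ 0 < N ∧
      ∀ n a k δ : ℕ, N ≤ n → 0 < a → 0 < k → 0 < δ → δ ∣ Pif →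
        (∀ p : ℕ, p.Prime → p ∣ k → ¬ (p * δ ∣ Pif)) →
        ((k : ℝ) ^ 2 ≤ (n : ℝ) ^ ((1 : ℝ) / (1 + r))) →
        ((δ : ℤ) ∣ ((n : ℤ) - (a : ℤ) * f 0)) →
        |(pfa f a (δ * k) n : ℝ) - (pfa f a δ n : ℝ) / k| ≤
          C * ((pfa f a δ n : ℝ) / k) * n *
            Real.exp (-(δf * (n : ℝ) ^ ((1 : ℝ) / (1 + r)) / (k : ℝ) ^ 2)) := by
  obtain ⟨c2, hc2, A, L1, hlow⟩ := PFW.lower r hr P hPdeg hPlc f hfP hfpos hfprime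
  obtain ⟨c3, L2, hc3, hup⟩ := PFW.upper r hr P hPdeg hPlc f hfP hfpos Pif hPifpos hPif c2 hc2
  set M : ℝ := max 1 (max L1 L2) with hM
  have hM1 : 1 ≤ M := le_max_left _ _
  refine ⟨c3 / (2 * (A + 1)), Real.exp 1, ⌈M ^ (r + 1)⌉₊ + 1, by positivity, Real.exp_pos 1,
    Nat.succ_pos _, ?_⟩
  intro n a k δ hn _ha hk hδ0 hδ hco hkL hna
  have hnN : M ^ (r + 1) ≤ n := by
    refine (Nat.le_ceil _).trans ?_
    exact_mod_cast (Nat.le_succ _).trans hn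
  have hn0 : (0 : ℝ) ≤ n := Nat.cast_nonneg n
  set L : ℝ := (n : ℝ) ^ ((1 : ℝ) / (1 + r)) with hLdef
  have hL0 : 0 ≤ L := Real.rpow_nonneg hn0 _
  have hLn' : L ^ (r + 1) = n := by
    rw [hLdef, ← Real.rpow_natCast, ← Real.rpow_mul hn0]
    have : (1 : ℝ) / (1 + r) * ((r + 1 : ℕ) : ℝ) = 1 := by push_cast; field_simp; ring
    rw [this, Real.rpow_one]
  have hLn : L ^ r * L = n := by rw [← pow_succ]; exact hLn'
  have hML : M ≤ L := by
    by_contra h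
    push Not at h
    have := pow_lt_pow_left₀ h hL0 (Nat.succ_ne_zero r)
    rw [Nat.succ_eq_add_one] at this
    linarith
  have hL1 : 1 ≤ L := hM1.trans hML
  have hLr : 1 ≤ L ^ r := one_le_pow₀ hL1
  have hLlen : L ≤ n := by rw [← hLn]; nlinarith
  obtain ⟨x, hx0, hxc, hxn, hx⟩ := hlow n L
    (((le_max_left _ _).trans (le_max_right _ _)).trans hML) hLn
  have hmod := PFW.card_mod f hfprime Pif hPif δ hδ n a hna
  have hpδ : pfa f a δ n = pf f n := by
    rw [PFW.pfa_eq, PFW.pf_eq, Finset.filter_true_of_mem]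
    intro π hπ
    have := hmod π hπ
    rw [← Int.modEq_iff_dvd, Int.natCast_modEq_iff] at this
    exact this.symm
  rw [hpδ]
  have hk1 : (1 : ℝ) ≤ k := by exact_mod_cast hk
  have hG := PFW.GG_pos
  apply PFW.final_calc A c3 n L k (pf f n) _ hc3 (hL1.trans hLlen) hk1 (hkL.trans hLlen)
    (Nat.cast_nonneg _)
  · have h1 : (pfa f a (δ * k) n : ℝ) ≤ pf f n := by
      rw [PFW.pfa_eq, PFW.pf_eq]
      exact_mod_cast Finset.card_filter_le _ _
    have h2 : (pf f n : ℝ) / k ≤ pf f n := div_le_self (Nat.cast_nonneg _) hk1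
    have h3 : 0 ≤ (pf f n : ℝ) / k := by positivity
    have h4 : (0 : ℝ) ≤ pfa f a (δ * k) n := Nat.cast_nonneg _
    rw [abs_le]; constructor <;> linarith
  · apply PFW.assemble f n a k δ hk hδ0 _ hmod (by positivity)
    intro j hj
    refine (hup n L x ((j : ℝ) / ((δ * k : ℕ) : ℝ)) k hk
      (((le_max_right _ _).trans (le_max_right _ _)).trans hML) hLn hx0 hxc hxn
      (PFW.nd_ge Pif k δ j hk hδ0 hδ hco hj)).trans ?_
    calc Real.exp (n * x) * (Real.exp 1 * (PFW.GG (PFW.Tn f n) x * Real.exp (-(c3 * L / (k : ℝ) ^ 2))))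
        = (Real.exp (n * x) * PFW.GG (PFW.Tn f n) x) * (Real.exp 1 * Real.exp (-(c3 * L / (k : ℝ) ^ 2))) := by
          ring
      _ ≤ _ := by gcongr
end

section
/- Let a, k be positive integers with gcd(k, Π_f) = 1. Then p_f(a, k; n) ∼ p_f(n)/k as n → ∞; that is, the quotient k · p_f(a, k; n) / p_f(n) tends to 1 as n → ∞. -/
noncomputable section
open Classical in
def WW (A : Set ℕ) (n : ℕ) : Finset (Multiset ℕ) :=
  ((Finset.univ : Finset n.Partition).image (fun π => π.parts)).filter (fun m => ∀ i ∈ m, i ∈ A)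
end

lemma mem_WW {A : Set ℕ} (hA : ∀ i ∈ A, 0 < i) {n : ℕ} {m : Multiset ℕ} :
    m ∈ WW A n ↔ m.sum = n ∧ ∀ i ∈ m, i ∈ A := by
  classical
  unfold WW
  simp only [Finset.mem_filter, Finset.mem_image, Finset.mem_univ, true_and]
  constructor
  · rintro ⟨⟨π, rfl⟩, h⟩
    exact ⟨π.parts_sum, h⟩
  · rintro ⟨h1, h2⟩
    exact ⟨⟨⟨m, fun {i} hi => hA i (h2 i hi), h1⟩, rfl⟩, h2⟩

open Classical in
lemma case1 {A : Set ℕ} (hA : ∀ i ∈ A, 0 < i) (n s : ℕ) (hs : s ∈ A) (B : Finset ℕ)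
    (t M : ℕ) :
    ((WW A n).filter (fun l => l.count s < t ∧ ∃ b ∈ B, b ≠ s ∧ 0 < b ∧ M * s ≤ l.count b)).card * M
      ≤ (WW A n).card * (B.card * t) := by
  apply Finset.card_mul_le_card_mul (fun l m => ∃ b ∈ B, b ≠ s ∧ 0 < b ∧ ∃ u : ℕ,
      u * s ≤ l.count b ∧ m = l - Multiset.replicate (u * s) b + Multiset.replicate (u * b) s)
  · intro l hl
    rw [Finset.mem_filter, mem_WW hA] at hl
    obtain ⟨⟨hsum, hmem⟩, ht, b, hb, hbs, hb0, hM⟩ := hl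
    have hle : ∀ u < M, u * s ≤ l.count b := fun u hu =>
      le_trans (Nat.mul_le_mul_right _ hu.le) hM
    have hinj : Set.InjOn (fun u => l - Multiset.replicate (u * s) b + Multiset.replicate (u * b) s)
        (Finset.range M : Set ℕ) := by
      intro u _ v _ h
      have h2 := congrArg (Multiset.count s) h
      simp only [Multiset.count_add, Multiset.count_sub, Multiset.count_replicate, if_neg hbs,
        if_true] at h2
      have : u * b = v * b := by omega
      exact Nat.eq_of_mul_eq_mul_right hb0 this
    calc M = ((Finset.range M).image (fun u => l - Multiset.replicate (u * s) b +
            Multiset.replicate (u * b) s)).card := by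
          rw [Finset.card_image_of_injOn hinj, Finset.card_range]
      _ ≤ _ := by
          apply Finset.card_le_card
          intro m hm
          rw [Finset.mem_image] at hm
          obtain ⟨u, hu, rfl⟩ := hm
          have hu := hle u (Finset.mem_range.1 hu)
          rw [Finset.mem_bipartiteAbove, mem_WW hA]
          refine ⟨⟨?_, ?_⟩, b, hb, hbs, hb0, u, hu, rfl⟩
          · have h1 : l - Multiset.replicate (u * s) b + Multiset.replicate (u * s) b = l :=
              Multiset.sub_add_cancel (Multiset.le_count_iff_replicate_le.1 hu)
            have h2 := congrArg Multiset.sum h1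
            simp only [Multiset.sum_add, Multiset.sum_replicate, smul_eq_mul] at h2 ⊢
            rw [← hsum, ← h2]; ring
          · intro i hi
            rw [Multiset.mem_add] at hi
            rcases hi with hi | hi
            · exact hmem i (Multiset.mem_of_le (Multiset.sub_le_self _ _) hi)
            · rw [Multiset.eq_of_mem_replicate hi]; exact hs
  · intro m hm
    calc _ ≤ ((B ×ˢ Finset.range t).image (fun p : ℕ × ℕ =>
            m + Multiset.replicate (((m.count s - p.2) / p.1) * s) p.1
              - Multiset.replicate (((m.count s - p.2) / p.1) * p.1) s)).card := by
          apply Finset.card_le_card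
          intro l hl
          rw [Finset.mem_bipartiteBelow, Finset.mem_filter] at hl
          obtain ⟨⟨_, ht, _⟩, b, hb, hbs, hb0, u, hu, h⟩ := hl
          rw [Finset.mem_image]
          refine ⟨(b, l.count s), by simp [hb, ht], ?_⟩
          have h2 := congrArg (Multiset.count s) h
          simp only [Multiset.count_add, Multiset.count_sub, Multiset.count_replicate, if_neg hbs,
            if_true] at h2
          have hu' : (m.count s - l.count s) / b = u := by
            rw [h2, Nat.sub_zero, Nat.add_sub_cancel_left, Nat.mul_div_cancel _ hb0]
          simp only [hu']
          rw [h, add_right_comm, Multiset.sub_add_cancel (Multiset.le_count_iff_replicate_le.1 hu),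
            Multiset.add_sub_cancel_right]
      _ ≤ _ := by
          refine Finset.card_image_le.trans ?_
          rw [Finset.card_product, Finset.card_range]

open Classical in
lemma case2 {A : Set ℕ} (hA : ∀ i ∈ A, 0 < i) (n : ℕ) (B : Finset ℕ) (hBA : ∀ b ∈ B, b ∈ A)
    (L X K τ : ℕ) (hτ : 0 < τ)
    (hfill : ∀ x ≥ X, ∃ F : Finset (Multiset ℕ), K ≤ F.card ∧
      ∀ m ∈ F, m.sum = x ∧ ∀ i ∈ m, i ∈ B) :
    ((WW A n).filter (fun l => (∀ b ∈ B, l.count b < L) ∧ ∃ y, y ∉ B ∧ X ≤ τ * y ∧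
      τ ≤ l.count y)).card * K
      ≤ (WW A n).card * (L • B.val).powerset.toFinset.card := by
  apply Finset.card_mul_le_card_mul (fun l m => ∃ y, y ∉ B ∧ τ ≤ l.count y ∧ ∃ g : Multiset ℕ,
      (∀ i ∈ g, i ∈ B) ∧ m = l - Multiset.replicate τ y + g)
  · intro l hl
    rw [Finset.mem_filter, mem_WW hA] at hl
    obtain ⟨⟨hsum, hmem⟩, hL, y, hyB, hX, hy⟩ := hl
    obtain ⟨F, hK, hF⟩ := hfill _ hX
    refine hK.trans ?_
    rw [← Finset.card_image_of_injective F (add_right_injective (l - Multiset.replicate τ y))]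
    apply Finset.card_le_card
    intro m hm
    rw [Finset.mem_image] at hm
    obtain ⟨g, hg, rfl⟩ := hm
    rw [Finset.mem_bipartiteAbove, mem_WW hA]
    refine ⟨⟨?_, ?_⟩, y, hyB, hy, g, (hF g hg).2, rfl⟩
    · have h1 : l - Multiset.replicate τ y + Multiset.replicate τ y = l :=
        Multiset.sub_add_cancel (Multiset.le_count_iff_replicate_le.1 hy)
      have h2 := congrArg Multiset.sum h1
      simp only [Multiset.sum_add, Multiset.sum_replicate, smul_eq_mul] at h2 ⊢
      rw [(hF g hg).1, h2, hsum]
    · intro i hi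
      rw [Multiset.mem_add] at hi
      rcases hi with hi | hi
      · exact hmem i (Multiset.mem_of_le (Multiset.sub_le_self _ _) hi)
      · exact hBA i ((hF g hg).2 i hi)
  · intro m hm
    apply Finset.card_le_card_of_injOn (fun l => l.filter (· ∈ B))
    · intro l hl
      rw [Finset.mem_coe, Finset.mem_bipartiteBelow, Finset.mem_filter] at hl
      obtain ⟨⟨_, hL, _⟩, _⟩ := hl
      simp only [Finset.mem_coe, Multiset.mem_toFinset, Multiset.mem_powerset]
      rw [Multiset.le_iff_count]
      intro b
      rw [Multiset.count_filter, Multiset.count_nsmul]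
      split_ifs with hb
      · rw [Multiset.count_eq_one_of_mem B.nodup hb]
        have := hL b hb
        omega
      · exact Nat.zero_le _
    · have key : ∀ l ∈ (((WW A n).filter (fun l => (∀ b ∈ B, l.count b < L) ∧ ∃ y, y ∉ B ∧ X ≤ τ * y ∧
          τ ≤ l.count y)).bipartiteBelow (fun l m => ∃ y, y ∉ B ∧ τ ≤ l.count y ∧ ∃ g : Multiset ℕ,
          (∀ i ∈ g, i ∈ B) ∧ m = l - Multiset.replicate τ y + g) m), ∃ y,
          l = l.filter (· ∈ B) + m.filter (· ∉ B) + Multiset.replicate τ y ∧ l.sum = n := by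
        intro l hl
        rw [Finset.mem_bipartiteBelow, Finset.mem_filter, mem_WW hA] at hl
        obtain ⟨⟨⟨hs, _⟩, hL, _⟩, y, hyB, hy, g, hg, rfl⟩ := hl
        refine ⟨y, ?_, hs⟩
        ext i
        simp only [Multiset.count_add, Multiset.count_filter, Multiset.count_sub,
          Multiset.count_replicate]
        have hgi : i ∉ B → g.count i = 0 := fun h => Multiset.count_eq_zero.2 (fun h' => h (hg i h'))
        by_cases hi : i ∈ B
        · have : y ≠ i := by rintro rfl; exact hyB hi
          simp [hi, this]
        · by_cases hyi : y = i
          · subst hyi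
            simp [hi, hgi hi]; omega
          · simp [hi, hgi hi, hyi]
      intro l hl l' hl' h
      obtain ⟨y, h1, h2⟩ := key l hl
      obtain ⟨y', h1', h2'⟩ := key l' hl'
      simp only at h
      rw [← h] at h1'
      have e1 := congrArg Multiset.sum h1
      have e2 := congrArg Multiset.sum h1'
      simp only [Multiset.sum_add, Multiset.sum_replicate, smul_eq_mul] at e1 e2
      have : τ * y = τ * y' := by omega
      have := Nat.eq_of_mul_eq_mul_left hτ this
      rw [h1, h1', this]

lemma rare {A : Set ℕ} (hA : ∀ i ∈ A, 0 < i) (s : ℕ) (hs : s ∈ A) (B : Finset ℕ)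
    (hBA : ∀ b ∈ B, b ∈ A)
    (hfill : ∀ K : ℕ, ∃ X, ∀ x ≥ X, ∃ F : Finset (Multiset ℕ), K ≤ F.card ∧
      ∀ m ∈ F, m.sum = x ∧ ∀ i ∈ m, i ∈ B) (t : ℕ) (ε : ℝ) (hε : 0 < ε) :
    ∃ n0, ∀ n ≥ n0, (((WW A n).filter (fun l => l.count s < t)).card : ℝ) ≤ ε * (WW A n).card := by
  classical
  -- a multiplicative to real inequality conversion
  have conv : ∀ (c : ℕ), ∃ K : ℕ, ∀ x w : ℕ, x * K ≤ w * c → (x : ℝ) ≤ ε / 3 * w := by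
    intro c
    obtain ⟨K, hK⟩ := exists_nat_gt ((c : ℝ) / (ε / 3))
    refine ⟨K, fun x w h => ?_⟩
    have hε3 : 0 < ε / 3 := by positivity
    have hK0 : (0 : ℝ) < K := lt_of_le_of_lt (by positivity) hK
    rw [div_lt_iff₀ hε3] at hK
    have h' : (x : ℝ) * K ≤ w * c := by exact_mod_cast h
    have hw : (w : ℝ) * c ≤ w * (K * (ε / 3)) := mul_le_mul_of_nonneg_left hK.le (by positivity)
    have : (x : ℝ) * K ≤ (ε / 3 * w) * K := by linarith
    exact le_of_mul_le_mul_right this hK0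
  obtain ⟨M, hM⟩ := conv (B.card * t)
  set L := M * s + t + 1 with hLdef
  obtain ⟨K, hK⟩ := conv (L • B.val).powerset.toFinset.card
  obtain ⟨X, hX⟩ := hfill K
  refine ⟨(∑ y ∈ B ∪ Finset.range X, (L + X + 1) * y) + 1, fun n hn => ?_⟩
  have h1 := hM _ _ (case1 hA n s hs B t M)
  have h2 := hK _ _ (case2 hA n B hBA L X K 1 one_pos hX)
  have h3 := hK _ _ (case2 hA n B hBA L X K (X + 1) (Nat.succ_pos _) hX)
  set S1 := (WW A n).filter (fun l => l.count s < t ∧ ∃ b ∈ B, b ≠ s ∧ 0 < b ∧ M * s ≤ l.count b)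
  set S2 := (WW A n).filter (fun l => (∀ b ∈ B, l.count b < L) ∧ ∃ y, y ∉ B ∧ X ≤ 1 * y ∧
      1 ≤ l.count y)
  set S3 := (WW A n).filter (fun l => (∀ b ∈ B, l.count b < L) ∧ ∃ y, y ∉ B ∧ X ≤ (X + 1) * y ∧
      X + 1 ≤ l.count y)
  have hsub : (WW A n).filter (fun l => l.count s < t) ⊆ S1 ∪ S2 ∪ S3 := by
    intro l hl
    rw [Finset.mem_filter] at hl
    obtain ⟨hlW, ht⟩ := hl
    by_contra hcon
    simp only [Finset.mem_union, not_or] at hcon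
    obtain ⟨⟨c1, c2⟩, c3⟩ := hcon
    have hW := (mem_WW hA).1 hlW
    have hB : ∀ b ∈ B, l.count b < L := by
      intro b hb
      by_cases hbs : b = s
      · rw [hbs]; omega
      · by_contra hlt
        apply c1
        rw [Finset.mem_filter]
        exact ⟨hlW, ht, b, hb, hbs, hA b (hBA b hb), by omega⟩
    have hsup : l.toFinset ⊆ B ∪ Finset.range X := by
      intro y hy
      rw [Multiset.mem_toFinset] at hy
      rw [Finset.mem_union, Finset.mem_range]
      by_contra hc
      rw [not_or] at hc
      apply c2
      rw [Finset.mem_filter]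
      exact ⟨hlW, hB, y, hc.1, by omega, Multiset.one_le_count_iff_mem.2 hy⟩
    have hcnt : ∀ y ∈ l.toFinset, l.count y ≤ L + X + 1 := by
      intro y hy
      rw [Multiset.mem_toFinset] at hy
      by_cases hyB : y ∈ B
      · have := hB y hyB; omega
      · by_contra hc
        apply c3
        rw [Finset.mem_filter]
        have hy0 := hA y (hW.2 y hy)
        exact ⟨hlW, hB, y, hyB, by nlinarith, by omega⟩
    have hsum : l.sum ≤ ∑ y ∈ B ∪ Finset.range X, (L + X + 1) * y := by
      rw [Finset.sum_multiset_count]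
      refine le_trans (Finset.sum_le_sum (g := fun y => (L + X + 1) * y) ?_)
        (Finset.sum_le_sum_of_subset hsup)
      intro y hy
      rw [smul_eq_mul]
      exact Nat.mul_le_mul_right _ (hcnt y hy)
    rw [hW.1] at hsum
    omega
  have hc : ((WW A n).filter (fun l => l.count s < t)).card ≤ S1.card + S2.card + S3.card :=
    (Finset.card_le_card hsub).trans ((Finset.card_union_le _ _).trans
      (Nat.add_le_add_right (Finset.card_union_le _ _) _))
  have hc' : (((WW A n).filter (fun l => l.count s < t)).card : ℝ) ≤ S1.card + S2.card + S3.card := by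
    exact_mod_cast hc
  linarith

lemma mem_span_ms {t : Finset ℕ} {x : ℕ} (hx : x ∈ Submodule.span ℕ (t : Set ℕ)) :
    ∃ m : Multiset ℕ, m.sum = x ∧ ∀ i ∈ m, i ∈ t := by
  induction hx using Submodule.span_induction with
  | mem x h => exact ⟨{x}, by simp, by simpa using h⟩
  | zero => exact ⟨0, by simp, by simp⟩
  | add x y _ _ h1 h2 =>
    obtain ⟨a, ha, ha'⟩ := h1
    obtain ⟨b, hb, hb'⟩ := h2
    refine ⟨a + b, by simp [ha, hb], fun i hi => ?_⟩
    rcases Multiset.mem_add.1 hi with h | h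
    exacts [ha' i h, hb' i h]
  | smul c x _ h =>
    obtain ⟨a, ha, ha'⟩ := h
    exact ⟨c • a, by simp [ha, Multiset.sum_nsmul], fun i hi => ha' i (Multiset.mem_of_mem_nsmul hi)⟩

lemma fills {A : Set ℕ} (hinf : A.Infinite) (hg : Nat.setGcd A = 1) :
    ∃ B : Finset ℕ, (∀ b ∈ B, b ∈ A) ∧
    ∀ K : ℕ, ∃ X, ∀ x ≥ X, ∃ F : Finset (Multiset ℕ), K ≤ F.card ∧
      ∀ m ∈ F, m.sum = x ∧ ∀ i ∈ m, i ∈ B := by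
  classical
  obtain ⟨t, N, htA, hN⟩ := Nat.exists_mem_span_nat_finset_of_ge A
  obtain ⟨c, hcA, hct⟩ := hinf.exists_notMem_finset t
  refine ⟨insert c t, ?_, fun K => ⟨N + K * c, fun x hx => ?_⟩⟩
  · intro b hb
    rcases Finset.mem_insert.1 hb with h | h
    · rw [h]; exact hcA
    · exact htA h
  · have : ∀ i : ℕ, ∃ m : Multiset ℕ, i < K → m.sum = x - i * c ∧ ∀ j ∈ m, j ∈ t := by
      intro i
      by_cases hi : i < K
      · have : i * c ≤ K * c := Nat.mul_le_mul_right _ hi.le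
        obtain ⟨m, hm⟩ := mem_span_ms (hN (x - i * c) (by omega) (by rw [hg]; exact one_dvd _))
        exact ⟨m, fun _ => hm⟩
      · exact ⟨0, fun h => absurd h hi⟩
    choose g hgm using this
    refine ⟨(Finset.range K).image (fun i => g i + Multiset.replicate i c), ?_, ?_⟩
    · rw [Finset.card_image_of_injOn, Finset.card_range]
      intro i hi j hj h
      have h2 := congrArg (Multiset.count c) h
      have z : ∀ i < K, (g i).count c = 0 := fun i hi =>
        Multiset.count_eq_zero.2 (fun h' => hct ((hgm i hi).2 c h'))
      simp only [Finset.coe_range, Set.mem_Iio] at hi hj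
      simpa [z i hi, z j hj] using h2
    · intro m hm
      rw [Finset.mem_image] at hm
      obtain ⟨i, hi, rfl⟩ := hm
      have hi := Finset.mem_range.1 hi
      have : i * c ≤ K * c := Nat.mul_le_mul_right _ hi.le
      refine ⟨?_, fun j hj => ?_⟩
      · rw [Multiset.sum_add, (hgm i hi).1, Multiset.sum_replicate, smul_eq_mul]; omega
      · rw [Multiset.mem_add] at hj
        rcases hj with h | h
        · exact Finset.mem_insert_of_mem ((hgm i hi).2 j h)
        · rw [Multiset.eq_of_mem_replicate h]; exact Finset.mem_insert_self _ _

lemma rareU {A : Set ℕ} (hA : ∀ i ∈ A, 0 < i) (hinf : A.Infinite) (hg : Nat.setGcd A = 1)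
    (U : Multiset ℕ) (hU : ∀ i ∈ U, i ∈ A) (ε : ℝ) (hε : 0 < ε) :
    ∃ n0, ∀ n ≥ n0, (((WW A n).filter (fun l => ¬ U ≤ l)).card : ℝ) ≤ ε * (WW A n).card := by
  classical
  obtain ⟨B, hBA, hfill⟩ := fills hinf hg
  have h : ∀ s : ℕ, ∃ n0, s ∈ U → ∀ n ≥ n0,
      (((WW A n).filter (fun l => l.count s < U.count s)).card : ℝ)
        ≤ ε / (U.toFinset.card + 1) * (WW A n).card := by
    intro s
    by_cases hs : s ∈ U
    · obtain ⟨n0, h⟩ := rare hA s (hU s hs) B hBA hfill (U.count s) (ε / (U.toFinset.card + 1))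
        (by positivity)
      exact ⟨n0, fun _ => h⟩
    · exact ⟨0, fun h => absurd h hs⟩
  choose N hN using h
  refine ⟨U.toFinset.sup N, fun n hn => ?_⟩
  have hsub : (WW A n).filter (fun l => ¬ U ≤ l) ⊆
      U.toFinset.biUnion (fun s => (WW A n).filter (fun l => l.count s < U.count s)) := by
    intro l hl
    rw [Finset.mem_filter, Multiset.le_iff_count] at hl
    obtain ⟨h1, h2⟩ := hl
    push Not at h2
    obtain ⟨s, hs⟩ := h2
    rw [Finset.mem_biUnion]
    exact ⟨s, Multiset.mem_toFinset.2 (Multiset.count_pos.1 (by omega)), by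
      rw [Finset.mem_filter]; exact ⟨h1, hs⟩⟩
  have h1 := (Finset.card_le_card hsub).trans Finset.card_biUnion_le
  have h2 : (((WW A n).filter (fun l => ¬ U ≤ l)).card : ℝ) ≤
      ∑ s ∈ U.toFinset, (((WW A n).filter (fun l => l.count s < U.count s)).card : ℝ) := by
    exact_mod_cast h1
  refine h2.trans ((Finset.sum_le_card_nsmul _ _ (ε / (U.toFinset.card + 1) * (WW A n).card) ?_).trans ?_)
  · intro s hs
    exact hN s (Multiset.mem_toFinset.1 hs) n ((Finset.le_sup hs).trans hn)
  · rw [nsmul_eq_mul, ← mul_assoc]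
    apply mul_le_mul_of_nonneg_right _ (by positivity)
    rw [mul_div_assoc', div_le_iff₀ (by positivity)]
    nlinarith

noncomputable def PP (A : Set ℕ) (k n a : ℕ) : ℕ :=
  ((WW A n).filter (fun l => Multiset.card l % k = a % k)).card

lemma step {A : Set ℕ} (hA : ∀ i ∈ A, 0 < i) (k n : ℕ) (U V : Multiset ℕ)
    (hU : ∀ i ∈ U, i ∈ A) (hs : U.sum = V.sum)
    (hc : Multiset.card U ≡ Multiset.card V + 1 [MOD k]) (a : ℕ) :
    PP A k n a ≤ PP A k n (a + 1) + ((WW A n).filter (fun l => ¬ V ≤ l)).card := by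
  classical
  unfold PP
  rw [← Finset.card_filter_add_card_filter_not (s := (WW A n).filter (fun l => Multiset.card l % k = a % k))
    (fun l => V ≤ l)]
  apply Nat.add_le_add
  · apply Finset.card_le_card_of_injOn (fun l => l - V + U)
    · intro l hl
      simp only [Finset.mem_coe, Finset.mem_filter, mem_WW hA] at hl ⊢
      obtain ⟨⟨⟨h1, h2⟩, h3⟩, h4⟩ := hl
      have e := Multiset.sub_add_cancel h4
      have e1 := congrArg Multiset.sum e
      have e2 := congrArg Multiset.card e
      rw [Multiset.sum_add] at e1
      rw [Multiset.card_add] at e2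
      refine ⟨⟨?_, ?_⟩, ?_⟩
      · rw [Multiset.sum_add, hs, e1, h1]
      · intro i hi
        rcases Multiset.mem_add.1 hi with h | h
        · exact h2 i (Multiset.mem_of_le (Multiset.sub_le_self _ _) h)
        · exact hU i h
      · rw [Multiset.card_add]
        have h5 : Multiset.card l ≡ a [MOD k] := h3
        have := (Nat.ModEq.add_left (Multiset.card (l - V)) hc)
        rw [← add_assoc, e2] at this
        exact this.trans (h5.add_right 1)
    · intro l hl l' hl' h
      simp only [Finset.mem_coe, Finset.mem_filter] at hl hl'
      have := Multiset.add_left_inj.1 h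
      rw [← Multiset.sub_add_cancel hl.2, this, Multiset.sub_add_cancel hl'.2]
  · apply Finset.card_le_card
    intro l hl
    simp only [Finset.mem_filter] at hl ⊢
    exact ⟨hl.1.1, hl.2⟩

lemma step_iter {A : Set ℕ} (hA : ∀ i ∈ A, 0 < i) (k n : ℕ) (U V : Multiset ℕ)
    (hU : ∀ i ∈ U, i ∈ A) (hs : U.sum = V.sum)
    (hc : Multiset.card U ≡ Multiset.card V + 1 [MOD k]) (a j : ℕ) :
    PP A k n a ≤ PP A k n (a + j) + j * ((WW A n).filter (fun l => ¬ V ≤ l)).card := by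
  induction j with
  | zero => simp
  | succ j ih =>
    have := step hA k n U V hU hs hc (a + j)
    rw [← add_assoc, add_mul, one_mul]
    omega

lemma PP_sum (A : Set ℕ) (k n a : ℕ) (hk : 0 < k) :
    ∑ j ∈ Finset.range k, PP A k n (a + j) = (WW A n).card := by
  classical
  unfold PP
  rw [← Finset.card_biUnion]
  · congr 1
    ext l
    simp only [Finset.mem_biUnion, Finset.mem_filter, Finset.mem_range]
    constructor
    · rintro ⟨_, _, h, _⟩; exact h
    · intro h
      refine ⟨(Multiset.card l + (k - a % k)) % k, Nat.mod_lt _ hk, h, ?_⟩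
      have h1 := Nat.mod_lt a hk
      have : a + (Multiset.card l + (k - a % k)) = Multiset.card l + k * (a / k + 1) := by
        have := Nat.div_add_mod a k
        rw [mul_add]; omega
      rw [Nat.add_mod, Nat.mod_mod, ← Nat.add_mod, this, Nat.add_mul_mod_self_left]
  · intro i hi j hj hij
    rw [Function.onFun, Finset.disjoint_left]
    intro l h1 h2
    rw [Finset.mem_filter] at h1 h2
    apply hij
    have h3 : a + i ≡ a + j [MOD k] := h1.2.symm.trans h2.2
    have h4 := Nat.ModEq.add_left_cancel' a h3
    simp only [Finset.coe_range, Set.mem_Iio] at hi hj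
    exact Nat.ModEq.eq_of_lt_of_lt h4 hi hj

lemma main_abs {A : Set ℕ} (hA : ∀ i ∈ A, 0 < i) (hinf : A.Infinite) (hg : Nat.setGcd A = 1)
    (k : ℕ) (hk : 0 < k) (U V : Multiset ℕ)
    (hU : ∀ i ∈ U, i ∈ A) (hV : ∀ i ∈ V, i ∈ A) (hs : U.sum = V.sum)
    (hc : Multiset.card U ≡ Multiset.card V + 1 [MOD k]) (a : ℕ) :
    Filter.Tendsto (fun n : ℕ => (k : ℝ) * (PP A k n a : ℝ) / ((WW A n).card : ℝ))
      Filter.atTop (nhds 1) := by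
  rw [Metric.tendsto_atTop]
  intro ε hε
  obtain ⟨n0, h0⟩ := rareU hA hinf hg V hV (ε / (2 * k * k)) (by positivity)
  obtain ⟨B, hBA, hfill⟩ := fills hinf hg
  obtain ⟨X, hX⟩ := hfill 1
  refine ⟨max n0 X, fun n hn => ?_⟩
  have hE := h0 n (le_trans (le_max_left _ _) hn)
  obtain ⟨F, hF1, hF⟩ := hX n (le_trans (le_max_right _ _) hn)
  obtain ⟨m, hm⟩ := Finset.card_pos.1 hF1
  have hpos : 0 < (WW A n).card := Finset.card_pos.2
    ⟨m, (mem_WW hA).2 ⟨(hF m hm).1, fun i hi => hBA i ((hF m hm).2 i hi)⟩⟩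
  set E := ((WW A n).filter (fun l => ¬ V ≤ l)).card
  set w := (WW A n).card with hw
  have hper : PP A k n (a + k) = PP A k n a := by
    unfold PP; rw [Nat.add_mod_right]
  have h1 : ∀ j ∈ Finset.range k, PP A k n a ≤ PP A k n (a + j) + k * E := by
    intro j hj
    have h : PP A k n a ≤ PP A k n (a + j) + j * E := step_iter hA k n U V hU hs hc a j
    have : j * E ≤ k * E := Nat.mul_le_mul_right _ (Finset.mem_range.1 hj).le
    exact h.trans (by omega)
  have h2 : ∀ j ∈ Finset.range k, PP A k n (a + j) ≤ PP A k n a + k * E := by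
    intro j hj
    have hj := (Finset.mem_range.1 hj).le
    have h : PP A k n (a + j) ≤ PP A k n (a + j + (k - j)) + (k - j) * E :=
      step_iter hA k n U V hU hs hc (a + j) (k - j)
    rw [add_assoc, Nat.add_sub_cancel' hj, hper] at h
    have : (k - j) * E ≤ k * E := Nat.mul_le_mul_right _ (Nat.sub_le _ _)
    exact h.trans (by omega)
  have s1 := Finset.sum_le_sum h1
  have s2 := Finset.sum_le_sum h2
  rw [Finset.sum_add_distrib, PP_sum A k n a hk] at s1
  rw [PP_sum A k n a hk] at s2
  simp only [Finset.sum_const, Finset.card_range, smul_eq_mul] at s1 s2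
  have s1' : (k : ℝ) * PP A k n a ≤ w + k * (k * E) := by exact_mod_cast s1
  have s2' : (w : ℝ) ≤ k * (PP A k n a + k * E) := by exact_mod_cast s2
  have hwpos : (0 : ℝ) < w := by exact_mod_cast hpos
  have hkpos : (0 : ℝ) < k := by exact_mod_cast hk
  have hE' : (k : ℝ) * (k * E) ≤ ε / 2 * w := by
    calc (k : ℝ) * (k * E) ≤ k * (k * (ε / (2 * k * k) * w)) := by gcongr
      _ = ε / 2 * w := by field_simp
  have hew : 0 < ε * w := by positivity
  rw [Real.dist_eq, div_sub_one hwpos.ne', abs_div, abs_of_pos hwpos, div_lt_iff₀ hwpos, abs_lt]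
  constructor <;> linarith

/-- integer valued polynomials are periodic modulo every `d`. -/
lemma periodic (P : Polynomial ℚ) (f : ℤ → ℤ) (hfP : ∀ ℓ : ℤ, (f ℓ : ℚ) = P.eval (ℓ : ℚ))
    (d : ℕ) (hd : 0 < d) :
    ∃ M : ℤ, 0 < M ∧ ∀ ℓ j : ℤ, (d : ℤ) ∣ f (ℓ + M * j) - f ℓ := by
  obtain ⟨b, hbP⟩ := IsLocalization.exist_integer_multiples_of_finset (nonZeroDivisors ℤ)
    (P.support.image P.coeff)
  have hb0 : (b : ℤ) ≠ 0 := nonZeroDivisors.ne_zero b.2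
  have hQ : ∃ Q : Polynomial ℤ, Q.map (Int.castRingHom ℚ) = Polynomial.C ((b : ℤ) : ℚ) * P := by
    rw [← Polynomial.mem_lifts, Polynomial.lifts_iff_coeff_lifts]
    intro i
    rw [Polynomial.coeff_C_mul]
    by_cases hi : i ∈ P.support
    · obtain ⟨z, hz⟩ := hbP (P.coeff i) (Finset.mem_image_of_mem _ hi)
      exact ⟨z, by simpa [Algebra.smul_def] using hz⟩
    · rw [Polynomial.notMem_support_iff.1 hi, mul_zero]
      exact ⟨0, by simp⟩
  obtain ⟨Q, hQ⟩ := hQ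
  have hQf : ∀ ℓ : ℤ, Q.eval ℓ = b * f ℓ := by
    intro ℓ
    have h1 : ((Q.eval ℓ : ℤ) : ℚ) = (Q.map (Int.castRingHom ℚ)).eval (ℓ : ℚ) := by
      simp
    rw [hQ, Polynomial.eval_mul, Polynomial.eval_C, ← hfP] at h1
    exact_mod_cast h1
  refine ⟨d * |(b : ℤ)|, by positivity, fun ℓ j => ?_⟩
  have h := Polynomial.sub_dvd_eval_sub (ℓ + d * |(b : ℤ)| * j) ℓ Q
  rw [hQf, hQf, ← mul_sub] at h
  have h2 : (b : ℤ) * d ∣ (ℓ + d * |(b : ℤ)| * j) - ℓ := by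
    rw [add_sub_cancel_left]
    obtain ⟨c, hc⟩ := (dvd_abs (b : ℤ) b).2 dvd_rfl
    exact ⟨c * j, by rw [hc]; ring⟩
  exact Int.dvd_of_mul_dvd_mul_left hb0 (h2.trans h)

lemma exchange (A : Set ℕ) (k Pif : ℕ) (hcop : Nat.gcd k Pif = 1) (s0 : ℕ) (hs0 : s0 ∈ A)
    (hd : ∀ d : ℕ, (∀ s ∈ A, (d : ℤ) ∣ (s : ℤ) - s0) → d ∣ Pif) :
    ∃ U V : Multiset ℕ, (∀ i ∈ U, i ∈ A) ∧ (∀ i ∈ V, i ∈ A) ∧ U.sum = V.sum ∧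
      Multiset.card U ≡ Multiset.card V + 1 [MOD k] := by
  set H : AddSubgroup (ℤ × ℤ) := AddSubgroup.closure ((fun s : ℕ => ((1 : ℤ), (s : ℤ))) '' A)
    with hH
  have hrep : ∀ z ∈ H, ∃ U V : Multiset ℕ, (∀ i ∈ U, i ∈ A) ∧ (∀ i ∈ V, i ∈ A) ∧
      z.1 = (Multiset.card U : ℤ) - Multiset.card V ∧ z.2 = (U.sum : ℤ) - V.sum := by
    intro z hz
    induction hz using AddSubgroup.closure_induction with
    | mem x h =>
      obtain ⟨s, hs, rfl⟩ := h
      exact ⟨{s}, 0, by simpa using hs, by simp, by simp, by simp⟩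
    | zero => exact ⟨0, 0, by simp, by simp, by simp, by simp⟩
    | add x y _ _ h1 h2 =>
      obtain ⟨U, V, hU, hV, e1, e2⟩ := h1
      obtain ⟨U', V', hU', hV', e1', e2'⟩ := h2
      refine ⟨U + U', V + V', ?_, ?_, ?_, ?_⟩
      · intro i hi
        rcases Multiset.mem_add.1 hi with h | h
        exacts [hU i h, hU' i h]
      · intro i hi
        rcases Multiset.mem_add.1 hi with h | h
        exacts [hV i h, hV' i h]
      · simp [e1, e1']; ring
      · simp [e2, e2']; ring
    | neg x _ h =>
      obtain ⟨U, V, hU, hV, e1, e2⟩ := h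
      exact ⟨V, U, hV, hU, by simp [e1], by simp [e2]⟩
  have hmem : ∀ s ∈ A, ((1 : ℤ), (s : ℤ)) ∈ H := fun s hs =>
    AddSubgroup.subset_closure ⟨s, hs, rfl⟩
  have hPi : ((0 : ℤ), (Pif : ℤ)) ∈ H := by
    obtain ⟨g, hg⟩ := Int.subgroup_cyclic (H.comap (AddMonoidHom.inr ℤ ℤ))
    rw [← AddSubgroup.zmultiples_eq_closure] at hg
    have h1 : g.natAbs ∣ Pif := by
      apply hd
      intro s hs
      rw [Int.natAbs_dvd, ← Int.mem_zmultiples_iff, ← hg, AddSubgroup.mem_comap]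
      have := H.sub_mem (hmem s hs) (hmem s0 hs0)
      simpa using this
    have h2 : (Pif : ℤ) ∈ H.comap (AddMonoidHom.inr ℤ ℤ) := by
      rw [hg, Int.mem_zmultiples_iff]
      exact Int.natAbs_dvd.1 (Int.natCast_dvd_natCast.2 h1)
    simpa using h2
  have hbez := Nat.gcd_eq_gcd_ab k Pif
  rw [hcop] at hbez
  set x := Nat.gcdB k Pif
  have hfin : ((Pif : ℤ) * x, (0 : ℤ)) ∈ H := by
    have := H.sub_mem (H.zsmul_mem (hmem s0 hs0) (Pif * x)) (H.zsmul_mem hPi (x * s0))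
    convert this using 1
    ext
    · simp
    · simp; ring
  obtain ⟨U, V, hU, hV, e1, e2⟩ := hrep _ hfin
  refine ⟨U, V, hU, hV, by simp only at e2; omega, ?_⟩
  rw [← Int.natCast_modEq_iff, Int.modEq_iff_dvd]
  refine ⟨Nat.gcdA k Pif, ?_⟩
  simp only at e1
  push_cast at hbez ⊢
  linarith

def AA (f : ℤ → ℤ) : Set ℕ := {i | ∃ ℓ : ℤ, 1 ≤ ℓ ∧ (i : ℤ) = f ℓ}

lemma pf_eq (f : ℤ → ℤ) (n : ℕ) : pf f n = (WW (AA f) n).card := by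
  classical
  unfold pf WW
  rw [Nat.card_eq_fintype_card, Fintype.card_subtype, Finset.filter_image,
    Finset.card_image_of_injective _ (fun π π' h => Nat.Partition.ext h)]
  congr 1
  ext π
  simp only [Finset.mem_filter, Finset.mem_univ, true_and]
  rfl

lemma pfm_eq (f : ℤ → ℤ) (m n : ℕ) :
    pfm f m n = ((WW (AA f) n).filter (fun l => Multiset.card l = m)).card := by
  classical
  unfold pfm WW
  rw [Nat.card_eq_fintype_card, Fintype.card_subtype, Finset.filter_image, Finset.filter_image,
    Finset.card_image_of_injective _ (fun π π' h => Nat.Partition.ext h), Finset.filter_filter]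
  congr 1
  ext π
  simp only [Finset.mem_filter, Finset.mem_univ, true_and]
  rfl

lemma pfa_eq (f : ℤ → ℤ) (hA : ∀ i ∈ AA f, 0 < i) (a k n : ℕ) :
    pfa f a k n = PP (AA f) k n a := by
  classical
  unfold pfa PP
  simp only [pfm_eq]
  rw [Finset.card_eq_sum_card_fiberwise (f := fun l => Multiset.card l)
    (t := Finset.range (n + 1))]
  · apply Finset.sum_congr rfl
    intro m _
    rw [Finset.filter_filter]
    split_ifs with h
    · congr 1
      ext l
      simp only [Finset.mem_filter]
      constructor
      · rintro ⟨h1, rfl⟩; exact ⟨h1, h, rfl⟩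
      · rintro ⟨h1, _, h2⟩; exact ⟨h1, h2⟩
    · symm
      rw [Finset.card_eq_zero, Finset.filter_eq_empty_iff]
      rintro l _ ⟨h1, h2⟩
      rw [h2] at h1; exact h h1
  · intro l hl
    rw [Finset.mem_coe, Finset.mem_filter, mem_WW hA] at hl
    rw [Finset.mem_coe, Finset.mem_range, Nat.lt_succ_iff, ← hl.1.1]
    have := Multiset.card_nsmul_le_sum (s := l) (a := 1) (fun i hi => hA i (hl.1.2 i hi))
    simpa using this

theorem stmt4 (r : ℕ) (hr : 1 ≤ r) (P : Polynomial ℚ) (hPdeg : P.natDegree = r)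
    (hPlc : 0 < P.leadingCoeff)
    (f : ℤ → ℤ) (hfP : ∀ ℓ : ℤ, (f ℓ : ℚ) = P.eval (ℓ : ℚ))
    (hfpos : ∀ ℓ : ℤ, 1 ≤ ℓ → 0 < f ℓ)
    (hfprime : ∀ p : ℕ, p.Prime → ∃ ℓ : ℤ, ¬ ((p : ℤ) ∣ f ℓ))
    (Pif : ℕ) (hPifpos : 0 < Pif)
    (hPif : ∀ d : ℕ, d ∣ Pif ↔ ∀ ℓ : ℤ, (d : ℤ) ∣ (f ℓ - f 0))
    (a k : ℕ) (ha : 0 < a) (hk : 0 < k) (hcop : Nat.gcd k Pif = 1) :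
    Filter.Tendsto (fun n : ℕ => (k : ℝ) * (pfa f a k n : ℝ) / (pf f n : ℝ))
      Filter.atTop (nhds 1) := by
  have hAeq : ∀ ℓ : ℤ, 1 ≤ ℓ → ((f ℓ).toNat : ℤ) = f ℓ := fun ℓ h =>
    Int.toNat_of_nonneg (hfpos ℓ h).le
  have hmemA : ∀ ℓ : ℤ, 1 ≤ ℓ → (f ℓ).toNat ∈ AA f := fun ℓ h => ⟨ℓ, h, hAeq ℓ h⟩
  have hA : ∀ i ∈ AA f, 0 < i := by
    rintro i ⟨ℓ, h, e⟩
    have := hfpos ℓ h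
    omega
  -- shifting an integer to a positive one by a multiple of a period
  have hshift : ∀ M : ℤ, 0 < M → ∀ ℓ : ℤ, ∃ j : ℤ, 1 ≤ ℓ + M * j := by
    intro M hM ℓ
    refine ⟨|ℓ| + 1, ?_⟩
    have := neg_abs_le ℓ
    have := abs_nonneg ℓ
    nlinarith
  have hinf : (AA f).Infinite := by
    intro hfin
    have hcov : Set.Ici (1 : ℤ) ⊆ ⋃ i ∈ AA f, {ℓ : ℤ | f ℓ = i} := by
      intro ℓ hℓ
      simp only [Set.mem_iUnion]
      exact ⟨_, hmemA ℓ hℓ, (hAeq ℓ hℓ).symm⟩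
    refine (Set.Ici_infinite (1 : ℤ)) (Set.Finite.subset (hfin.biUnion fun i _ => ?_) hcov)
    have hne : P - Polynomial.C (i : ℚ) ≠ 0 := by
      intro h0
      have : P = Polynomial.C (i : ℚ) := sub_eq_zero.1 h0
      rw [this, Polynomial.natDegree_C] at hPdeg
      omega
    have hroots := (P - Polynomial.C (i : ℚ)).roots.toFinset.finite_toSet
    refine Set.Finite.subset (hroots.preimage (f := fun ℓ : ℤ => (ℓ : ℚ))
      (Int.cast_injective.injOn)) ?_
    intro ℓ hℓ
    have hℓ' : f ℓ = i := hℓ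
    have h2 := hfP ℓ
    rw [hℓ'] at h2
    simp only [Set.mem_preimage, Finset.mem_coe, Multiset.mem_toFinset]
    rw [Polynomial.mem_roots hne, Polynomial.IsRoot, Polynomial.eval_sub, Polynomial.eval_C, ← h2]
    simp
  have hg : Nat.setGcd (AA f) = 1 := by
    by_contra h1
    obtain ⟨p, hp, hpd⟩ := Nat.exists_prime_and_dvd h1
    rw [Nat.dvd_setGcd_iff] at hpd
    obtain ⟨ℓ, hℓ⟩ := hfprime p hp
    obtain ⟨M, hM, hper⟩ := periodic P f hfP p hp.pos
    obtain ⟨j, hj⟩ := hshift M hM ℓ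
    have h2 : (p : ℤ) ∣ f (ℓ + M * j) := by
      rw [← hAeq _ hj]
      exact Int.natCast_dvd_natCast.2 (hpd _ (hmemA _ hj))
    exact hℓ ((dvd_sub_right h2).1 (hper ℓ j))
  obtain ⟨U, V, hU, hV, hs, hc⟩ := exchange (AA f) k Pif hcop _ (hmemA 1 le_rfl) (by
    intro d hd
    rw [hAeq 1 le_rfl] at hd
    have hd' : ∀ ℓ : ℤ, 1 ≤ ℓ → (d : ℤ) ∣ f ℓ - f 1 := by
      intro ℓ h
      have := hd _ (hmemA ℓ h)
      rwa [hAeq ℓ h] at this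
    rcases Nat.eq_zero_or_pos d with rfl | hd0
    · exfalso
      apply hinf
      refine Set.Finite.subset (Set.finite_singleton (f 1).toNat) ?_
      rintro i ⟨ℓ, h, e⟩
      have := hd' ℓ h
      rw [Nat.cast_zero, zero_dvd_iff] at this
      rw [Set.mem_singleton_iff]
      omega
    · rw [hPif]
      obtain ⟨M, hM, hper⟩ := periodic P f hfP d hd0
      have hall : ∀ ℓ : ℤ, (d : ℤ) ∣ f ℓ - f 1 := by
        intro ℓ
        obtain ⟨j, hj⟩ := hshift M hM ℓ
        have h := dvd_sub (hd' _ hj) (hper ℓ j)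
        have e : f (ℓ + M * j) - f 1 - (f (ℓ + M * j) - f ℓ) = f ℓ - f 1 := by ring
        rwa [e] at h
      intro ℓ
      have h := dvd_sub (hall ℓ) (hall 0)
      have e : f ℓ - f 1 - (f 0 - f 1) = f ℓ - f 0 := by ring
      rwa [e] at h)
  have := main_abs hA hinf hg k hk U V hU hV hs hc a
  simpa only [pf_eq, pfa_eq f hA] using this
end
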